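/- With the Calderón–Zygmund decomposition, the truncated kernels and the sets F_s^n, 𝓘_s^{#,n} as in the context, there exist constants η > 0, δ > 0, C₀ and C' (depending only on d and the constants C, c₁, c₂) such that for every integer s ≥ 200, every w ∈ {0,1/2}^d and every n ≥ 1, ‖ sup_{l∈ℤ} | Σ_{K∈𝓘_s^{#,n} : l(K)≥2^l} T_{K,2} b_{k−s} | ‖_{L²(ℝ^d)} ≤ C' 2^{−n} (s² 2^{−δs} λ C_Ω ‖f‖_{L¹(ℝ^d)})^{1/2}. -/

import Mathlib

open MeasureTheory Metric Set FourierTransform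
open scoped ENNReal RealInnerProductSpace

noncomputable section

abbrev Rd (d : ℕ) : Type := EuclideanSpace ℝ (Fin d)

/-- Surface measure on the unit sphere `S^{d-1}`. -/
def sphereMeasure (d : ℕ) : Measure (sphere (0 : Rd d) 1) :=
  (volume : Measure (Rd d)).toSphere

/-- Integral over the sphere of a function defined on `ℝ^d`. -/
def sphInt (d : ℕ) (g : Rd d → ℝ) : ℝ :=
  ∫ θ : sphere (0 : Rd d) 1, g (θ : Rd d) ∂(sphereMeasure d)

/-- `‖Ω‖₁`, the `L¹(S^{d-1})` norm of `Ω`. -/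
def omegaL1 (d : ℕ) (Ω : Rd d → ℝ) : ℝ := sphInt d (fun x => |Ω x|)

/-- `‖Ω‖_{LlogL(S^{d-1})}`. -/
def omegaLlogL (d : ℕ) (Ω : Rd d → ℝ) : ℝ :=
  sphInt d (fun x => |Ω x| * Real.log (2 + |Ω x|))

/-- The constant `C_Ω`. -/
def constCOmega (d : ℕ) (Ω : Rd d → ℝ) : ℝ :=
  omegaLlogL d Ω +
    sphInt d (fun x => |Ω x| * (1 + max (Real.log (|Ω x| / omegaL1 d Ω)) 0))

/-- `Ω` is homogeneous of degree zero on `ℝ^d ∖ {0}`. -/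
def Homogeneous0 (d : ℕ) (Ω : Rd d → ℝ) : Prop :=
  ∀ x : Rd d, x ≠ 0 → ∀ r : ℝ, 0 < r → Ω (r • x) = Ω x

/-- The hypotheses on `Ω`: homogeneity of degree `0`, integrability on the sphere,
the cancellation condition, and `Ω ∈ L log L(S^{d-1})`. -/
def OmegaHyp (d : ℕ) (Ω : Rd d → ℝ) : Prop :=
  Homogeneous0 d Ω ∧
  Integrable (fun θ : sphere (0 : Rd d) 1 => Ω (θ : Rd d)) (sphereMeasure d) ∧
  (∫ θ : sphere (0 : Rd d) 1, Ω (θ : Rd d) ∂(sphereMeasure d)) = 0 ∧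
  Integrable (fun θ : sphere (0 : Rd d) 1 => |Ω (θ : Rd d)| * Real.log (2 + |Ω (θ : Rd d)|))
    (sphereMeasure d)

/-- `φ` is smooth, supported in the annulus `{2^{-4} < |x| < 2^{-2}}` and
satisfies the partition of unity condition `Σ_j φ(2^{-j} x) = 1` for `x ≠ 0`. -/
def AdmissiblePhi (d : ℕ) (φ : Rd d → ℝ) : Prop :=
  ContDiff ℝ (⊤ : ℕ∞) φ ∧
  tsupport φ ⊆ {x : Rd d | (2:ℝ) ^ (-4 : ℤ) < ‖x‖ ∧ ‖x‖ < (2:ℝ) ^ (-2 : ℤ)} ∧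
  ∀ x : Rd d, x ≠ 0 → HasSum (fun j : ℤ => φ ((2:ℝ) ^ (-j) • x)) 1

/-- The kernel `𝒦_j(x) = φ(2^{-j}x) Ω(x) |x|^{-d}`. -/
def Kker (d : ℕ) (φ Om : Rd d → ℝ) (j : ℤ) (x : Rd d) : ℝ :=
  φ ((2:ℝ) ^ (-j) • x) * Om x * ‖x‖ ^ (-(d : ℤ))

/-- The dyadic operator `T_j f = 𝒦_j * f`. -/
def Tj (d : ℕ) (φ Om : Rd d → ℝ) (j : ℤ) (f : Rd d → ℝ) (x : Rd d) : ℝ :=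
  ∫ y, Kker d φ Om j (x - y) * f y

/-- The maximal dyadic truncated operator `T_* f(x) = sup_l |Σ_{j ≥ l} T_j f(x)|`. -/
def TStar (d : ℕ) (φ Om f : Rd d → ℝ) (x : Rd d) : ℝ≥0∞ :=
  ⨆ l : ℤ, ENNReal.ofReal |∑' j : {j : ℤ // l ≤ j}, Tj d φ Om (j : ℤ) f x|

/-- The dyadic cube `2^k w + ∏_i [m_i 2^k, (m_i+1) 2^k)` in the shifted grid `𝔇^w`. -/
def dcube (d : ℕ) (w : Fin d → ℝ) (k : ℤ) (m : Fin d → ℤ) : Set (Rd d) :=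
  {x | ∀ i : Fin d, (2:ℝ) ^ k * (w i + m i) ≤ x i ∧ x i < (2:ℝ) ^ k * (w i + m i + 1)}

/-- The concentric cube `½K` of half the sidelength. -/
def dhalf (d : ℕ) (w : Fin d → ℝ) (k : ℤ) (m : Fin d → ℤ) : Set (Rd d) :=
  {x | ∀ i : Fin d,
    (2:ℝ) ^ k * (w i + m i + 1/4) ≤ x i ∧ x i < (2:ℝ) ^ k * (w i + m i + 3/4)}

/-- `w ∈ {0, 1/2}^d`. -/
def GridShift (d : ℕ) (w : Fin d → ℝ) : Prop := ∀ i, w i = 0 ∨ w i = 1/2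

/-- The Calderón–Zygmund decomposition data at level `λ/C_Ω`: a countable collection
`Qset` of pairwise disjoint standard dyadic cubes and bad functions `b_Q` with
`supp b_Q ⊆ Q`, `∫ b_Q = 0`, `‖b_Q‖₁ ≤ C⟨f⟩_Q |Q|` and `⟨f⟩_Q ≈ λ/C_Ω`. -/
structure CZData (d : ℕ) (COm Cc c₁ c₂ : ℝ) (f : Rd d → ℝ) (lam : ℝ)
    (Qset : Set (ℤ × (Fin d → ℤ))) (b : ℤ × (Fin d → ℤ) → Rd d → ℝ) : Prop where
  pairwise_disjoint : Qset.Pairwise fun q q' =>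
    Disjoint (dcube d 0 q.1 q.2) (dcube d 0 q'.1 q'.2)
  support_subset : ∀ q ∈ Qset, Function.support (b q) ⊆ dcube d 0 q.1 q.2
  integrable : ∀ q ∈ Qset, Integrable (b q)
  integral_zero : ∀ q ∈ Qset, (∫ x, b q x) = 0
  l1_bound : ∀ q ∈ Qset, (∫ x, |b q x|) ≤ Cc * ∫ x in dcube d 0 q.1 q.2, |f x|
  avg_lower : ∀ q ∈ Qset, c₁ * lam / COm ≤
    (∫ x in dcube d 0 q.1 q.2, |f x|) / (volume (dcube d 0 q.1 q.2)).toReal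
  avg_upper : ∀ q ∈ Qset,
    (∫ x in dcube d 0 q.1 q.2, |f x|) / (volume (dcube d 0 q.1 q.2)).toReal ≤ c₂ * lam / COm

/-- `b_m = Σ_{Q ∈ 𝒬, l(Q) = 2^m} b_Q`. -/
def bsum (d : ℕ) (Qset : Set (ℤ × (Fin d → ℤ))) (b : ℤ × (Fin d → ℤ) → Rd d → ℝ)
    (m : ℤ) (x : Rd d) : ℝ :=
  ∑' mv : Fin d → ℤ, Set.indicator Qset (fun q => b q x) (m, mv)

/-- `Ω₁ = Ω·χ_{{|Ω| ≥ 2^{ηs}‖Ω‖₁}}`. -/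
def Omega1 (d : ℕ) (Ω : Rd d → ℝ) (η : ℝ) (s : ℕ) (x : Rd d) : ℝ :=
  if (2:ℝ) ^ (η * s) * omegaL1 d Ω ≤ |Ω x| then Ω x else 0

/-- `Ω₂ = Ω·χ_{{|Ω| < 2^{ηs}‖Ω‖₁}}`. -/
def Omega2 (d : ℕ) (Ω : Rd d → ℝ) (η : ℝ) (s : ℕ) (x : Rd d) : ℝ :=
  if |Ω x| < (2:ℝ) ^ (η * s) * omegaL1 d Ω then Ω x else 0

/-- `T_K g = 𝒦_k * (g·χ_{½K})`, for `K ∈ 𝔇^w` with `l(K) = 2^k` given by `(k, m)`,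
where the kernel is built from the function `Om`. -/
def TKop (d : ℕ) (φ Om : Rd d → ℝ) (w : Fin d → ℝ) (k : ℤ) (m : Fin d → ℤ)
    (g : Rd d → ℝ) (x : Rd d) : ℝ :=
  ∫ y, Kker d φ Om k (x - y) * Set.indicator (dhalf d w k m) g y

/-- The exceptional sets `F_s^n`: `F_s^0 = ℝ^d` and `F_s^{n+1}` is the set where more than
`C₀2^{ds}` of the cubes `K ∈ 𝔇^w` with `K ⊆ F_s^n` and `b_{k-s}χ_{½K} ≠ 0` pile up. -/
def Fset (d : ℕ) (w : Fin d → ℝ) (Qset : Set (ℤ × (Fin d → ℤ)))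
    (b : ℤ × (Fin d → ℤ) → Rd d → ℝ) (s : ℕ) (C₀ : ℝ) : ℕ → Set (Rd d)
  | 0 => Set.univ
  | n + 1 =>
    {x | ENNReal.ofReal (C₀ * (2:ℝ) ^ (d * s)) <
      ∑' km : ℤ × (Fin d → ℤ),
        Set.indicator
          {km' : ℤ × (Fin d → ℤ) |
            dcube d w km'.1 km'.2 ⊆ Fset d w Qset b s C₀ n ∧
            ¬ ((dhalf d w km'.1 km'.2).indicator (bsum d Qset b (km'.1 - (s : ℤ)))
                =ᵐ[(volume : Measure (Rd d))] (fun _ => (0:ℝ)))}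
          (fun km' => (dcube d w km'.1 km'.2).indicator (fun _ => (1:ℝ≥0∞)) x) km}

/-- The partition classes `𝓘_s^{#,n}`: cubes `K ∈ 𝔇^w` with `b_{k-s}χ_{½K} ≠ 0`,
`K ⊆ F_s^{n-1}` and `K ⊄ F_s^n`. -/
def Isharp (d : ℕ) (w : Fin d → ℝ) (Qset : Set (ℤ × (Fin d → ℤ)))
    (b : ℤ × (Fin d → ℤ) → Rd d → ℝ) (s : ℕ) (C₀ : ℝ) (n : ℕ) :
    Set (ℤ × (Fin d → ℤ)) :=
  {km | ¬ ((dhalf d w km.1 km.2).indicator (bsum d Qset b (km.1 - (s : ℤ)))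
        =ᵐ[(volume : Measure (Rd d))] (fun _ => (0:ℝ))) ∧
    dcube d w km.1 km.2 ⊆ Fset d w Qset b s C₀ (n - 1) ∧
    ¬ dcube d w km.1 km.2 ⊆ Fset d w Qset b s C₀ n}

namespace RoughSingular

section Plancherel

variable {E : Type*} [NormedAddCommGroup E] [InnerProductSpace ℝ E] [FiniteDimensional ℝ E]
  [MeasurableSpace E] [BorelSpace E]

/-- The `L²` Fourier transform of an integrable function is its Fourier integral. -/
theorem Lp_fourier_ae_eq {f : E → ℂ} (hf : Integrable f) (hf2 : MemLp f 2 volume) :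
    (𝓕 (hf2.toLp f) : Lp ℂ 2 (volume : Measure E)) =ᵐ[volume] 𝓕 f := by
  have hcont : Continuous (𝓕 f) :=
    VectorFourier.fourierIntegral_continuous Real.continuous_fourierChar
      (by exact continuous_inner) hf
  refine ae_eq_of_integral_contDiff_smul_eq ?_ hcont.locallyIntegrable ?_
  · exact ((Lp.memLp _).locallyIntegrable (by norm_num))
  intro g hg hgc
  have hg₁ : HasCompactSupport (Complex.ofRealCLM ∘ g) := hgc.comp_left (map_zero _)
  have hg₂ : ContDiff ℝ ((⊤ : ℕ∞) : WithTop ℕ∞) (Complex.ofRealCLM ∘ g) := Complex.ofRealCLM.contDiff.comp hg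
  let G : SchwartzMap E ℂ := hg₁.toSchwartzMap hg₂
  have hG : ∀ x, G x = (g x : ℂ) := fun x => rfl
  have h1 := congrArg (fun T => T G) (Lp.fourier_toTemperedDistribution_eq (hf2.toLp f))
  simp only [TemperedDistribution.fourier_apply, Lp.toTemperedDistribution_apply] at h1
  have h2 : ∫ x, g x • (𝓕 (hf2.toLp f) : Lp ℂ 2 (volume : Measure E)) x
      = ∫ x, G x • (𝓕 (hf2.toLp f) : Lp ℂ 2 (volume : Measure E)) x := by
    simp [hG]
  rw [h2, ← h1]
  have h3 : ∫ x, (𝓕 G) x • (hf2.toLp f) x = ∫ x, (𝓕 (G : E → ℂ)) x • f x := by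
    refine integral_congr_ae ?_
    filter_upwards [hf2.coeFn_toLp] with x hx
    rw [hx, SchwartzMap.fourier_coe]
  have h4 : ∫ x, g x • 𝓕 f x = ∫ x, G x • 𝓕 f x := by
    simp [hG]
  rw [h3, h4]
  have := (VectorFourier.integral_fourierIntegral_smul_eq_flip (L := innerₗ E) (μ := volume)
    (ν := volume) (f := (G : E → ℂ)) (g := f)
      Real.continuous_fourierChar continuous_inner G.integrable hf)
  simpa using! this

/-- Plancherel's identity for functions in `L¹ ∩ L²`. -/
theorem lintegral_enorm_sq_fourier {f : E → ℂ} (hf : Integrable f) (hf2 : MemLp f 2 volume) :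
    ∫⁻ ξ, ‖𝓕 f ξ‖ₑ ^ (2:ℕ) = ∫⁻ x, ‖f x‖ₑ ^ (2:ℕ) := by
  have h := Lp.norm_fourier_eq (hf2.toLp f)
  have h' : ‖(𝓕 (hf2.toLp f) : Lp ℂ 2 (volume : Measure E))‖ₑ = ‖hf2.toLp f‖ₑ := by
    rw [← ofReal_norm, ← ofReal_norm, h]
  rw [Lp.enorm_def, Lp.enorm_def, eLpNorm_congr_ae (Lp_fourier_ae_eq hf hf2),
    eLpNorm_congr_ae hf2.coeFn_toLp] at h'
  rw [eLpNorm_eq_lintegral_rpow_enorm_toReal (by norm_num) (by norm_num),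
    eLpNorm_eq_lintegral_rpow_enorm_toReal (by norm_num) (by norm_num)] at h'
  have h'' := congrArg (fun t : ℝ≥0∞ => t ^ (2:ℝ)) h'
  simp only [← ENNReal.rpow_mul] at h''
  norm_num at h''
  exact h''

end Plancherel

theorem mul_exp_neg_sq_le (n : ℕ) {t : ℝ} (ht : 0 ≤ t) :
    t * Real.exp (-Real.pi * t ^ 2) ≤
      ((n + 1).factorial * Real.exp 2) * ((1 + t) ^ n)⁻¹ := by
  have h1 : (1 + t) ^ (n + 1) ≤ (n + 1).factorial * Real.exp (1 + t) := by
    have := Real.pow_div_factorial_le_exp (x := 1 + t) (by linarith) (n + 1)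
    rw [div_le_iff₀ (by positivity)] at this
    linarith
  have hpos : 0 < (1 + t) ^ n := by positivity
  rw [← div_eq_mul_inv, le_div_iff₀ hpos]
  have h2 : Real.exp (1 + t) * Real.exp (-Real.pi * t ^ 2) ≤ Real.exp 2 := by
    rw [← Real.exp_add]
    apply Real.exp_le_exp.2
    nlinarith [Real.pi_gt_three, sq_nonneg (t - 1), sq_nonneg t]
  calc t * Real.exp (-Real.pi * t ^ 2) * (1 + t) ^ n
      ≤ (1 + t) ^ (n + 1) * Real.exp (-Real.pi * t ^ 2) := by
        rw [show t * Real.exp (-Real.pi * t ^ 2) * (1 + t) ^ n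
          = ((1 + t) ^ n * t) * Real.exp (-Real.pi * t ^ 2) by ring]
        refine mul_le_mul_of_nonneg_right ?_ (Real.exp_pos _).le
        rw [pow_succ]
        exact mul_le_mul_of_nonneg_left (by linarith) hpos.le
    _ ≤ ((n + 1).factorial * Real.exp (1 + t)) * Real.exp (-Real.pi * t ^ 2) := by gcongr
    _ ≤ (n + 1).factorial * Real.exp 2 := by rw [mul_assoc]; gcongr

theorem abs_exp_neg_sq_sub_le (n : ℕ) {a b δ : ℝ} (ha : 0 ≤ a) (hb : 0 ≤ b) (hδ : |a - b| ≤ δ) :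
    |Real.exp (-Real.pi * a ^ 2) - Real.exp (-Real.pi * b ^ 2)| ≤
      2 * Real.pi * ((n + 1).factorial * Real.exp 2) * (δ * (1 + δ) ^ n) * ((1 + b) ^ n)⁻¹ := by
  have hδ0 : 0 ≤ δ := (abs_nonneg _).trans hδ
  have key : ∀ t ∈ uIcc a b, ‖-Real.pi * (2 * t) * Real.exp (-Real.pi * t ^ 2)‖ ≤
      2 * Real.pi * ((n + 1).factorial * Real.exp 2) * (1 + δ) ^ n * ((1 + b) ^ n)⁻¹ := by
    intro t ht
    have hts : 0 ≤ t ∧ b ≤ t + δ := by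
      rw [mem_uIcc] at ht
      rw [abs_le] at hδ
      rcases ht with h | h <;> constructor <;> linarith [h.1, h.2, hδ.1, hδ.2]
    obtain ⟨ht0, hbt⟩ := hts
    have h1 := mul_exp_neg_sq_le n ht0
    have h2 : ((1 + t) ^ n)⁻¹ ≤ (1 + δ) ^ n * ((1 + b) ^ n)⁻¹ := by
      rw [← div_eq_mul_inv, le_div_iff₀ (by positivity), inv_mul_le_iff₀ (by positivity),
        ← mul_pow]
      exact pow_le_pow_left₀ (by positivity) (by nlinarith) n
    rw [norm_mul, Real.norm_eq_abs, Real.norm_eq_abs, abs_of_pos (Real.exp_pos _)]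
    have : |-Real.pi * (2 * t)| = 2 * Real.pi * t := by
      rw [abs_mul, abs_neg, abs_of_pos Real.pi_pos, abs_of_nonneg (by positivity)]; ring
    rw [this]
    calc 2 * Real.pi * t * Real.exp (-Real.pi * t ^ 2)
        = 2 * Real.pi * (t * Real.exp (-Real.pi * t ^ 2)) := by ring
      _ ≤ 2 * Real.pi * (((n + 1).factorial * Real.exp 2) * ((1 + δ) ^ n * ((1 + b) ^ n)⁻¹)) := by
        refine mul_le_mul_of_nonneg_left (h1.trans ?_) (by positivity)
        gcongr
      _ = _ := by ring
  have hder : ∀ t ∈ uIcc a b, HasDerivWithinAt (fun t : ℝ => Real.exp (-Real.pi * t ^ 2))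
      (-Real.pi * (2 * t) * Real.exp (-Real.pi * t ^ 2)) (uIcc a b) t := by
    intro t _
    have := ((hasDerivAt_pow 2 t).const_mul (-Real.pi)).exp
    refine (this.hasDerivWithinAt).congr_deriv ?_
    simp only [Nat.cast_ofNat, Nat.add_one_sub_one, pow_one]
    ring
  have := (convex_uIcc a b).norm_image_sub_le_of_norm_hasDerivWithin_le hder key
    right_mem_uIcc left_mem_uIcc
  rw [Real.norm_eq_abs, Real.norm_eq_abs] at this
  refine this.trans ?_
  calc _ ≤ 2 * Real.pi * ((n + 1).factorial * Real.exp 2) * (1 + δ) ^ n * ((1 + b) ^ n)⁻¹ * δ := by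
        gcongr
    _ = _ := by ring

section GaussianEnergy

variable {E : Type*} [NormedAddCommGroup E] [InnerProductSpace ℝ E] [FiniteDimensional ℝ E]
  [MeasurableSpace E] [BorelSpace E]

/-- The `L¹`-normalised Gaussian at scale `σ`. -/
def gaussKer (E : Type*) [NormedAddCommGroup E] [InnerProductSpace ℝ E] (σ : ℝ) (u : E) : ℝ :=
  (σ ^ Module.finrank ℝ E)⁻¹ * Real.exp (-Real.pi * (‖u‖ / σ) ^ 2)

theorem gauss_re_pos {σ : ℝ} (hσ : 0 < σ) : 0 < ((Real.pi * σ ^ 2 : ℝ) : ℂ).re := by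
  rw [Complex.ofReal_re]
  positivity

theorem fourier_modulated_gaussian {σ : ℝ} (hσ : 0 < σ) (x y : E) :
    𝓕 (fun v : E => Complex.exp (-((Real.pi * σ ^ 2 : ℝ) : ℂ) * ‖v‖ ^ 2
      + 2 * Real.pi * Complex.I * ⟪x, v⟫)) y = (gaussKer E σ (x - y) : ℂ) := by
  rw [fourier_gaussian_innerProductSpace' (gauss_re_pos hσ)]
  unfold gaussKer
  push_cast
  have hπ : (Real.pi : ℂ) ≠ 0 := by exact_mod_cast Real.pi_ne_zero
  have hs : (σ : ℂ) ≠ 0 := by exact_mod_cast hσ.ne'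
  congr 1
  · have : (Real.pi : ℂ) / (Real.pi * σ ^ 2) = (((σ ^ 2)⁻¹ : ℝ) : ℂ) := by
      push_cast; field_simp
    rw [this]
    have h2 : ((Module.finrank ℝ E : ℂ) / 2) = (((Module.finrank ℝ E : ℝ) / 2 : ℝ) : ℂ) := by
      push_cast; rfl
    rw [h2, ← Complex.ofReal_cpow (by positivity)]
    norm_cast
    rw [Real.inv_rpow (by positivity), ← Real.rpow_natCast σ 2, ← Real.rpow_mul hσ.le]
    rw [show ((2:ℕ):ℝ) * ((Module.finrank ℝ E : ℝ) / 2) = (Module.finrank ℝ E : ℝ) by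
      push_cast; ring, Real.rpow_natCast]
  · congr 1
    field_simp

theorem integral_gaussian_mul_fourier_sq {σ : ℝ} (hσ : 0 < σ) {g : E → ℝ} (hg : Integrable g) :
    ∫ ξ, (Real.exp (-(Real.pi * σ ^ 2) * ‖ξ‖ ^ 2) : ℂ) *
        (𝓕 (fun x => (g x : ℂ)) ξ * (starRingEnd ℂ) (𝓕 (fun x => (g x : ℂ)) ξ)) =
      ∫ x, (g x : ℂ) * ((∫ y, gaussKer E σ (x - y) * g y : ℝ) : ℂ) := by
  set gc : E → ℂ := fun x => (g x : ℂ) with hgc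
  have hgi : Integrable gc := hg.ofReal
  have hcont : Continuous (𝓕 gc) :=
    VectorFourier.fourierIntegral_continuous Real.continuous_fourierChar
      (by exact continuous_inner) hgi
  have hbdd : ∀ ξ, ‖𝓕 gc ξ‖ ≤ ∫ x, ‖gc x‖ := fun ξ =>
    VectorFourier.norm_fourierIntegral_le_integral_norm _ _ _ _ _
  have hconj : ∀ ξ, (starRingEnd ℂ) (𝓕 gc ξ) = 𝓕 gc (-ξ) := by
    intro ξ
    rw [Real.fourier_eq', Real.fourier_eq', ← integral_conj]
    congr 1; ext v
    simp only [smul_eq_mul, map_mul, hgc, Complex.conj_ofReal, ← Complex.exp_conj]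
    simp
  have hgauss : Integrable (fun v : E => Complex.exp (-((Real.pi * σ ^ 2 : ℝ) : ℂ) * ‖v‖ ^ 2)) := by
    simpa using GaussianFourier.integrable_cexp_neg_mul_sq_norm_add (V := E)
      (b := ((Real.pi * σ ^ 2 : ℝ) : ℂ)) (gauss_re_pos hσ) 0 0
  have hgx : ∀ x : E, Integrable (fun v : E => Complex.exp (-((Real.pi * σ ^ 2 : ℝ) : ℂ) * ‖v‖ ^ 2
      + 2 * Real.pi * Complex.I * ⟪x, v⟫)) := fun x =>
    GaussianFourier.integrable_cexp_neg_mul_sq_norm_add (V := E)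
      (b := ((Real.pi * σ ^ 2 : ℝ) : ℂ)) (gauss_re_pos hσ) _ x
  have hh : Integrable (fun ξ : E => Complex.exp (-((Real.pi * σ ^ 2 : ℝ) : ℂ) * ‖ξ‖ ^ 2)
      * 𝓕 gc (-ξ)) := by
    refine hgauss.mul_bdd (c := ∫ x, ‖gc x‖) (hcont.comp continuous_neg).aestronglyMeasurable ?_
    exact Filter.Eventually.of_forall fun ξ => hbdd _
  have e1 : ∫ ξ, (Real.exp (-(Real.pi * σ ^ 2) * ‖ξ‖ ^ 2) : ℂ) *
      (𝓕 gc ξ * (starRingEnd ℂ) (𝓕 gc ξ)) =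
      ∫ ξ, 𝓕 gc ξ • (Complex.exp (-((Real.pi * σ ^ 2 : ℝ) : ℂ) * ‖ξ‖ ^ 2) * 𝓕 gc (-ξ)) := by
    congr 1; ext ξ
    rw [hconj]; push_cast; rw [smul_eq_mul]; ring
  rw [e1]
  have e2 := VectorFourier.integral_fourierIntegral_smul_eq_flip (L := innerₗ E) (μ := volume)
    (ν := volume) Real.continuous_fourierChar continuous_inner hgi hh
  have e2' : ∫ ξ, 𝓕 gc ξ • (Complex.exp (-((Real.pi * σ ^ 2 : ℝ) : ℂ) * ‖ξ‖ ^ 2) * 𝓕 gc (-ξ)) =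
      ∫ x, gc x • 𝓕 (fun ξ : E => Complex.exp (-((Real.pi * σ ^ 2 : ℝ) : ℂ) * ‖ξ‖ ^ 2)
        * 𝓕 gc (-ξ)) x := by
    simpa using! e2
  rw [e2']
  congr 1; ext x
  rw [smul_eq_mul]
  congr 1
  have e3 := VectorFourier.integral_fourierIntegral_smul_eq_flip (L := innerₗ E) (μ := volume)
    (ν := volume) Real.continuous_fourierChar continuous_inner (hgx x) hgi
  have e3' : ∫ ξ, 𝓕 (fun v : E => Complex.exp (-((Real.pi * σ ^ 2 : ℝ) : ℂ) * ‖v‖ ^ 2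
      + 2 * Real.pi * Complex.I * ⟪x, v⟫)) ξ • gc ξ = ∫ v, Complex.exp
        (-((Real.pi * σ ^ 2 : ℝ) : ℂ) * ‖v‖ ^ 2 + 2 * Real.pi * Complex.I * ⟪x, v⟫) • 𝓕 gc v := by
    simpa using! e3
  simp_rw [fourier_modulated_gaussian hσ] at e3'
  rw [Real.fourier_eq', ← integral_neg_eq_self]
  have e4 : ∫ y, ((gaussKer E σ (x - y) : ℝ) : ℂ) • gc y
      = ((∫ y, gaussKer E σ (x - y) * g y : ℝ) : ℂ) := by
    refine Eq.trans ?_ (integral_ofReal (𝕜 := ℂ))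
    congr 1; ext y; simp [hgc]
  rw [← e4, e3']
  congr 1; ext v
  simp only [smul_eq_mul, norm_neg, neg_neg, inner_neg_left]
  rw [Complex.exp_add, real_inner_comm]
  push_cast
  ring_nf

theorem lintegral_gaussian_mul_fourier_sq_le {σ : ℝ} (hσ : 0 < σ) {g : E → ℝ}
    (hg : Integrable g) {B : ℝ} (hB : ∀ x, |∫ y, gaussKer E σ (x - y) * g y| ≤ B) :
    ∫⁻ ξ, ENNReal.ofReal (Real.exp (-(Real.pi * σ ^ 2) * ‖ξ‖ ^ 2)) *
        ‖𝓕 (fun x => (g x : ℂ)) ξ‖ₑ ^ 2 ≤ ENNReal.ofReal (B * ∫ x, |g x|) := by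
  set gc : E → ℂ := fun x => (g x : ℂ) with hgc
  have hgi : Integrable gc := hg.ofReal
  have hcont : Continuous (𝓕 gc) :=
    VectorFourier.fourierIntegral_continuous Real.continuous_fourierChar
      (by exact continuous_inner) hgi
  have hbdd : ∀ ξ, ‖𝓕 gc ξ‖ ≤ ∫ x, ‖gc x‖ := fun ξ =>
    VectorFourier.norm_fourierIntegral_le_integral_norm _ _ _ _ _
  have hgauss : Integrable (fun v : E => Real.exp (-(Real.pi * σ ^ 2) * ‖v‖ ^ 2)) := by
    have := (GaussianFourier.integrable_cexp_neg_mul_sq_norm_add (V := E)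
      (b := ((Real.pi * σ ^ 2 : ℝ) : ℂ)) (gauss_re_pos hσ) 0 0).norm
    refine this.congr (Filter.Eventually.of_forall fun v => ?_)
    simp [Complex.norm_exp, ← Complex.ofReal_pow]
  have hInt : Integrable (fun ξ : E => Real.exp (-(Real.pi * σ ^ 2) * ‖ξ‖ ^ 2) * ‖𝓕 gc ξ‖ ^ 2) := by
    refine hgauss.mul_bdd (c := (∫ x, ‖gc x‖) ^ 2) (by fun_prop) ?_
    refine Filter.Eventually.of_forall fun ξ => ?_
    rw [norm_pow, norm_norm]
    exact pow_le_pow_left₀ (norm_nonneg _) (hbdd ξ) 2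
  have e1 : ∫⁻ ξ, ENNReal.ofReal (Real.exp (-(Real.pi * σ ^ 2) * ‖ξ‖ ^ 2)) * ‖𝓕 gc ξ‖ₑ ^ 2 =
      ENNReal.ofReal (∫ ξ, Real.exp (-(Real.pi * σ ^ 2) * ‖ξ‖ ^ 2) * ‖𝓕 gc ξ‖ ^ 2) := by
    rw [ofReal_integral_eq_lintegral_ofReal hInt
      (Filter.Eventually.of_forall fun ξ => by positivity)]
    congr 1; ext ξ
    rw [ENNReal.ofReal_mul (Real.exp_pos _).le, ← ofReal_norm, ENNReal.ofReal_pow (norm_nonneg _)]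
  rw [e1]
  apply ENNReal.ofReal_le_ofReal
  have e2 := integral_gaussian_mul_fourier_sq hσ hg
  have e3 : ((∫ ξ, Real.exp (-(Real.pi * σ ^ 2) * ‖ξ‖ ^ 2) * ‖𝓕 gc ξ‖ ^ 2 : ℝ) : ℂ) =
      ((∫ x, g x * ∫ y, gaussKer E σ (x - y) * g y : ℝ) : ℂ) := by
    refine (integral_ofReal (𝕜 := ℂ)).symm.trans (Eq.trans ?_ (integral_ofReal (𝕜 := ℂ)))
    refine Eq.trans (integral_congr_ae (Filter.Eventually.of_forall fun ξ => ?_))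
      (e2.trans (integral_congr_ae (Filter.Eventually.of_forall fun x => ?_)))
    · simp only [Complex.mul_conj, Complex.normSq_eq_norm_sq]
      simp [hgc]
    · simp
  rw [Complex.ofReal_inj] at e3
  rw [e3]
  refine (le_abs_self _).trans (abs_integral_le_integral_abs.trans ?_)
  rw [← integral_const_mul]
  refine integral_mono_of_nonneg (Filter.Eventually.of_forall fun x => abs_nonneg _)
    (hg.abs.const_mul B) (Filter.Eventually.of_forall fun x => ?_)
  simp only [abs_mul]
  rw [mul_comm]
  exact mul_le_mul_of_nonneg_right (hB x) (abs_nonneg _)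

end GaussianEnergy

section GaussKer

variable {E : Type*} [NormedAddCommGroup E] [InnerProductSpace ℝ E]

theorem continuous_gaussKer (σ : ℝ) : Continuous (gaussKer E σ) := by
  unfold gaussKer; fun_prop

theorem gaussKer_bound {σ : ℝ} (hσ : 0 < σ) (u : E) : ‖gaussKer E σ u‖ ≤
    (σ ^ Module.finrank ℝ E)⁻¹ := by
  unfold gaussKer
  rw [norm_mul, Real.norm_of_nonneg (by positivity), Real.norm_of_nonneg (Real.exp_pos _).le]
  refine mul_le_of_le_one_right (by positivity) (Real.exp_le_one_iff.2 ?_)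
  nlinarith [Real.pi_pos, sq_nonneg (‖u‖ / σ)]

end GaussKer

section GaussianAtoms

variable {E : Type*} [NormedAddCommGroup E] [InnerProductSpace ℝ E] [FiniteDimensional ℝ E]
  [MeasurableSpace E] [BorelSpace E]

theorem integrable_inv_one_add_norm_pow :
    Integrable (fun v : E => ((1 + ‖v‖) ^ (Module.finrank ℝ E + 1))⁻¹) := by
  have := integrable_one_add_norm (E := E) (μ := volume)
    (r := ((Module.finrank ℝ E + 1 : ℕ) : ℝ)) (by push_cast; linarith)
  refine this.congr (Filter.Eventually.of_forall fun v => ?_)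
  simp only
  rw [Real.rpow_neg (by positivity), Real.rpow_natCast]

/-- The constant in the smoothing estimate for Gaussian averages of atoms. -/
def gaussConst (E : Type*) [NormedAddCommGroup E] [InnerProductSpace ℝ E] [FiniteDimensional ℝ E]
    [MeasurableSpace E] [BorelSpace E] : ℝ :=
  2 * Real.pi * ((Module.finrank ℝ E + 1 + 1).factorial * Real.exp 2) *
    ∫ v : E, ((1 + ‖v‖) ^ (Module.finrank ℝ E + 1))⁻¹

theorem gaussConst_nonneg : 0 ≤ gaussConst E := by
  unfold gaussConst
  have : 0 ≤ ∫ v : E, ((1 + ‖v‖) ^ (Module.finrank ℝ E + 1))⁻¹ :=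
    integral_nonneg fun v => by positivity
  positivity

theorem abs_integral_gaussKer_mul_sum_le {ι : Type*} (F : Finset ι) (Q : ι → Set E)
    (b : ι → E → ℝ) {σ D α : ℝ} (hσ : 0 < σ) (hD : 0 ≤ D) (hα : 0 ≤ α)
    (hQm : ∀ i ∈ F, MeasurableSet (Q i)) (hQd : (F : Set ι).Pairwise fun i j => Disjoint (Q i) (Q j))
    (hQ0 : ∀ i ∈ F, volume (Q i) ≠ 0) (hQt : ∀ i ∈ F, volume (Q i) ≠ ⊤)
    (hdiam : ∀ i ∈ F, ∀ x ∈ Q i, ∀ y ∈ Q i, ‖x - y‖ ≤ D)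
    (hb : ∀ i ∈ F, Integrable (b i)) (hsupp : ∀ i ∈ F, Function.support (b i) ⊆ Q i)
    (hmean : ∀ i ∈ F, ∫ x, b i x = 0)
    (hbα : ∀ i ∈ F, ∫ x, |b i x| ≤ α * (volume (Q i)).toReal) (x : E) :
    |∫ y, gaussKer E σ (x - y) * ∑ i ∈ F, b i y| ≤
      gaussConst E * (D / σ * (1 + D / σ) ^ (Module.finrank ℝ E + 1)) * α := by
  set n := Module.finrank ℝ E + 1 with hn
  set δ := D / σ with hδ
  have hδ0 : 0 ≤ δ := by positivity
  set C1 := 2 * Real.pi * ((n + 1).factorial * Real.exp 2) * (δ * (1 + δ) ^ n) with hC1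
  have hC10 : 0 ≤ C1 := by positivity
  set H : E → ℝ := fun v => (σ ^ Module.finrank ℝ E)⁻¹ * C1 * ((1 + ‖(σ⁻¹) • v‖) ^ n)⁻¹ with hH
  have hHnn : ∀ v, 0 ≤ H v := fun v => by positivity
  have hHint : Integrable H :=
    ((integrable_inv_one_add_norm_pow (E := E)).comp_smul (inv_ne_zero hσ.ne')).const_mul _
  have hHval : ∫ v, H v = gaussConst E * (δ * (1 + δ) ^ n) := by
    rw [hH, integral_const_mul]
    have := Measure.integral_comp_smul (volume : Measure E)
      (fun v : E => ((1 + ‖v‖) ^ n)⁻¹) (σ⁻¹)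
    rw [this, gaussConst, hC1, smul_eq_mul]
    have : |((σ⁻¹) ^ Module.finrank ℝ E)⁻¹| = σ ^ Module.finrank ℝ E := by
      rw [inv_pow, inv_inv, abs_of_nonneg (by positivity)]
    rw [this]
    have hs : σ ^ Module.finrank ℝ E ≠ 0 := by positivity
    rw [hn]
    field_simp
  have hGdiff : ∀ i ∈ F, ∀ y ∈ Q i, ∀ y' ∈ Q i,
      |gaussKer E σ (x - y) - gaussKer E σ (x - y')| ≤ H (x - y') := by
    intro i hi y hy y' hy'
    have h1 : |‖x - y‖ / σ - ‖x - y'‖ / σ| ≤ δ := by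
      rw [← sub_div, abs_div, abs_of_pos hσ, hδ]
      gcongr
      refine (abs_norm_sub_norm_le _ _).trans ?_
      rw [sub_sub_sub_cancel_left]
      exact hdiam i hi _ hy' _ hy
    have h2 := abs_exp_neg_sq_sub_le n (a := ‖x - y‖ / σ) (b := ‖x - y'‖ / σ)
      (by positivity) (by positivity) h1
    unfold gaussKer
    rw [← mul_sub, abs_mul, abs_of_nonneg (by positivity : 0 ≤ (σ ^ Module.finrank ℝ E)⁻¹)]
    simp only [hH]
    rw [norm_smul, norm_inv, Real.norm_of_nonneg hσ.le, mul_assoc]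
    refine mul_le_mul_of_nonneg_left (h2.trans (le_of_eq ?_)) (by positivity)
    rw [div_eq_inv_mul]
  have hGb : ∀ i ∈ F, Integrable fun y => gaussKer E σ (x - y) * b i y := by
    intro i hi
    refine (hb i hi).bdd_mul (c := (σ ^ Module.finrank ℝ E)⁻¹)
      ((continuous_gaussKer σ).comp (continuous_const.sub continuous_id)).aestronglyMeasurable ?_
    exact Filter.Eventually.of_forall fun y => gaussKer_bound hσ _
  have hone : ∀ i ∈ F, |∫ y, gaussKer E σ (x - y) * b i y| ≤ α * ∫ y in Q i, H (x - y) := by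
    intro i hi
    have hpt : ∀ y' ∈ Q i, |∫ y, gaussKer E σ (x - y) * b i y| ≤
        (α * (volume (Q i)).toReal) * H (x - y') := by
      intro y' hy'
      have e1 : ∫ y, gaussKer E σ (x - y) * b i y =
          ∫ y, (gaussKer E σ (x - y) - gaussKer E σ (x - y')) * b i y := by
        simp_rw [sub_mul]
        rw [integral_sub (hGb i hi) ((hb i hi).const_mul _), integral_const_mul, hmean i hi]
        simp
      rw [e1]
      refine abs_integral_le_integral_abs.trans ?_
      refine le_trans ?_ (mul_le_mul_of_nonneg_right (hbα i hi) (hHnn _))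
      rw [← integral_mul_const]
      refine integral_mono_of_nonneg (Filter.Eventually.of_forall fun y => abs_nonneg _)
        ((hb i hi).abs.mul_const _) (Filter.Eventually.of_forall fun y => ?_)
      simp only [abs_mul]
      by_cases hy : y ∈ Q i
      · rw [mul_comm]
        exact mul_le_mul_of_nonneg_left (hGdiff i hi y hy y' hy') (abs_nonneg _)
      · have : b i y = 0 := by
          by_contra h; exact hy (hsupp i hi h)
        simp [this]
    have hvol : 0 < (volume (Q i)).toReal := ENNReal.toReal_pos (hQ0 i hi) (hQt i hi)
    have hInt : (volume (Q i)).toReal * |∫ y, gaussKer E σ (x - y) * b i y| ≤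
        (α * (volume (Q i)).toReal) * ∫ y in Q i, H (x - y) := by
      rw [← integral_const_mul]
      have := setIntegral_mono_on (μ := volume) (s := Q i)
        (f := fun _ => |∫ y, gaussKer E σ (x - y) * b i y|)
        (g := fun y' => (α * (volume (Q i)).toReal) * H (x - y'))
        (integrableOn_const (hQt i hi)) ((hHint.comp_sub_left x).const_mul _).integrableOn
        (hQm i hi) hpt
      simpa [setIntegral_const, measureReal_def] using this
    refine le_of_mul_le_mul_left (hInt.trans (le_of_eq ?_)) hvol
    ring
  simp_rw [Finset.mul_sum]
  rw [integral_finsetSum _ hGb]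
  refine (Finset.abs_sum_le_sum_abs _ _).trans ((Finset.sum_le_sum hone).trans ?_)
  rw [← Finset.mul_sum, mul_comm _ α]
  refine mul_le_mul_of_nonneg_left ?_ hα
  rw [← integral_biUnion_finset F hQm hQd fun i _ => (hHint.comp_sub_left x).integrableOn,
    ← hHval, ← integral_sub_left_eq_self H volume x]
  exact setIntegral_le_integral (hHint.comp_sub_left x)
    (Filter.Eventually.of_forall fun y => hHnn _)

end GaussianAtoms

section Polar

variable {E : Type*} [NormedAddCommGroup E] [NormedSpace ℝ E] [FiniteDimensional ℝ E]
  [Nontrivial E] [MeasurableSpace E] [BorelSpace E] (μ : Measure E) [μ.IsAddHaarMeasure]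

theorem integral_eq_integral_polar {F : E → ℂ} (hF : Integrable F μ) :
    ∫ x, F x ∂μ = ∫ θ : sphere (0 : E) 1, (∫ r in Ioi (0 : ℝ),
      (r ^ (Module.finrank ℝ E - 1)) • F (r • (θ : E))) ∂μ.toSphere := by
  have hmp := μ.measurePreserving_homeomorphUnitSphereProd
  have hme : MeasurableEmbedding (homeomorphUnitSphereProd E) :=
    (homeomorphUnitSphereProd E).measurableEmbedding
  let G : sphere (0 : E) 1 × Ioi (0 : ℝ) → ℂ := fun p => F (p.2.1 • p.1.1)
  have hG : G ∘ homeomorphUnitSphereProd E = fun x : ({0}ᶜ : Set E) => F x := by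
    ext x
    simp only [Function.comp, G]
    congr 1
    simp [smul_smul, mul_inv_cancel₀ (norm_ne_zero_iff.2 x.2)]
  have hFi : Integrable (fun x : ({0}ᶜ : Set E) => F x) (μ.comap (↑)) := by
    have := hF.integrableOn (s := ({0}ᶜ : Set E))
    rwa [integrableOn_iff_comap_subtypeVal (measurableSet_singleton _).compl] at this
  have hGi : Integrable G (μ.toSphere.prod (.volumeIoiPow (Module.finrank ℝ E - 1))) := by
    rw [← hmp.integrable_comp_emb hme, hG]
    exact hFi
  calc ∫ x, F x ∂μ = ∫ x : ({0}ᶜ : Set E), F x ∂(μ.comap (↑)) := by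
        rw [integral_subtype_comap (measurableSet_singleton _).compl F,
          restrict_compl_singleton]
    _ = ∫ p, G p ∂(μ.toSphere.prod (.volumeIoiPow (Module.finrank ℝ E - 1))) := by
        rw [← hmp.integral_comp hme, ← hG]
        rfl
    _ = _ := by
        rw [integral_prod _ hGi]
        congr 1; ext θ
        simp only [Measure.volumeIoiPow, ENNReal.ofReal, G]
        rw [integral_withDensity_eq_integral_smul
          ((measurable_subtype_coe.pow_const _).real_toNNReal),
          integral_subtype_comap measurableSet_Ioi
            fun a : ℝ => Real.toNNReal (a ^ (Module.finrank ℝ E - 1)) • F (a • (θ : E))]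
        refine setIntegral_congr_fun measurableSet_Ioi fun x hx => ?_
        rw [NNReal.smul_def, Real.coe_toNNReal _ (pow_nonneg (le_of_lt hx) _)]

theorem norm_integral_le_of_radial {F : E → ℂ} (hF : Integrable F μ) {B : ℝ}
    (h : ∀ θ : E, ‖θ‖ = 1 → ‖∫ r in Ioi (0 : ℝ), (r ^ (Module.finrank ℝ E - 1)) • F (r • θ)‖ ≤ B) :
    ‖∫ x, F x ∂μ‖ ≤ B * μ.toSphere.real univ := by
  rw [integral_eq_integral_polar μ hF]
  exact norm_integral_le_of_norm_le_const
    (Filter.Eventually.of_forall fun θ => h θ (by simp))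

end Polar

section Radial

theorem integral_mul_cexp_eq {a : ℝ → ℝ} (ha : ContDiff ℝ 1 a) (h0 : a 0 = 0) (h1 : a 1 = 0)
    {z : ℂ} (hz : z ≠ 0) :
    ∫ r in (0:ℝ)..1, (a r : ℂ) * Complex.exp (z * r) =
      -z⁻¹ * ∫ r in (0:ℝ)..1, ((deriv a r : ℝ) : ℂ) * Complex.exp (z * r) := by
  have hu : ∀ x : ℝ, HasDerivAt (fun r : ℝ => (a r : ℂ)) ((deriv a x : ℝ) : ℂ) x := fun x =>
    ((ha.differentiable (by norm_num)) x).hasDerivAt.ofReal_comp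
  have hv : ∀ x : ℝ, HasDerivAt (fun r : ℝ => z⁻¹ * Complex.exp (z * r)) (Complex.exp (z * x)) x := by
    intro x
    have h1 : HasDerivAt (fun r : ℝ => z * (r : ℂ)) z x := by
      simpa using (hasDerivAt_id x).ofReal_comp.const_mul z
    have h2 := h1.cexp.const_mul z⁻¹
    refine h2.congr_deriv ?_
    field_simp
  have hd : Continuous (deriv a) := ha.continuous_deriv (by norm_num)
  have := intervalIntegral.integral_mul_deriv_eq_deriv_mul (a := 0) (b := 1)
    (fun x _ => hu x) (fun x _ => hv x)
    ((Complex.continuous_ofReal.comp hd).intervalIntegrable _ _)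
    (Continuous.intervalIntegrable (by fun_prop) _ _)
  rw [this, h0, h1]
  simp only [Complex.ofReal_zero, zero_mul, sub_zero, zero_sub]
  rw [← intervalIntegral.integral_const_mul, ← intervalIntegral.integral_neg]
  congr 1; ext x; ring

theorem norm_integral_mul_cexp_le (N : ℕ) {B : ℝ} (z : ℂ) (hz : z ≠ 0) (hre : z.re = 0) :
    ∀ a : ℝ → ℝ, ContDiff ℝ ((⊤ : ℕ∞) : WithTop ℕ∞) a → (∀ j, iteratedDeriv j a 0 = 0) →
    (∀ j, iteratedDeriv j a 1 = 0) → (∀ r, |iteratedDeriv N a r| ≤ B) →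
    ‖∫ r in (0:ℝ)..1, (a r : ℂ) * Complex.exp (z * r)‖ ≤ B * (‖z‖ ^ N)⁻¹ := by
  induction N with
  | zero =>
    intro a ha _ _ hB
    have := intervalIntegral.norm_integral_le_of_norm_le_const (a := (0:ℝ)) (b := 1) (C := B)
      (f := fun r => (a r : ℂ) * Complex.exp (z * r)) (fun r _ => by
        rw [norm_mul, Complex.norm_exp, Complex.norm_real]
        simpa [hre] using hB r)
    simpa using this
  | succ N ih =>
    intro a ha h0 h1 hB
    have ha' : ContDiff ℝ ((⊤ : ℕ∞) : WithTop ℕ∞) (deriv a) :=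
      (contDiff_infty_iff_deriv.1 ha).2
    have := ih (deriv a) ha' (fun j => by rw [← iteratedDeriv_succ']; exact h0 _)
      (fun j => by rw [← iteratedDeriv_succ']; exact h1 _)
      (fun r => by rw [← iteratedDeriv_succ']; exact hB r)
    rw [integral_mul_cexp_eq (ha.of_le (by exact_mod_cast le_top)) (by simpa using h0 0)
      (by simpa using h1 0) hz, norm_mul, norm_neg, norm_inv, pow_succ, mul_inv]
    calc _ ≤ ‖z‖⁻¹ * (B * (‖z‖ ^ N)⁻¹) := by gcongr
      _ = _ := by ring

/-- The function `φ(x)/|x|`, the radial profile of the kernels. -/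
def radialProfile (d : ℕ) (φ : Rd d → ℝ) (x : Rd d) : ℝ := φ x * ‖x‖⁻¹

variable {d : ℕ} {φ : Rd d → ℝ}

theorem AdmissiblePhi.eq_zero_of_norm_le (hφ : AdmissiblePhi d φ) {x : Rd d}
    (hx : ‖x‖ ≤ (2:ℝ) ^ (-4 : ℤ)) : φ x = 0 := by
  by_contra h
  exact absurd (hφ.2.1 (subset_tsupport _ h)).1 (not_lt.2 hx)

theorem AdmissiblePhi.eq_zero_of_le_norm (hφ : AdmissiblePhi d φ) {x : Rd d}
    (hx : (2:ℝ) ^ (-2 : ℤ) ≤ ‖x‖) : φ x = 0 := by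
  by_contra h
  exact absurd (hφ.2.1 (subset_tsupport _ h)).2 (not_lt.2 hx)

theorem AdmissiblePhi.hasCompactSupport (hφ : AdmissiblePhi d φ) : HasCompactSupport φ :=
  HasCompactSupport.of_support_subset_isCompact (isCompact_closedBall (0 : Rd d) 1) fun x hx => by
    have := (hφ.2.1 (subset_tsupport _ hx)).2
    rw [mem_closedBall_zero_iff]
    refine this.le.trans (by norm_num)

theorem AdmissiblePhi.contDiff_radialProfile (hφ : AdmissiblePhi d φ) :
    ContDiff ℝ ((⊤ : ℕ∞) : WithTop ℕ∞) (radialProfile d φ) := by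
  rw [contDiff_iff_contDiffAt]
  intro x
  by_cases hx : x = 0
  · subst hx
    have : radialProfile d φ =ᶠ[nhds 0] fun _ => 0 := by
      filter_upwards [Metric.ball_mem_nhds (0 : Rd d) (by positivity : (0:ℝ) < (2:ℝ) ^ (-4 : ℤ))]
        with y hy
      rw [mem_ball_zero_iff] at hy
      simp [radialProfile, AdmissiblePhi.eq_zero_of_norm_le hφ hy.le]
    exact contDiffAt_const.congr_of_eventuallyEq this
  · exact hφ.1.contDiffAt.mul ((contDiffAt_norm ℝ hx).inv (norm_ne_zero_iff.2 hx))

theorem AdmissiblePhi.exists_iteratedDeriv_bound (hφ : AdmissiblePhi d φ) (N : ℕ) :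
    ∃ B : ℝ, 0 ≤ B ∧ ∀ θ : Rd d, ‖θ‖ = 1 → ∀ r : ℝ,
      |iteratedDeriv N (fun r : ℝ => radialProfile d φ (r • θ)) r| ≤ B := by
  have hcs : HasCompactSupport (radialProfile d φ) := (AdmissiblePhi.hasCompactSupport hφ).mul_right
  have hcd := AdmissiblePhi.contDiff_radialProfile hφ
  obtain ⟨B, hB⟩ := (hcs.iteratedFDeriv (𝕜 := ℝ) N).exists_bound_of_continuous
    (hcd.continuous_iteratedFDeriv (by exact_mod_cast le_top))
  refine ⟨B, (norm_nonneg _).trans (hB 0), fun θ hθ r => ?_⟩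
  have e : (fun r : ℝ => radialProfile d φ (r • θ)) =
      radialProfile d φ ∘ (ContinuousLinearMap.toSpanSingleton ℝ θ) := by
    ext r; simp
  rw [← Real.norm_eq_abs, ← norm_iteratedFDeriv_eq_norm_iteratedDeriv, e,
    ContinuousLinearMap.iteratedFDeriv_comp_right _ hcd _ (by exact_mod_cast le_top)]
  refine (ContinuousMultilinearMap.norm_compContinuousLinearMap_le _ _).trans ?_
  simp only [ContinuousLinearMap.norm_toSpanSingleton, hθ, Finset.prod_const_one, mul_one]
  exact hB _

end Radial

variable {d : ℕ} {φ Om : Rd d → ℝ}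

theorem Kker_eq_zero_of_norm_le (hφ : AdmissiblePhi d φ) {k : ℤ} {x : Rd d}
    (hx : ‖x‖ ≤ (2:ℝ) ^ (k - 4)) : Kker d φ Om k x = 0 := by
  have : φ ((2:ℝ) ^ (-k) • x) = 0 := by
    apply AdmissiblePhi.eq_zero_of_norm_le hφ
    rw [norm_smul, Real.norm_of_nonneg (by positivity)]
    calc (2:ℝ) ^ (-k) * ‖x‖ ≤ (2:ℝ) ^ (-k) * (2:ℝ) ^ (k - 4) := by gcongr
      _ = _ := by rw [← zpow_add₀ (by norm_num)]; congr 1; ring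
  rw [Kker, this, zero_mul, zero_mul]

theorem Kker_eq_zero_of_le_norm (hφ : AdmissiblePhi d φ) {k : ℤ} {x : Rd d}
    (hx : (2:ℝ) ^ (k - 2) ≤ ‖x‖) : Kker d φ Om k x = 0 := by
  have : φ ((2:ℝ) ^ (-k) • x) = 0 := by
    apply AdmissiblePhi.eq_zero_of_le_norm hφ
    rw [norm_smul, Real.norm_of_nonneg (by positivity)]
    calc (2:ℝ) ^ (-2:ℤ) = (2:ℝ) ^ (-k) * (2:ℝ) ^ (k - 2) := by
          rw [← zpow_add₀ (by norm_num)]; congr 1; ring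
      _ ≤ _ := by gcongr
  rw [Kker, this, zero_mul, zero_mul]

theorem Kker_smul (hφ : AdmissiblePhi d φ) (hO : Homogeneous0 d Om) (k : ℤ) (x : Rd d) :
    Kker d φ Om k x = (2:ℝ) ^ (-(k * d)) * Kker d φ Om 0 ((2:ℝ) ^ (-k) • x) := by
  by_cases hx : x = 0
  · subst hx
    rw [Kker_eq_zero_of_norm_le hφ (by rw [norm_zero]; positivity),
      Kker_eq_zero_of_norm_le hφ (by rw [smul_zero, norm_zero]; positivity), mul_zero]
  · simp only [Kker, neg_zero, zpow_zero, one_smul]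
    rw [hO x hx _ (by positivity), norm_smul, Real.norm_of_nonneg (by positivity), mul_zpow,
      ← zpow_mul]
    have : (2:ℝ) ^ (-k * -(d:ℤ)) * (2:ℝ) ^ (-(k * d) : ℤ) = 1 := by
      rw [← zpow_add₀ (by norm_num)]
      simp
    linear_combination (-φ ((2:ℝ) ^ (-k) • x) * Om x * ‖x‖ ^ (-(d : ℤ))) * this

theorem AdmissiblePhi.exists_bound (hφ : AdmissiblePhi d φ) :
    ∃ B : ℝ, 0 < B ∧ ∀ (Om : Rd d → ℝ) (A : ℝ), (∀ x, |Om x| ≤ A) → ∀ k x,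
      |Kker d φ Om k x| ≤ B * A * (2:ℝ) ^ (-(k * d)) := by
  obtain ⟨B, hB⟩ := (AdmissiblePhi.hasCompactSupport hφ).exists_bound_of_continuous hφ.1.continuous
  have hB0 : 0 ≤ B := (norm_nonneg _).trans (hB 0)
  refine ⟨(B + 1) * (2:ℝ) ^ (4 * d), by positivity, fun Om A hA k x => ?_⟩
  have hA0 : 0 ≤ A := (abs_nonneg _).trans (hA 0)
  by_cases hx : ‖x‖ ≤ (2:ℝ) ^ (k - 4)
  · rw [Kker_eq_zero_of_norm_le hφ hx]
    simp only [abs_zero]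
    positivity
  · push Not at hx
    rw [Kker, abs_mul, abs_mul, abs_of_nonneg (zpow_nonneg (norm_nonneg x) _)]
    have h1 : ‖x‖ ^ (-(d:ℤ)) ≤ (2:ℝ) ^ (4 * d) * (2:ℝ) ^ (-(k * d)) := by
      rw [zpow_neg, zpow_natCast]
      have : (2:ℝ) ^ (4 * d) * (2:ℝ) ^ (-(k * d)) = (((2:ℝ) ^ (k - 4)) ^ d)⁻¹ := by
        rw [← zpow_natCast, ← zpow_natCast, ← zpow_mul, ← zpow_neg, ← zpow_add₀ (by norm_num)]
        congr 1; push_cast; ring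
      rw [this]
      gcongr
    calc |φ ((2:ℝ) ^ (-k) • x)| * |Om x| * ‖x‖ ^ (-(d:ℤ))
        ≤ (B + 1) * A * ((2:ℝ) ^ (4 * d) * (2:ℝ) ^ (-(k * d))) := by
          gcongr
          · exact (hB _).trans (by linarith)
          · exact hA x
      _ = _ := by ring

theorem measurable_Kker (hφ : AdmissiblePhi d φ) (hO : Measurable Om) (k : ℤ) :
    Measurable (Kker d φ Om k) := by
  have := hφ.1.continuous.measurable
  unfold Kker
  have h2 : Measurable fun x : Rd d => ‖x‖ ^ (-(d:ℤ)) := by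
    simp only [zpow_neg, zpow_natCast]
    fun_prop
  fun_prop

theorem integrable_Kker (hφ : AdmissiblePhi d φ) (hO : Measurable Om) {A : ℝ}
    (hA : ∀ x, |Om x| ≤ A) (k : ℤ) : Integrable (Kker d φ Om k) := by
  obtain ⟨B, -, hB⟩ := AdmissiblePhi.exists_bound hφ
  have hs : Function.support (Kker d φ Om k) ⊆ closedBall (0 : Rd d) ((2:ℝ) ^ (k - 2)) := by
    intro x hx
    rw [mem_closedBall_zero_iff]
    by_contra h
    exact hx (Kker_eq_zero_of_le_norm hφ (not_le.1 h).le)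
  rw [← integrableOn_iff_integrable_of_support_subset hs]
  exact Measure.integrableOn_of_bounded (measure_closedBall_lt_top).ne
    (measurable_Kker hφ hO k).aestronglyMeasurable (M := B * A * (2:ℝ) ^ (-(k * d)))
    (Filter.Eventually.of_forall fun x => hB Om A hA k x)

theorem fourier_Kker (hφ : AdmissiblePhi d φ) (hO : Homogeneous0 d Om) (k : ℤ) (ξ : Rd d) :
    𝓕 (fun x => (Kker d φ Om k x : ℂ)) ξ =
      𝓕 (fun x => (Kker d φ Om 0 x : ℂ)) ((2:ℝ) ^ k • ξ) := by
  rw [Real.fourier_eq', Real.fourier_eq']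
  have h := Measure.integral_comp_smul (volume : Measure (Rd d))
    (fun v => Complex.exp ((↑(-2 * Real.pi * inner ℝ v ((2:ℝ) ^ k • ξ)) : ℂ) * Complex.I) •
      (Kker d φ Om 0 v : ℂ)) ((2:ℝ) ^ (-k))
  have e : |(((2:ℝ) ^ (-k)) ^ Module.finrank ℝ (Rd d))⁻¹| = (2:ℝ) ^ (k * d) := by
    rw [abs_of_nonneg (by positivity), finrank_euclideanSpace_fin, ← zpow_natCast, ← zpow_mul,
      ← zpow_neg]
    congr 1; ring
  rw [e] at h
  calc _ = ∫ v, (2:ℝ) ^ (-(k * d)) •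
        (Complex.exp ((↑(-2 * Real.pi * inner ℝ ((2:ℝ) ^ (-k) • v) ((2:ℝ) ^ k • ξ)) : ℂ) *
          Complex.I) • (Kker d φ Om 0 ((2:ℝ) ^ (-k) • v) : ℂ)) := by
        congr 1; ext v
        have : inner ℝ ((2:ℝ) ^ (-k) • v) ((2:ℝ) ^ k • ξ) = inner ℝ v ξ := by
          rw [real_inner_smul_left, real_inner_smul_right, ← mul_assoc, ← zpow_add₀ (by norm_num)]
          simp
        rw [this, Kker_smul hφ hO, Complex.real_smul, smul_eq_mul, smul_eq_mul]
        push_cast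
        ring
    _ = _ := by
        rw [integral_smul, h, smul_smul, ← zpow_add₀ (by norm_num)]
        simp

theorem AdmissiblePhi.exists_fourier_decay_zero (hφ : AdmissiblePhi d φ) (hd : 1 ≤ d) (N : ℕ) :
    ∃ B : ℝ, 0 < B ∧ ∀ (Om : Rd d → ℝ) (A τ : ℝ) (ξ : Rd d), Measurable Om → Homogeneous0 d Om →
      (∀ x, |Om x| ≤ A) → 0 < τ → (∀ x, x ≠ 0 → Om x ≠ 0 → τ * ‖x‖ ≤ |inner ℝ x ξ|) →
      ‖𝓕 (fun x => (Kker d φ Om 0 x : ℂ)) ξ‖ ≤ B * A * (τ ^ N)⁻¹ := by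
  have : Nonempty (Fin d) := ⟨⟨0, hd⟩⟩
  have : Nontrivial (Rd d) := inferInstance
  obtain ⟨B, hB0, hB⟩ := AdmissiblePhi.exists_iteratedDeriv_bound hφ N
  refine ⟨(B + 1) * ((volume : Measure (Rd d)).toSphere.real univ + 1), by positivity,
    fun Om A τ ξ hOm hO hA hτ hτξ => ?_⟩
  have hA0 : 0 ≤ A := (abs_nonneg _).trans (hA 0)
  rw [Real.fourier_eq']
  have hInt : Integrable (fun v : Rd d => Complex.exp ((↑(-2 * Real.pi * inner ℝ v ξ) : ℂ) *
      Complex.I) • (Kker d φ Om 0 v : ℂ)) := by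
    have hK : Integrable fun v : Rd d => (Kker d φ Om 0 v : ℂ) :=
      (integrable_Kker hφ hOm hA 0).ofReal (𝕜 := ℂ)
    have := (Real.fourierIntegral_convergent_iff ξ).2 hK
    refine this.congr (Filter.Eventually.of_forall fun v => ?_)
    simp only [Circle.smul_def, Real.fourierChar_apply]
    rw [smul_eq_mul, smul_eq_mul]
    push_cast
    ring_nf
  refine (norm_integral_le_of_radial volume hInt (B := (B + 1) * A * (τ ^ N)⁻¹) ?_).trans ?_
  · intro θ hθ
    have hθ0 : θ ≠ 0 := by rintro rfl; simp at hθ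
    set a : ℝ → ℝ := fun r => radialProfile d φ (r • θ) with ha
    set z : ℂ := (-2 * Real.pi * inner ℝ θ ξ : ℝ) * Complex.I with hz
    have e1 : ∫ r in Ioi (0:ℝ), (r ^ (Module.finrank ℝ (Rd d) - 1)) •
        (Complex.exp ((↑(-2 * Real.pi * inner ℝ (r • θ) ξ) : ℂ) * Complex.I) •
          (Kker d φ Om 0 (r • θ) : ℂ)) =
        (Om θ : ℂ) * ∫ r in (0:ℝ)..1, (a r : ℂ) * Complex.exp (z * r) := by
      rw [intervalIntegral.integral_of_le zero_le_one, ← integral_const_mul]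
      have hz1 : ∀ r : ℝ, 1 ≤ r → a r = 0 := by
        intro r hr
        have : φ (r • θ) = 0 := by
          apply AdmissiblePhi.eq_zero_of_le_norm hφ
          rw [norm_smul, hθ, mul_one, Real.norm_eq_abs]
          exact le_trans (by norm_num) (hr.trans (le_abs_self r))
        simp [ha, radialProfile, this]
      rw [← setIntegral_eq_of_subset_of_forall_sdiff_eq_zero measurableSet_Ioi
        (show Ioc (0:ℝ) 1 ⊆ Ioi 0 from Ioc_subset_Ioi_self)]
      · refine setIntegral_congr_fun measurableSet_Ioi fun r hr => ?_
        have hr0 : (0:ℝ) < r := hr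
        simp only [Kker, neg_zero, zpow_zero, one_smul, ha, radialProfile]
        rw [hO θ hθ0 r hr0, norm_smul, hθ, mul_one, Real.norm_of_nonneg hr0.le,
          real_inner_smul_left, finrank_euclideanSpace_fin, hz]
        have : r ^ (d - 1) * r ^ (-(d:ℤ)) = r⁻¹ := by
          rw [← zpow_natCast, ← zpow_add₀ hr0.ne', ← zpow_neg_one]
          congr 1
          push_cast [hd]; ring
        rw [Complex.real_smul, smul_eq_mul]
        rw [← this]
        push_cast
        ring_nf
      · intro r hr
        rw [hz1 r]
        · simp
        · by_contra h
          exact hr.2 ⟨hr.1, (not_le.1 h).le⟩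
    rw [e1, norm_mul, Complex.norm_real]
    by_cases hOθ : Om θ = 0
    · simp only [hOθ, norm_zero, zero_mul]; positivity
    have hin := hτξ θ hθ0 hOθ
    rw [hθ, mul_one] at hin
    have hzn : ‖z‖ = 2 * Real.pi * |inner ℝ θ ξ| := by
      rw [hz, norm_mul, Complex.norm_I, mul_one, Complex.norm_real, Real.norm_eq_abs, abs_mul,
        abs_mul, abs_neg, abs_of_pos Real.pi_pos]
      simp
    have hzτ : τ ≤ ‖z‖ := by
      rw [hzn]
      have := Real.pi_gt_three
      nlinarith [abs_nonneg (inner ℝ θ ξ)]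
    have hz0 : z ≠ 0 := by
      rw [← norm_pos_iff]; exact hτ.trans_le hzτ
    have hac : ContDiff ℝ ((⊤ : ℕ∞) : WithTop ℕ∞) a :=
      (AdmissiblePhi.contDiff_radialProfile hφ).comp (contDiff_id.smul contDiff_const)
    have hloc : ∀ r0 : ℝ, (∀ᶠ r in nhds r0, φ (r • θ) = 0) → ∀ j, iteratedDeriv j a r0 = 0 := by
      intro r0 h j
      have : a =ᶠ[nhds r0] fun _ => 0 := by
        filter_upwards [h] with r hr
        simp [ha, radialProfile, hr]
      rw [this.iteratedDeriv_eq]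
      simp
    have hnr : ∀ r : ℝ, ‖r • θ‖ = |r| := fun r => by rw [norm_smul, hθ, mul_one, Real.norm_eq_abs]
    have hb := norm_integral_mul_cexp_le N z hz0 (by simp [hz]) a hac
      (hloc 0 (by
        filter_upwards [Metric.ball_mem_nhds (0:ℝ) (by positivity : (0:ℝ) < (2:ℝ) ^ (-4 : ℤ))]
          with r hr
        apply AdmissiblePhi.eq_zero_of_norm_le hφ
        rw [mem_ball_zero_iff, Real.norm_eq_abs] at hr
        rw [hnr]; exact hr.le))
      (hloc 1 (by
        filter_upwards [Ioi_mem_nhds (by norm_num : (2:ℝ) ^ (-2 : ℤ) < 1)] with r hr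
        apply AdmissiblePhi.eq_zero_of_le_norm hφ
        rw [hnr]; exact (le_of_lt hr).trans (le_abs_self r)))
      (fun r => hB θ hθ r)
    calc ‖Om θ‖ * ‖∫ r in (0:ℝ)..1, (a r : ℂ) * Complex.exp (z * r)‖
        ≤ A * ((B + 1) * (τ ^ N)⁻¹) := by
          gcongr
          · exact hA θ
          · refine hb.trans ?_
            gcongr
            linarith
      _ = _ := by ring
  · have : 0 ≤ (B + 1) * A * (τ ^ N)⁻¹ := by positivity
    nlinarith

theorem AdmissiblePhi.exists_fourier_decay (hφ : AdmissiblePhi d φ) (hd : 1 ≤ d) (N : ℕ) :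
    ∃ B : ℝ, 0 < B ∧ ∀ (Om : Rd d → ℝ) (A τ : ℝ) (ξ : Rd d), Measurable Om → Homogeneous0 d Om →
      (∀ x, |Om x| ≤ A) → 0 < τ → (∀ x, x ≠ 0 → Om x ≠ 0 → τ * ‖x‖ ≤ |inner ℝ x ξ|) →
      ∀ k : ℤ, ‖𝓕 (fun x => (Kker d φ Om k x : ℂ)) ξ‖ ≤ B * A * (((2:ℝ) ^ k * τ) ^ N)⁻¹ := by
  obtain ⟨B, hB0, hB⟩ := AdmissiblePhi.exists_fourier_decay_zero hφ hd N
  refine ⟨B, hB0, fun Om A τ ξ hOm hO hA hτ hτξ k => ?_⟩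
  rw [fourier_Kker hφ hO]
  refine hB Om A _ _ hOm hO hA (by positivity) fun x hx hOx => ?_
  rw [real_inner_smul_right, abs_mul, abs_of_pos (by positivity), mul_assoc]
  gcongr
  exact hτξ x hx hOx

theorem AdmissiblePhi.exists_fourier_bound (hφ : AdmissiblePhi d φ) :
    ∃ B : ℝ, 0 < B ∧ ∀ (Om : Rd d → ℝ) (A : ℝ) (ξ : Rd d), Measurable Om → Homogeneous0 d Om →
      (∀ x, |Om x| ≤ A) →
      ∀ k : ℤ, ‖𝓕 (fun x => (Kker d φ Om k x : ℂ)) ξ‖ ≤ B * A := by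
  obtain ⟨B, hB0, hB⟩ := AdmissiblePhi.exists_bound hφ
  refine ⟨B * (volume.real (closedBall (0 : Rd d) 1) + 1), by positivity,
    fun Om A ξ hOm hO hA k => ?_⟩
  have hA0 : 0 ≤ A := (abs_nonneg _).trans (hA 0)
  rw [fourier_Kker hφ hO, Real.fourier_eq']
  rw [← setIntegral_eq_integral_of_forall_compl_eq_zero (s := closedBall (0 : Rd d) 1)]
  · refine (norm_setIntegral_le_of_norm_le_const (C := B * A)
      (measure_closedBall_lt_top) fun x _ => ?_).trans ?_
    · rw [norm_smul, Complex.norm_exp_ofReal_mul_I, one_mul, Complex.norm_real]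
      simpa using hB Om A hA 0 x
    · have : 0 ≤ B * A := by positivity
      nlinarith
  · intro x hx
    rw [Kker_eq_zero_of_le_norm hφ]
    · simp
    · rw [mem_closedBall_zero_iff, not_le] at hx
      exact le_trans (by norm_num) hx.le

section Tube

variable {d : ℕ}

/-- The tube of length `2a` and width `2b` around the line spanned by the vector with
coordinates `1` in position `i` and `e j` in position `j ≠ i`. -/
def tube (i : Fin d) (e : Fin d → ℝ) (a b : ℝ) : Set (Rd d) :=
  {v | |v i| ≤ a ∧ ∀ j, j ≠ i → |v j - v i * e j| ≤ b}

theorem measurableSet_tube (i : Fin d) (e : Fin d → ℝ) (a b : ℝ) :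
    MeasurableSet (tube i e a b) := by
  have : tube i e a b = {v : Rd d | |v i| ≤ a} ∩ ⋂ j, {v : Rd d | j ≠ i → |v j - v i * e j| ≤ b} := by
    ext v; simp [tube]
  rw [this]
  refine (measurableSet_le (by fun_prop) measurable_const).inter (MeasurableSet.iInter fun j => ?_)
  by_cases h : j = i
  · simp [h]
  · simp only [ne_eq, h, not_false_eq_true, forall_const]
    exact measurableSet_le (by fun_prop) measurable_const

theorem sub_mem_tube {i : Fin d} {e : Fin d → ℝ} {a b a' b' : ℝ} {u v : Rd d}
    (hu : u ∈ tube i e a b) (hv : v ∈ tube i e a' b') : u - v ∈ tube i e (a + a') (b + b') := by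
  refine ⟨(abs_sub _ _).trans (add_le_add hu.1 hv.1), fun j hj => ?_⟩
  have : (u - v) j - (u - v) i * e j = (u j - u i * e j) - (v j - v i * e j) := by
    simp only [PiLp.sub_apply]; ring
  rw [this]
  exact (abs_sub _ _).trans (add_le_add (hu.2 j hj) (hv.2 j hj))

theorem add_mem_tube {i : Fin d} {e : Fin d → ℝ} {a b a' b' : ℝ} {u v : Rd d}
    (hu : u ∈ tube i e a b) (hv : v ∈ tube i e a' b') : u + v ∈ tube i e (a + a') (b + b') := by
  refine ⟨(abs_add_le _ _).trans (add_le_add hu.1 hv.1), fun j hj => ?_⟩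
  have : (u + v) j - (u + v) i * e j = (u j - u i * e j) + (v j - v i * e j) := by
    simp only [PiLp.add_apply]; ring
  rw [this]
  exact (abs_add_le _ _).trans (add_le_add (hu.2 j hj) (hv.2 j hj))

theorem tube_mono {i : Fin d} {e : Fin d → ℝ} {a b a' b' : ℝ} (ha : a ≤ a') (hb : b ≤ b') :
    tube i e a b ⊆ tube i e a' b' := fun _ h => ⟨h.1.trans ha, fun j hj => (h.2 j hj).trans hb⟩

theorem mem_tube_of_abs_le {i : Fin d} {e : Fin d → ℝ} (he : ∀ j, |e j| ≤ 1) {r : ℝ} {v : Rd d}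
    (hv : ∀ j, |v j| ≤ r) : v ∈ tube i e r (2 * r) := by
  refine ⟨hv i, fun j _ => (abs_sub _ _).trans ?_⟩
  rw [abs_mul]
  have : |v i| * |e j| ≤ r * 1 := mul_le_mul (hv i) (he j) (abs_nonneg _)
    ((abs_nonneg _).trans (hv i))
  linarith [hv j]

theorem volume_tube_le (i : Fin d) (e : Fin d → ℝ) {a b : ℝ} (ha : 0 ≤ a) (hb : 0 ≤ b) :
    volume (tube i e a b) ≤ ENNReal.ofReal (2 * a * (2 * b) ^ (d - 1)) := by
  classical
  set e' : Fin d → ℝ := fun j => if j = i then 0 else -e j with he'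
  set M : Matrix (Fin d) (Fin d) ℝ := 1 + Matrix.replicateCol Unit e' *
    Matrix.replicateRow Unit (Pi.single i (1:ℝ)) with hM
  have hdet : M.det = 1 := by
    rw [hM, Matrix.det_one_add_replicateCol_mul_replicateRow]
    simp [he']
  have hmul : ∀ v : Fin d → ℝ, ∀ j, Matrix.toLin' M v j = v j + e' j * v i := by
    intro v j
    rw [hM, Matrix.toLin'_apply, Matrix.add_mulVec, Matrix.one_mulVec]
    simp [Matrix.mulVec, Matrix.mul_apply, dotProduct, Matrix.replicateRow, Matrix.replicateCol, Pi.single_apply]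
  have hmap := Real.map_matrix_volume_pi_eq_smul_volume_pi (M := M) (by rw [hdet]; norm_num)
  rw [hdet] at hmap
  simp only [inv_one, abs_one, ENNReal.ofReal_one, one_smul] at hmap
  set r : Fin d → ℝ := fun j => if j = i then a else b with hr
  have hpre : tube i e a b = (WithLp.ofLp : Rd d → (Fin d → ℝ)) ⁻¹'
      (Matrix.toLin' M ⁻¹' (univ.pi fun j => Icc (-r j) (r j))) := by
    ext v
    simp only [tube, mem_ofPred_eq, mem_preimage, mem_univ_pi, mem_Icc, ← abs_le, hmul, hr, he']
    constructor
    · rintro ⟨h1, h2⟩ j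
      by_cases hj : j = i
      · subst hj; simpa using h1
      · simp only [hj, if_false]
        have := h2 j hj
        rwa [show v j + -e j * v i = v j - v i * e j by ring]
    · intro h
      refine ⟨by simpa using h i, fun j hj => ?_⟩
      have := h j
      simp only [hj, if_false] at this
      rwa [show v j + -e j * v i = v j - v i * e j by ring] at this
  have hms : MeasurableSet (univ.pi fun j => Icc (-r j) (r j)) :=
    MeasurableSet.univ_pi fun j => measurableSet_Icc
  have hlm : Measurable (Matrix.toLin' M) := (LinearMap.continuous_of_finiteDimensional _).measurable
  rw [hpre, (PiLp.volume_preserving_ofLp (Fin d)).measure_preimage (hlm hms).nullMeasurableSet,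
    ← Measure.map_apply hlm hms, hmap, volume_pi_pi]
  simp only [Real.volume_Icc, hr]
  rw [Fintype.prod_eq_mul_prod_compl i, Finset.prod_congr rfl (g := fun _ => ENNReal.ofReal (2 * b))]
  · rw [Finset.prod_const, Finset.card_compl, Finset.card_singleton, Fintype.card_fin, if_pos rfl,
      ← ENNReal.ofReal_pow (by positivity), ← ENNReal.ofReal_mul (by linarith)]
    apply le_of_eq; congr 1; ring
  · intro j hj
    rw [if_neg (by simpa using hj)]
    congr 1; ring

end Tube

section Cubes

variable {d : ℕ}

theorem dcube_eq_preimage (w : Fin d → ℝ) (k : ℤ) (m : Fin d → ℤ) :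
    dcube d w k m = (WithLp.ofLp : Rd d → (Fin d → ℝ)) ⁻¹' (univ.pi fun i =>
      Ico ((2:ℝ) ^ k * (w i + m i)) ((2:ℝ) ^ k * (w i + m i + 1))) := by
  ext x; simp [dcube]

theorem measurableSet_dcube (w : Fin d → ℝ) (k : ℤ) (m : Fin d → ℤ) :
    MeasurableSet (dcube d w k m) := by
  rw [dcube_eq_preimage]
  exact (PiLp.volume_preserving_ofLp (Fin d)).measurable
    (MeasurableSet.univ_pi fun _ => measurableSet_Ico)

theorem volume_dcube (w : Fin d → ℝ) (k : ℤ) (m : Fin d → ℤ) :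
    volume (dcube d w k m) = ENNReal.ofReal ((2:ℝ) ^ (k * d)) := by
  rw [dcube_eq_preimage, (PiLp.volume_preserving_ofLp (Fin d)).measure_preimage
    (MeasurableSet.univ_pi fun _ => measurableSet_Ico).nullMeasurableSet, volume_pi_pi]
  simp only [Real.volume_Ico]
  rw [Finset.prod_congr rfl (g := fun _ => ENNReal.ofReal ((2:ℝ) ^ k))
    (fun i _ => by congr 1; ring), Finset.prod_const, Finset.card_univ, Fintype.card_fin,
    ← ENNReal.ofReal_pow (by positivity), ← zpow_natCast, ← zpow_mul]

theorem abs_sub_le_of_mem_dcube {w : Fin d → ℝ} {k : ℤ} {m : Fin d → ℤ} {x y : Rd d}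
    (hx : x ∈ dcube d w k m) (hy : y ∈ dcube d w k m) (i : Fin d) : |x i - y i| ≤ (2:ℝ) ^ k := by
  obtain ⟨h1, h2⟩ := hx i
  obtain ⟨h3, h4⟩ := hy i
  have : (2:ℝ) ^ k * (w i + m i + 1) = (2:ℝ) ^ k * (w i + m i) + (2:ℝ) ^ k := by ring
  rw [abs_le]
  constructor <;> linarith

theorem norm_le_sum_abs (x : Rd d) : ‖x‖ ≤ ∑ i, |x i| := by
  rw [EuclideanSpace.norm_eq]
  refine Real.sqrt_le_iff.2 ⟨Finset.sum_nonneg fun _ _ => abs_nonneg _, ?_⟩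
  simp only [Real.norm_eq_abs]
  exact Finset.sum_sq_le_sq_sum_of_nonneg fun _ _ => abs_nonneg _

theorem abs_apply_le_norm (x : Rd d) (i : Fin d) : |x i| ≤ ‖x‖ := by
  simpa using PiLp.norm_apply_le x i

theorem norm_sub_le_of_mem_dcube {w : Fin d → ℝ} {k : ℤ} {m : Fin d → ℤ} {x y : Rd d}
    (hx : x ∈ dcube d w k m) (hy : y ∈ dcube d w k m) : ‖x - y‖ ≤ d * (2:ℝ) ^ k := by
  refine (norm_le_sum_abs _).trans ?_
  refine (Finset.sum_le_card_nsmul _ _ _ fun i _ => abs_sub_le_of_mem_dcube hx hy i).trans ?_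
  simp

end Cubes

section Bilinear

variable {E : Type*} [AddCommGroup E] [MeasurableSpace E] [MeasurableSub₂ E]
  {μ : Measure E} [SFinite μ]

theorem measurable_lintegral_conv {κ β : E → ℝ≥0∞} (hκ : Measurable κ) (hβ : Measurable β) :
    Measurable fun x => ∫⁻ y, κ (x - y) * β y ∂μ := by
  apply Measurable.lintegral_prod_right'
    (f := fun p : E × E => κ (p.1 - p.2) * β p.2)
  fun_prop

theorem lintegral_conv_mul_conv {κ β κ' β' : E → ℝ≥0∞} (hκ : Measurable κ) (hβ : Measurable β)
    (hκ' : Measurable κ') (hβ' : Measurable β') :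
    ∫⁻ x, (∫⁻ y, κ (x - y) * β y ∂μ) * (∫⁻ z, κ' (x - z) * β' z ∂μ) ∂μ =
      ∫⁻ y, (∫⁻ z, (∫⁻ x, κ (x - y) * κ' (x - z) ∂μ) * β' z ∂μ) * β y ∂μ := by
  have hin : ∀ x, Measurable fun y => κ (x - y) * β y := fun x => by fun_prop
  have hin' : ∀ x, Measurable fun y => κ' (x - y) * β' y := fun x => by fun_prop
  calc _ = ∫⁻ x, ∫⁻ y, (κ (x - y) * β y) * (∫⁻ z, κ' (x - z) * β' z ∂μ) ∂μ ∂μ := by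
        congr 1; ext x
        rw [lintegral_mul_const _ (hin x)]
    _ = ∫⁻ y, ∫⁻ x, (κ (x - y) * β y) * (∫⁻ z, κ' (x - z) * β' z ∂μ) ∂μ ∂μ := by
        apply lintegral_lintegral_swap
        have := measurable_lintegral_conv (μ := μ) hκ' hβ'
        fun_prop
    _ = _ := by
        congr 1; ext y
        have e1 : ∀ x, (κ (x - y) * β y) * (∫⁻ z, κ' (x - z) * β' z ∂μ) =
            (∫⁻ z, κ (x - y) * (κ' (x - z) * β' z) ∂μ) * β y := fun x => by
          rw [lintegral_const_mul _ (hin' x)]; ring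
        simp_rw [e1]
        rw [lintegral_mul_const]
        · congr 1
          rw [lintegral_lintegral_swap]
          · congr 1; ext z
            rw [← lintegral_mul_const _ (by fun_prop)]
            congr 1; ext x; ring
          · fun_prop
        · have := measurable_lintegral_conv (μ := μ) hκ' hβ'
          have e2 : ∀ x, (∫⁻ z, κ (x - y) * (κ' (x - z) * β' z) ∂μ) =
            κ (x - y) * ∫⁻ z, (κ' (x - z) * β' z) ∂μ := fun x => lintegral_const_mul _ (hin' x)
          simp_rw [e2]
          fun_prop

theorem lintegral_sq_sum_conv_le {ι : Type*} (F : Finset ι) (k : ι → ℤ) {κ β : ι → E → ℝ≥0∞}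
    (hκ : ∀ c, Measurable (κ c)) (hβ : ∀ c, Measurable (β c)) {M : ℝ≥0∞}
    (H : ∀ c ∈ F, ∀ y, ∑ c' ∈ F with k c' ≤ k c,
      ∫⁻ z, (∫⁻ x, κ c (x - y) * κ c' (x - z) ∂μ) * β c' z ∂μ ≤ M) :
    ∫⁻ x, (∑ c ∈ F, ∫⁻ y, κ c (x - y) * β c y ∂μ) ^ 2 ∂μ ≤ 2 * (M * ∑ c ∈ F, ∫⁻ y, β c y ∂μ) := by
  set h : ι → E → ℝ≥0∞ := fun c x => ∫⁻ y, κ c (x - y) * β c y ∂μ with hh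
  have hm : ∀ c, Measurable (h c) := fun c => measurable_lintegral_conv (hκ c) (hβ c)
  have key : ∀ x, (∑ c ∈ F, h c x) ^ 2 ≤ 2 * ∑ c ∈ F, ∑ c' ∈ F with k c' ≤ k c, h c x * h c' x := by
    intro x
    have hs : ∑ c ∈ F, ∑ c' ∈ F, (if k c' ≤ k c then h c x * h c' x else 0) =
        ∑ c ∈ F, ∑ c' ∈ F, (if k c ≤ k c' then h c x * h c' x else 0) := by
      rw [Finset.sum_comm]
      simp_rw [mul_comm]
    simp_rw [Finset.sum_filter]
    rw [two_mul]
    nth_rewrite 2 [hs]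
    rw [← Finset.sum_add_distrib, sq, Finset.sum_mul_sum]
    refine Finset.sum_le_sum fun c _ => ?_
    rw [← Finset.sum_add_distrib]
    refine Finset.sum_le_sum fun c' _ => ?_
    rcases le_total (k c') (k c) with h1 | h1
    · rw [if_pos h1]; exact le_self_add
    · rw [if_pos h1]; exact le_add_self
  calc _ ≤ ∫⁻ x, 2 * ∑ c ∈ F, ∑ c' ∈ F with k c' ≤ k c, h c x * h c' x ∂μ := lintegral_mono key
    _ = 2 * ∑ c ∈ F, ∑ c' ∈ F with k c' ≤ k c, ∫⁻ x, h c x * h c' x ∂μ := by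
        rw [lintegral_const_mul _ (by fun_prop), lintegral_finsetSum _ (by fun_prop)]
        congr 2; ext c
        rw [lintegral_finsetSum _ (by fun_prop)]
    _ ≤ 2 * ∑ c ∈ F, M * ∫⁻ y, β c y ∂μ := by
        gcongr with c hc
        have hm3 : ∀ c', Measurable fun y =>
            ∫⁻ z, (∫⁻ x, κ c (x - y) * κ c' (x - z) ∂μ) * β c' z ∂μ := by
          intro c'
          apply Measurable.lintegral_prod_right'
            (f := fun p : E × E => (∫⁻ x, κ c (x - p.1) * κ c' (x - p.2) ∂μ) * β c' p.2)
          refine Measurable.mul ?_ (by fun_prop)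
          apply Measurable.lintegral_prod_right'
            (f := fun p : (E × E) × E => κ c (p.2 - p.1.1) * κ c' (p.2 - p.1.2))
          fun_prop
        have hm4 : ∀ c', Measurable fun y =>
            (∫⁻ z, (∫⁻ x, κ c (x - y) * κ c' (x - z) ∂μ) * β c' z ∂μ) * β c y :=
          fun c' => (hm3 c').mul (hβ c)
        simp_rw [hh, lintegral_conv_mul_conv (hκ _) (hβ _) (hκ _) (hβ _)]
        rw [← lintegral_finsetSum _ (fun c' _ => hm4 c'),
          ← lintegral_const_mul _ (hβ c)]
        refine lintegral_mono fun y => ?_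
        rw [← Finset.sum_mul]
        gcongr
        exact H c hc y
    _ = _ := by simp only [Finset.mul_sum]

end Bilinear

variable {d : ℕ} {φ Om : Rd d → ℝ}

/-- A finite family of disjoint dyadic cubes carrying mean-zero functions of height `α`. -/
structure AtomFamily (d : ℕ) (F : Finset (ℤ × (Fin d → ℤ))) (b : ℤ × (Fin d → ℤ) → Rd d → ℝ)
    (α : ℝ) : Prop where
  nonneg : 0 ≤ α
  disjoint : (F : Set (ℤ × (Fin d → ℤ))).Pairwise fun c c' =>
    Disjoint (dcube d 0 c.1 c.2) (dcube d 0 c'.1 c'.2)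
  support_subset : ∀ c ∈ F, Function.support (b c) ⊆ dcube d 0 c.1 c.2
  measurable : ∀ c, Measurable (b c)
  integrable : ∀ c, Integrable (b c)
  integral_zero : ∀ c ∈ F, ∫ x, b c x = 0
  bound : ∀ c ∈ F, ∫ x, |b c x| ≤ α * (2:ℝ) ^ (c.1 * d)

theorem Kker_mem_tube (hφ : AdmissiblePhi d φ) {i : Fin d} {e : Fin d → ℝ} {ε : ℝ} (hε : 0 ≤ ε)
    (hcone : ∀ x, Om x ≠ 0 → ∀ j, j ≠ i → |x j - x i * e j| ≤ ε * |x i|) {k : ℤ} {x : Rd d}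
    (hx : Kker d φ Om k x ≠ 0) : x ∈ tube i e ((2:ℝ) ^ k) (ε * (2:ℝ) ^ k) := by
  have h1 : |x i| ≤ (2:ℝ) ^ k := by
    refine (abs_apply_le_norm x i).trans ?_
    by_contra h
    refine hx (Kker_eq_zero_of_le_norm hφ ((not_le.1 h).le.trans' ?_))
    exact zpow_le_zpow_right₀ (by norm_num) (by linarith)
  have h2 : Om x ≠ 0 := by
    intro h
    exact hx (by rw [Kker, h, mul_zero, zero_mul])
  exact ⟨h1, fun j hj => (hcone x h2 j hj).trans (by gcongr)⟩

theorem two_zpow_mul_pow (hd : 1 ≤ d) (k : ℤ) :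
    (2:ℝ) ^ k * ((2:ℝ) ^ k) ^ (d - 1) = (2:ℝ) ^ (k * d) := by
  rw [← pow_succ', Nat.sub_add_cancel hd, zpow_mul, zpow_natCast]

theorem sum_tube_mass_le {F : Finset (ℤ × (Fin d → ℤ))} {b : ℤ × (Fin d → ℤ) → Rd d → ℝ} {α : ℝ}
    (hF : AtomFamily d F b α) (hd : 1 ≤ d) {i : Fin d} {e : Fin d → ℝ} (he : ∀ j, |e j| ≤ 1)
    {ε : ℝ} (hε : 0 ≤ ε) (hε1 : ε ≤ 1) {s : ℕ} (hs : (2:ℝ) ^ (-(s:ℤ)) ≤ ε) (k : ℤ)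
    {F' : Finset (ℤ × (Fin d → ℤ))} (hF' : F' ⊆ F) (hk : ∀ c ∈ F', c.1 + s ≤ k) (y : Rd d) :
    ∑ c ∈ F', ∫⁻ z, (tube i e (2 * (2:ℝ) ^ k) (2 * (ε * (2:ℝ) ^ k))).indicator 1 (z - y) * ‖b c z‖ₑ ≤
      ENNReal.ofReal (α * (8 ^ d * ε ^ (d - 1) * (2:ℝ) ^ (k * d))) := by
  classical
  set T := tube i e (2 * (2:ℝ) ^ k) (2 * (ε * (2:ℝ) ^ k)) with hT
  set T' := tube i e (3 * (2:ℝ) ^ k) (4 * (ε * (2:ℝ) ^ k)) with hT'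
  set P : ℤ × (Fin d → ℤ) → Prop := fun c => ∃ z ∈ dcube d 0 c.1 c.2, z - y ∈ T with hP
  have hsub : ∀ c ∈ F', P c → dcube d 0 c.1 c.2 ⊆ (fun z => z - y) ⁻¹' T' := by
    rintro c hc ⟨z, hz, hzT⟩ x hx
    have h2 : (2:ℝ) ^ c.1 ≤ ε * (2:ℝ) ^ k := by
      calc (2:ℝ) ^ c.1 ≤ (2:ℝ) ^ (-(s:ℤ) + k) :=
            zpow_le_zpow_right₀ (by norm_num) (by linarith [hk c hc])
        _ = (2:ℝ) ^ (-(s:ℤ)) * (2:ℝ) ^ k := zpow_add₀ (by norm_num) _ _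
        _ ≤ _ := by gcongr
    have h3 : x - z ∈ tube i e ((2:ℝ) ^ c.1) (2 * (2:ℝ) ^ c.1) :=
      mem_tube_of_abs_le he fun j => by
        simpa using abs_sub_le_of_mem_dcube hx hz j
    have h4 := add_mem_tube h3 hzT
    have hk0 : (0:ℝ) < (2:ℝ) ^ k := by positivity
    have h5 : ε * (2:ℝ) ^ k ≤ (2:ℝ) ^ k := by nlinarith
    rw [mem_preimage]
    rw [sub_add_sub_cancel] at h4
    exact tube_mono (by linarith) (by linarith) h4
  have hterm : ∀ c ∈ F', ∫⁻ z, T.indicator 1 (z - y) * ‖b c z‖ₑ ≤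
      if P c then ENNReal.ofReal α * volume (dcube d 0 c.1 c.2) else 0 := by
    intro c hc
    split_ifs with h
    · calc _ ≤ ∫⁻ z, ‖b c z‖ₑ := by
            refine lintegral_mono fun z => ?_
            calc T.indicator 1 (z - y) * ‖b c z‖ₑ ≤ 1 * ‖b c z‖ₑ := by
                  gcongr
                  exact indicator_le_self' (fun _ _ => zero_le) _ |>.trans (by simp)
              _ = _ := one_mul _
        _ = ENNReal.ofReal (∫ z, |b c z|) := by
            rw [← ofReal_integral_norm_eq_lintegral_enorm (hF.integrable c)]; rfl
        _ ≤ _ := by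
            rw [volume_dcube, ← ENNReal.ofReal_mul hF.nonneg]
            exact ENNReal.ofReal_le_ofReal (hF.bound c (hF' hc))
    · rw [nonpos_iff_eq_zero]
      refine (lintegral_congr fun z => ?_).trans lintegral_zero
      by_cases hz : z - y ∈ T
      · by_cases hz2 : b c z = 0
        · simp [hz2]
        · exact absurd ⟨z, hF.support_subset c (hF' hc) hz2, hz⟩ h
      · simp [hz]
  calc _ ≤ ∑ c ∈ F', if P c then ENNReal.ofReal α * volume (dcube d 0 c.1 c.2) else 0 :=
        Finset.sum_le_sum hterm
    _ = ENNReal.ofReal α * ∑ c ∈ F' with P c, volume (dcube d 0 c.1 c.2) := by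
        rw [← Finset.sum_filter, Finset.mul_sum]
    _ = ENNReal.ofReal α * volume (⋃ c ∈ F'.filter P, dcube d 0 c.1 c.2) := by
        rw [measure_biUnion_finset]
        · intro c hc c' hc' hne
          exact hF.disjoint (hF' (Finset.mem_filter.1 hc).1) (hF' (Finset.mem_filter.1 hc').1) hne
        · exact fun c _ => measurableSet_dcube _ _ _
    _ ≤ ENNReal.ofReal α * volume ((fun z => z - y) ⁻¹' T') := by
        gcongr
        refine iUnion₂_subset fun c hc => ?_
        exact hsub c (Finset.mem_filter.1 hc).1 (Finset.mem_filter.1 hc).2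
    _ = ENNReal.ofReal α * volume T' := by
        congr 1
        exact (measurePreserving_sub_right volume y).measure_preimage
          (measurableSet_tube _ _ _ _).nullMeasurableSet
    _ ≤ ENNReal.ofReal α * ENNReal.ofReal (2 * (3 * (2:ℝ) ^ k) * (2 * (4 * (ε * (2:ℝ) ^ k))) ^ (d - 1)) := by
        gcongr
        exact volume_tube_le _ _ (by positivity) (by positivity)
    _ ≤ _ := by
        rw [← ENNReal.ofReal_mul hF.nonneg]
        refine ENNReal.ofReal_le_ofReal (mul_le_mul_of_nonneg_left ?_ hF.nonneg)
        have e8 : (8:ℝ) ^ d = 8 * 8 ^ (d - 1) := by rw [← pow_succ', Nat.sub_add_cancel hd]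
        rw [← two_zpow_mul_pow hd, e8]
        have : 2 * (4 * (ε * (2:ℝ) ^ k)) = 8 * ε * (2:ℝ) ^ k := by ring
        rw [this, mul_pow, mul_pow]
        have hX : 0 ≤ (8:ℝ) ^ (d - 1) * ε ^ (d - 1) * ((2:ℝ) ^ k * ((2:ℝ) ^ k) ^ (d - 1)) := by
          positivity
        nlinarith

theorem AdmissiblePhi.exists_cell_bound (hφ : AdmissiblePhi d φ) (hd : 1 ≤ d) :
    ∃ C : ℝ, 0 < C ∧ ∀ (Om : Rd d → ℝ) (A : ℝ) (i : Fin d) (e : Fin d → ℝ) (ε : ℝ) (s : ℕ)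
      (F : Finset (ℤ × (Fin d → ℤ))) (b : ℤ × (Fin d → ℤ) → Rd d → ℝ) (α : ℝ),
      Measurable Om → (∀ x, |Om x| ≤ A) → (∀ j, |e j| ≤ 1) → ε ≤ 1 →
      (2:ℝ) ^ (-(s:ℤ)) ≤ ε → (∀ x, Om x ≠ 0 → ∀ j, j ≠ i → |x j - x i * e j| ≤ ε * |x i|) →
      AtomFamily d F b α →
      ∫⁻ x, (∑ c ∈ F, ∫⁻ y, ‖Kker d φ Om (c.1 + s) (x - y)‖ₑ * ‖b c y‖ₑ) ^ 2 ≤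
        ENNReal.ofReal (C * A ^ 2 * (ε ^ (d - 1)) ^ 2 * α) * ∑ c ∈ F, ∫⁻ y, ‖b c y‖ₑ := by
  obtain ⟨B, hB0, hB⟩ := AdmissiblePhi.exists_bound hφ
  refine ⟨2 * B ^ 2 * 16 ^ d, by positivity, fun Om A i e ε s F b α hOm hA he hε1 hs hcone hF => ?_⟩
  have hA0 : 0 ≤ A := (abs_nonneg _).trans (hA 0)
  have hε0 : 0 ≤ ε := le_trans (by positivity) hs
  have hα := hF.nonneg
  set κ : ℤ × (Fin d → ℤ) → Rd d → ℝ≥0∞ := fun c u => ‖Kker d φ Om (c.1 + s) u‖ₑ with hκ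
  have hκm : ∀ c, Measurable (κ c) := fun c => (measurable_Kker hφ hOm _).enorm
  have hβm : ∀ c, Measurable fun y => ‖b c y‖ₑ := fun c => (hF.measurable c).enorm
  set T : ℤ → Set (Rd d) := fun k => tube i e ((2:ℝ) ^ k) (ε * (2:ℝ) ^ k) with hT
  set T2 : ℤ → Set (Rd d) := fun k => tube i e (2 * (2:ℝ) ^ k) (2 * (ε * (2:ℝ) ^ k)) with hT2
  have hTm : ∀ k, MeasurableSet (T k) := fun k => measurableSet_tube _ _ _ _
  have hκle : ∀ c u, κ c u ≤ ENNReal.ofReal (B * A * (2:ℝ) ^ (-((c.1 + s) * d))) *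
      (T (c.1 + s)).indicator 1 u := by
    intro c u
    by_cases hu : u ∈ T (c.1 + s)
    · rw [indicator_of_mem hu, Pi.one_apply, mul_one]
      simp only [κ, Real.enorm_eq_ofReal_abs]
      exact ENNReal.ofReal_le_ofReal (hB Om A hA _ _)
    · have : Kker d φ Om (c.1 + s) u = 0 := by
        by_contra h
        exact hu (Kker_mem_tube hφ hε0 hcone h)
      simp [κ, this]
  set M : ℝ≥0∞ := ENNReal.ofReal (B ^ 2 * 16 ^ d * A ^ 2 * (ε ^ (d - 1)) ^ 2 * α) with hM
  have key := lintegral_sq_sum_conv_le (μ := (volume : Measure (Rd d))) F (fun c => c.1) hκm hβm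
    (M := M) ?_
  · refine key.trans (le_of_eq ?_)
    rw [← mul_assoc]
    congr 1
    rw [hM, show (2:ℝ≥0∞) = ENNReal.ofReal 2 by simp, ← ENNReal.ofReal_mul (by norm_num)]
    congr 1; ring
  intro c hc y
  have hin : ∀ c' ∈ F.filter (fun c' => c'.1 ≤ c.1), ∀ z, ∫⁻ x, κ c (x - y) * κ c' (x - z) ≤
      ENNReal.ofReal (B * A * (2:ℝ) ^ (-((c.1 + s) * d)) * (B * A * (2 ^ d * ε ^ (d - 1)))) *
        (T2 (c.1 + s)).indicator 1 (z - y) := by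
    intro c' hc' z
    have hle := (Finset.mem_filter.1 hc').2
    have hle2 : (2:ℝ) ^ (c'.1 + s) ≤ (2:ℝ) ^ (c.1 + s) :=
      zpow_le_zpow_right₀ (by norm_num) (by linarith)
    have hpt : ∀ x, κ c (x - y) * κ c' (x - z) ≤
        ENNReal.ofReal (B * A * (2:ℝ) ^ (-((c.1 + s) * d))) * (T2 (c.1 + s)).indicator 1 (z - y) *
        ENNReal.ofReal (B * A * (2:ℝ) ^ (-((c'.1 + s) * d))) *
        (T (c'.1 + s)).indicator 1 (x - z) := by
      intro x
      by_cases h1 : x - y ∈ T (c.1 + s)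
      · by_cases h2 : x - z ∈ T (c'.1 + s)
        · have h3 : z - y ∈ T2 (c.1 + s) := by
            have := sub_mem_tube h1 h2
            rw [sub_sub_sub_cancel_left] at this
            refine tube_mono (by linarith) ?_ this
            nlinarith
          have e1 := hκle c (x - y)
          have e2 := hκle c' (x - z)
          rw [indicator_of_mem h1, Pi.one_apply, mul_one] at e1
          rw [indicator_of_mem h3, Pi.one_apply, mul_one, mul_assoc]
          exact mul_le_mul' e1 e2
        · have e2 := hκle c' (x - z)
          rw [indicator_of_notMem h2, mul_zero, nonpos_iff_eq_zero] at e2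
          rw [e2, mul_zero]; exact zero_le
      · have e1 := hκle c (x - y)
        rw [indicator_of_notMem h1, mul_zero, nonpos_iff_eq_zero] at e1
        rw [e1, zero_mul]; exact zero_le
    refine (lintegral_mono hpt).trans ?_
    have hmz : Measurable fun x => (T (c'.1 + s)).indicator (1 : Rd d → ℝ≥0∞) (x - z) :=
      (measurable_one.indicator (hTm _)).comp (measurable_sub_const z)
    rw [lintegral_const_mul _ hmz,
      lintegral_sub_right_eq_self (fun x => (T (c'.1 + s)).indicator (1 : Rd d → ℝ≥0∞) x) z,
      lintegral_indicator_one (hTm _)]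
    calc _ ≤ ENNReal.ofReal (B * A * (2:ℝ) ^ (-((c.1 + s) * d))) * (T2 (c.1 + s)).indicator 1 (z - y) *
          ENNReal.ofReal (B * A * (2:ℝ) ^ (-((c'.1 + s) * d))) *
          ENNReal.ofReal (2 * (2:ℝ) ^ (c'.1 + s) * (2 * (ε * (2:ℝ) ^ (c'.1 + s))) ^ (d - 1)) := by
          gcongr
          exact volume_tube_le _ _ (by positivity) (by positivity)
      _ = (ENNReal.ofReal (B * A * (2:ℝ) ^ (-((c.1 + s) * d))) *
          ENNReal.ofReal (B * A * (2:ℝ) ^ (-((c'.1 + s) * d)) *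
          (2 * (2:ℝ) ^ (c'.1 + s) * (2 * (ε * (2:ℝ) ^ (c'.1 + s))) ^ (d - 1)))) *
          (T2 (c.1 + s)).indicator 1 (z - y) := by
          rw [ENNReal.ofReal_mul (p := B * A * (2:ℝ) ^ (-((c'.1 + s) * d))) (by positivity)]; ring
      _ = _ := by
          rw [← ENNReal.ofReal_mul (by positivity)]
          congr 3
          have e8 : (2:ℝ) ^ d = 2 * 2 ^ (d - 1) := by rw [← pow_succ', Nat.sub_add_cancel hd]
          have e9 : (2:ℝ) ^ (-((c'.1 + s) * d)) * ((2:ℝ) ^ (c'.1 + s) * ((2:ℝ) ^ (c'.1 + s)) ^ (d - 1)) = 1 := by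
            rw [two_zpow_mul_pow hd, ← zpow_add₀ (by norm_num)]; simp
          rw [e8, mul_pow 2, mul_pow ε]
          linear_combination (B * A * (2 * 2 ^ (d - 1) * ε ^ (d - 1))) * e9
  calc _ ≤ ∑ c' ∈ F with c'.1 ≤ c.1, ∫⁻ z,
        (ENNReal.ofReal (B * A * (2:ℝ) ^ (-((c.1 + s) * d)) * (B * A * (2 ^ d * ε ^ (d - 1)))) *
        (T2 (c.1 + s)).indicator 1 (z - y)) * ‖b c' z‖ₑ := by
        refine Finset.sum_le_sum fun c' hc' => lintegral_mono fun z => ?_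
        gcongr
        exact hin c' hc' z
    _ = ENNReal.ofReal (B * A * (2:ℝ) ^ (-((c.1 + s) * d)) * (B * A * (2 ^ d * ε ^ (d - 1)))) *
        ∑ c' ∈ F with c'.1 ≤ c.1, ∫⁻ z, (T2 (c.1 + s)).indicator 1 (z - y) * ‖b c' z‖ₑ := by
        rw [Finset.mul_sum]
        refine Finset.sum_congr rfl fun c' _ => ?_
        rw [← lintegral_const_mul]
        · congr 1; ext z; ring
        · exact ((measurable_one.indicator (measurableSet_tube _ _ _ _)).comp
            (measurable_sub_const y)).mul (hβm c')
    _ ≤ ENNReal.ofReal (B * A * (2:ℝ) ^ (-((c.1 + s) * d)) * (B * A * (2 ^ d * ε ^ (d - 1)))) *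
        ENNReal.ofReal (α * (8 ^ d * ε ^ (d - 1) * (2:ℝ) ^ ((c.1 + s) * d))) := by
        gcongr
        refine sum_tube_mass_le hF hd he hε0 hε1 hs (c.1 + s) (Finset.filter_subset _ _) ?_ y
        intro c' hc'
        linarith [(Finset.mem_filter.1 hc').2]
    _ = M := by
        rw [← ENNReal.ofReal_mul (by positivity), hM]
        congr 1
        have e9 : (2:ℝ) ^ (-((c.1 + s) * d)) * (2:ℝ) ^ ((c.1 + s) * d) = 1 := by
          rw [← zpow_add₀ (by norm_num)]; simp
        have e16 : (16:ℝ) ^ d = 2 ^ d * 8 ^ d := by rw [← mul_pow]; norm_num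
        rw [e16]
        linear_combination (B ^ 2 * A ^ 2 * 2 ^ d * 8 ^ d * (ε ^ (d - 1)) ^ 2 * α) * e9

section Convolution

variable {E : Type*} [NormedAddCommGroup E] [InnerProductSpace ℝ E] [FiniteDimensional ℝ E]
  [MeasurableSpace E] [BorelSpace E]

/-- Convolution of real functions, as an integral. -/
def kconv (K g : E → ℝ) (x : E) : ℝ := ∫ y, K (x - y) * g y

theorem ofReal_kconv (K g : E → ℝ) :
    (fun x => (kconv K g x : ℂ)) = convolution (fun y => (g y : ℂ)) (fun y => (K y : ℂ))
      (ContinuousLinearMap.mul ℂ ℂ) volume := by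
  ext x
  simp only [kconv, convolution, ContinuousLinearMap.mul_apply']
  rw [← integral_complex_ofReal]
  congr 1; ext y
  push_cast; ring

theorem integrable_kconv {K g : E → ℝ} (hK : Integrable K) (hg : Integrable g) :
    Integrable (kconv K g) := by
  have h : Integrable fun x => (kconv K g x : ℂ) := by
    rw [ofReal_kconv]
    exact Integrable.integrable_convolution _ hg.ofReal hK.ofReal
  exact (h.re).congr (Filter.Eventually.of_forall fun x => by simp)

theorem fourier_kconv {K g : E → ℝ} (hK : Integrable K) (hg : Integrable g) (ξ : E) :
    𝓕 (fun x => (kconv K g x : ℂ)) ξ = 𝓕 (fun x => (K x : ℂ)) ξ * 𝓕 (fun x => (g x : ℂ)) ξ := by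
  have hKC : Integrable fun y => (K y : ℂ) := hK.ofReal (𝕜 := ℂ)
  have hgC : Integrable fun y => (g y : ℂ) := hg.ofReal (𝕜 := ℂ)
  rw [ofReal_kconv, Real.fourier_mul_convolution_eq hgC hKC, mul_comm]

theorem integrable_mul_of_bound {K g : E → ℝ} (hK : Measurable K) {M : ℝ} (hM : ∀ x, |K x| ≤ M)
    (hg : Integrable g) (x : E) : Integrable fun y => K (x - y) * g y :=
  hg.bdd_mul (c := M) (hK.comp (measurable_const_sub x)).aestronglyMeasurable
    (Filter.Eventually.of_forall fun _ => hM _)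

theorem abs_kconv_le {K g : E → ℝ} {M : ℝ} (hM : ∀ x, |K x| ≤ M)
    (hg : Integrable g) (x : E) : |kconv K g x| ≤ M * ∫ y, |g y| := by
  rw [kconv, ← integral_const_mul]
  refine (abs_integral_le_integral_abs).trans ?_
  refine integral_mono_of_nonneg (Filter.Eventually.of_forall fun y => abs_nonneg _)
    (hg.abs.const_mul M) (Filter.Eventually.of_forall fun y => ?_)
  simp only [abs_mul]
  gcongr
  exact hM _

theorem memLp_two_kconv {K g : E → ℝ} (hK : Integrable K) {M : ℝ} (hM : ∀ x, |K x| ≤ M)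
    (hg : Integrable g) : MemLp (kconv K g) 2 volume := by
  have h1 := integrable_kconv hK hg
  rw [memLp_two_iff_integrable_sq h1.1]
  refine (h1.bdd_mul (c := M * ∫ y, |g y|) h1.1
    (Filter.Eventually.of_forall fun x => abs_kconv_le hM hg x)).congr
    (Filter.Eventually.of_forall fun x => (sq _).symm)

theorem enorm_kconv_le (K g : E → ℝ) (x : E) :
    ‖kconv K g x‖ₑ ≤ ∫⁻ y, ‖K (x - y)‖ₑ * ‖g y‖ₑ := by
  refine (enorm_integral_le_lintegral_enorm _).trans (le_of_eq ?_)
  simp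

end Convolution

section DirectionCount

variable {d : ℕ}

/-- Indices of the angular cells in the sector where the `i`-th coordinate dominates. -/
def cellIndices (p : ℕ) (i : Fin d) : Finset (Fin d → ℤ) :=
  Fintype.piFinset fun j => if j = i then {(2:ℤ) ^ p} else Finset.Icc (-2 ^ p) (2 ^ p)

theorem mem_cellIndices {p : ℕ} {i : Fin d} {q : Fin d → ℤ} :
    q ∈ cellIndices p i ↔ q i = 2 ^ p ∧ ∀ j ≠ i, |q j| ≤ 2 ^ p := by
  rw [cellIndices, Fintype.mem_piFinset]
  constructor
  · intro h
    refine ⟨by simpa using h i, fun j hj => ?_⟩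
    have := h j
    rw [if_neg hj, Finset.mem_Icc] at this
    exact abs_le.2 this
  · rintro ⟨h1, h2⟩ j
    by_cases hj : j = i
    · subst hj; simp [h1]
    · rw [if_neg hj, Finset.mem_Icc]
      exact abs_le.1 (h2 j hj)

theorem abs_le_of_mem_cellIndices {p : ℕ} {i : Fin d} {q : Fin d → ℤ} (h : q ∈ cellIndices p i)
    (j : Fin d) : |q j| ≤ 2 ^ p := by
  rw [mem_cellIndices] at h
  by_cases hj : j = i
  · subst hj; rw [h.1, abs_of_pos (by positivity)]
  · exact h.2 j hj

theorem card_cellIndices_mul_le (p : ℕ) (i : Fin d) :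
    2 ^ p * (cellIndices p i).card ≤ (3 * 2 ^ p) ^ d := by
  have h1 : (2 ^ p : ℕ) = ∏ j : Fin d, if j = i then 2 ^ p else 1 := by simp
  have h2 : (3 * 2 ^ p) ^ d = ∏ _j : Fin d, 3 * 2 ^ p := by simp
  rw [cellIndices, Fintype.card_piFinset, h2]
  nth_rewrite 1 [h1]
  rw [← Finset.prod_mul_distrib]
  refine Finset.prod_le_prod' fun j _ => ?_
  have hp : 1 ≤ 2 ^ p := Nat.one_le_two_pow
  split_ifs
  · simp
  · rw [Int.card_Icc, one_mul]
    have : ((2:ℤ) ^ p + 1 - -2 ^ p) = ((2 * 2 ^ p + 1 : ℕ) : ℤ) := by push_cast; ring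
    rw [this, Int.toNat_natCast]
    omega

/-- Cells whose direction is nearly orthogonal to `ξ`. -/
def badCells (p : ℕ) (i : Fin d) (ξ : Rd d) : Finset (Fin d → ℤ) :=
  (cellIndices p i).filter fun q => |∑ j, (q j : ℝ) * ξ j| ≤ 2 * ∑ j, |ξ j|

theorem sum_abs_pos {ξ : Rd d} (hξ : ξ ≠ 0) : 0 < ∑ j, |ξ j| := by
  refine lt_of_lt_of_le (norm_pos_iff.2 hξ) (norm_le_sum_abs ξ)

theorem card_int_filter_le (S : Finset ℤ) (a B R : ℝ) (L : ℕ) (ha : a ≠ 0)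
    (hL : 2 * R ≤ L * |a|) (hS : ∀ z ∈ S, |z * a + B| ≤ R) : S.card ≤ L + 1 := by
  rcases S.eq_empty_or_nonempty with rfl | hne
  · simp
  set z₀ := S.min' hne
  have hsub : S ⊆ Finset.Icc z₀ (z₀ + L) := by
    intro z hz
    rw [Finset.mem_Icc]
    refine ⟨S.min'_le z hz, ?_⟩
    have h0 := hS z₀ (S.min'_mem hne)
    have h1 := hS z hz
    have h2 : |((z:ℝ) - z₀) * a| ≤ 2 * R := by
      have : ((z:ℝ) - z₀) * a = (z * a + B) - (z₀ * a + B) := by ring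
      rw [this]
      exact (abs_sub _ _).trans (by linarith)
    rw [abs_mul] at h2
    have h3 : |(z:ℝ) - z₀| ≤ L := le_of_mul_le_mul_right (h2.trans hL) (abs_pos.2 ha)
    have h4 : (z:ℝ) ≤ z₀ + L := by linarith [le_abs_self ((z:ℝ) - z₀)]
    exact_mod_cast h4
  refine (Finset.card_le_card hsub).trans ?_
  rw [Int.card_Icc]; omega

theorem exists_large_coordinate {p : ℕ} (hp : 3 ≤ p) (i : Fin d) {ξ : Rd d} (hξ : ξ ≠ 0)
    {q : Fin d → ℤ} (hq : q ∈ badCells p i ξ) :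
    ∃ j ≠ i, (∑ j, |ξ j|) ≤ 4 * d * |ξ j| := by
  by_contra! hcon
  rw [badCells, Finset.mem_filter] at hq
  obtain ⟨hq, hle⟩ := hq
  have hpos := sum_abs_pos hξ
  set T := ∑ j, |ξ j| with hT
  have hd : (0:ℝ) < d := by
    have : 0 < d := i.pos
    exact_mod_cast this
  have hsplit : T = |ξ i| + ∑ j ∈ Finset.univ.erase i, |ξ j| := by
    rw [hT, Finset.add_sum_erase _ (fun j => |ξ j|) (Finset.mem_univ i)]
  have hsmall : ∑ j ∈ Finset.univ.erase i, |ξ j| ≤ T / 4 := by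
    calc ∑ j ∈ Finset.univ.erase i, |ξ j| ≤ ∑ j ∈ Finset.univ.erase i, T / (4 * d) := by
          refine Finset.sum_le_sum fun j hj => ?_
          rw [le_div_iff₀ (by positivity)]
          linarith [hcon j (Finset.ne_of_mem_erase hj)]
      _ ≤ d * (T / (4 * d)) := by
          rw [Finset.sum_const, nsmul_eq_mul]
          gcongr
          refine (Finset.card_erase_le).trans (by simp)
      _ = T / 4 := by field_simp
  have hq2 := mem_cellIndices.1 hq
  have h1 : ∑ j, (q j : ℝ) * ξ j = 2 ^ p * ξ i + ∑ j ∈ Finset.univ.erase i, (q j : ℝ) * ξ j := by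
    rw [← Finset.add_sum_erase _ _ (Finset.mem_univ i), hq2.1]; push_cast; ring
  have h2 : |∑ j ∈ Finset.univ.erase i, (q j : ℝ) * ξ j| ≤ 2 ^ p * (T / 4) := by
    refine (Finset.abs_sum_le_sum_abs _ _).trans ?_
    calc _ ≤ ∑ j ∈ Finset.univ.erase i, 2 ^ p * |ξ j| := by
          refine Finset.sum_le_sum fun j _ => ?_
          rw [abs_mul]
          gcongr
          have : ((|q j| : ℤ) : ℝ) ≤ ((2 ^ p : ℤ) : ℝ) :=
            Int.cast_le.2 (abs_le_of_mem_cellIndices hq j)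
          simpa using this
      _ ≤ _ := by rw [← Finset.mul_sum]; gcongr
  have h3 : (2:ℝ) ^ p * |ξ i| ≤ |∑ j, (q j : ℝ) * ξ j| + 2 ^ p * (T / 4) := by
    have : (2:ℝ) ^ p * |ξ i| = |(2:ℝ) ^ p * ξ i| := by
      rw [abs_mul, abs_of_pos (a := (2:ℝ) ^ p) (by positivity)]
    rw [this, show (2:ℝ) ^ p * ξ i = ∑ j, (q j : ℝ) * ξ j -
      ∑ j ∈ Finset.univ.erase i, (q j : ℝ) * ξ j by rw [h1]; ring]
    exact (abs_sub _ _).trans (by linarith)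
  have h4 : (8:ℝ) ≤ 2 ^ p := by
    calc (8:ℝ) = 2 ^ 3 := by norm_num
      _ ≤ 2 ^ p := by gcongr; norm_num
  nlinarith

theorem card_badCells_mul_le {p : ℕ} (hp : 3 ≤ p) (i : Fin d) {ξ : Rd d} (hξ : ξ ≠ 0) :
    2 ^ p * 2 ^ p * (badCells p i ξ).card ≤ (8 * 2 * d + 1) * (3 * 2 ^ p) ^ d := by
  rcases (badCells p i ξ).eq_empty_or_nonempty with h | ⟨q₀, hq₀⟩
  · simp [h]
  obtain ⟨j₀, hj₀, hlarge⟩ := exists_large_coordinate hp i hξ hq₀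
  have hpos := sum_abs_pos hξ
  have hξj : ξ j₀ ≠ 0 := by
    intro h
    rw [h] at hlarge; simp at hlarge; linarith
  set I : Finset (Fin d → ℤ) := Fintype.piFinset fun j =>
    if j = i then {(2:ℤ) ^ p} else if j = j₀ then {0} else Finset.Icc (-2 ^ p) (2 ^ p) with hI
  have hmaps : (badCells p i ξ).image (fun q => Function.update q j₀ 0) ⊆ I := by
    intro q' hq'
    obtain ⟨q, hq, rfl⟩ := Finset.mem_image.1 hq'
    have hq1 := (Finset.mem_filter.1 hq).1
    rw [cellIndices, Fintype.mem_piFinset] at hq1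
    rw [hI, Fintype.mem_piFinset]
    intro j
    by_cases hj : j = j₀
    · subst hj; simp [hj₀]
    · simpa [hj] using hq1 j
  have hcardI : 2 ^ p * 2 ^ p * I.card ≤ (3 * 2 ^ p) ^ d := by
    have h1 : ∀ i : Fin d, (2 ^ p : ℕ) = ∏ j : Fin d, if j = i then 2 ^ p else 1 := by simp
    have h2 : (3 * 2 ^ p) ^ d = ∏ _j : Fin d, 3 * 2 ^ p := by simp
    calc 2 ^ p * 2 ^ p * I.card = (∏ j : Fin d, if j = i then 2 ^ p else 1) *
          (∏ j : Fin d, if j = j₀ then 2 ^ p else 1) * I.card := by rw [← h1, ← h1]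
      _ ≤ _ := ?_
    rw [hI, Fintype.card_piFinset, h2, ← Finset.prod_mul_distrib, ← Finset.prod_mul_distrib]
    refine Finset.prod_le_prod' fun j _ => ?_
    have hp : 1 ≤ 2 ^ p := Nat.one_le_two_pow
    by_cases hji : j = i
    · subst hji; simp [hj₀.symm]
    by_cases hjj : j = j₀
    · subst hjj; simp [hj₀]
    · rw [if_neg hji, if_neg hjj, if_neg hji, if_neg hjj, Int.card_Icc, one_mul, one_mul]
      have : ((2:ℤ) ^ p + 1 - -2 ^ p) = ((2 * 2 ^ p + 1 : ℕ) : ℤ) := by push_cast; ring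
      rw [this, Int.toNat_natCast]
      omega
  have hfib : ∀ q' ∈ (badCells p i ξ).image (fun q => Function.update q j₀ 0),
      ((badCells p i ξ).filter fun q => Function.update q j₀ 0 = q').card ≤ 8 * 2 * d + 1 := by
    intro q' _
    set S := (badCells p i ξ).filter fun q => Function.update q j₀ 0 = q' with hS
    have hinj : Set.InjOn (fun q : Fin d → ℤ => q j₀) S := by
      intro q hq r hr hqr
      have h1 := (Finset.mem_filter.1 hq).2
      have h2 := (Finset.mem_filter.1 hr).2
      ext j
      by_cases hj : j = j₀
      · subst hj; exact hqr
      · have := congrFun (h1.trans h2.symm) j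
        simpa [hj] using this
    rw [← Finset.card_image_of_injOn hinj]
    refine card_int_filter_le _ (ξ j₀) (∑ j, (q' j : ℝ) * ξ j) (2 * ∑ j, |ξ j|) _ hξj ?_ ?_
    · push_cast; linarith
    · intro z hz
      obtain ⟨q, hq, rfl⟩ := Finset.mem_image.1 hz
      obtain ⟨hq1, hq2⟩ := Finset.mem_filter.1 hq
      have hq3 := (Finset.mem_filter.1 hq1).2
      convert hq3 using 2
      rw [← hq2, ← Finset.add_sum_erase _ (fun j => (q j : ℝ) * ξ j) (Finset.mem_univ j₀),
        ← Finset.add_sum_erase _ _ (Finset.mem_univ j₀)]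
      simp only [Function.update_self, Int.cast_zero, zero_mul, zero_add, add_right_inj]
      refine Finset.sum_congr rfl fun j hj => ?_
      rw [Function.update_of_ne (Finset.ne_of_mem_erase hj)]
  have h5 := Finset.card_le_mul_card_image (badCells p i ξ) _ hfib
  calc _ ≤ 2 ^ p * 2 ^ p * ((8 * 2 * d + 1) * I.card) := by
        gcongr
        exact h5.trans (by gcongr)
    _ = (8 * 2 * d + 1) * (2 ^ p * 2 ^ p * I.card) := by ring
    _ ≤ _ := by gcongr

end DirectionCount

section ScaleWeights

/-- Weights in the relative scale, growing slowly to the right and decaying fast to the left. -/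
def scaleWeight (d : ℕ) (i : ℤ) : ℝ := if 0 ≤ i then (3 / 2) ^ i else (2 ^ (d + 3)) ^ i

theorem scaleWeight_nonneg (d : ℕ) (i : ℤ) : 0 ≤ scaleWeight d i := by
  rw [scaleWeight]; split_ifs <;> positivity

theorem summable_pow_natAbs {a : ℝ} (h0 : 0 ≤ a) (h1 : a < 1) :
    Summable fun i : ℤ => a ^ i.natAbs := by
  refine Summable.of_nat_of_neg ?_ ?_
  · simpa using summable_geometric_of_lt_one h0 h1
  · simpa using summable_geometric_of_lt_one h0 h1

theorem scaleWeight_mul_profile_le (d : ℕ) (i : ℤ) :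
    scaleWeight d i * ((d * 2 ^ (-i)) * (1 + d * 2 ^ (-i)) ^ (d + 1)) ≤
      d * (1 + d) ^ (d + 1) * (3 / 4) ^ i.natAbs := by
  rw [scaleWeight]
  split_ifs with hi
  · obtain ⟨n, rfl⟩ := Int.eq_ofNat_of_zero_le hi
    have h1 : (2:ℝ) ^ (-(n:ℤ)) ≤ 1 := zpow_le_one_of_nonpos₀ (by norm_num) (by omega)
    calc (3 / 2 : ℝ) ^ (n:ℤ) * ((d * 2 ^ (-(n:ℤ))) * (1 + d * 2 ^ (-(n:ℤ))) ^ (d + 1))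
        ≤ (3 / 2 : ℝ) ^ (n:ℤ) * ((d * 2 ^ (-(n:ℤ))) * (1 + d * 1) ^ (d + 1)) := by gcongr
      _ = d * (1 + d) ^ (d + 1) * ((3 / 2 : ℝ) ^ (n:ℤ) * 2 ^ (-(n:ℤ))) := by ring
      _ = _ := by
        congr 1
        rw [zpow_neg, zpow_natCast, zpow_natCast, ← inv_pow, ← mul_pow]
        norm_num
  · obtain ⟨n, rfl⟩ : ∃ n : ℕ, i = -n := ⟨i.natAbs, by omega⟩
    rw [neg_neg, zpow_natCast, zpow_neg, zpow_natCast, Int.natAbs_neg, Int.natAbs_natCast]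
    have h1 : (1:ℝ) ≤ 2 ^ n := one_le_pow₀ (by norm_num)
    have h2 : (1 + d * 2 ^ n : ℝ) ≤ (1 + d) * 2 ^ n := by nlinarith
    calc (((2:ℝ) ^ (d + 3)) ^ n)⁻¹ * ((d * 2 ^ n) * (1 + d * 2 ^ n) ^ (d + 1))
        ≤ (((2:ℝ) ^ (d + 3)) ^ n)⁻¹ * ((d * 2 ^ n) * ((1 + d) * 2 ^ n) ^ (d + 1)) := by
          gcongr
      _ = d * (1 + d) ^ (d + 1) * ((((2:ℝ) ^ (d + 3)) ^ n)⁻¹ * (2 ^ n) ^ (d + 2)) := by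
          rw [mul_pow]; ring
      _ = d * (1 + d) ^ (d + 1) * (1 / 2) ^ n := by
          congr 1
          rw [inv_mul_eq_iff_eq_mul₀ (by positivity), ← pow_mul, ← pow_mul, one_div, inv_pow,
            eq_mul_inv_iff_mul_eq₀ (by positivity), ← pow_add]
          congr 1; ring
      _ ≤ _ := mul_le_mul_of_nonneg_left
          (pow_le_pow_left₀ (by norm_num) (by norm_num) _) (by positivity)

theorem sq_le_weight (d : ℕ) (hd : 1 ≤ d) (i : ℤ) (y : ℝ) (hy : (2:ℝ) ^ (-i) ≤ y) :
    (min 1 ((y / d) ^ (d + 2))⁻¹) ^ 2 ≤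
      (2 / 3) ^ i.natAbs * (((d:ℝ) ^ (d + 2)) ^ 2 * scaleWeight d i) := by
  have hd' : (1:ℝ) ≤ d := by exact_mod_cast hd
  have hy0 : 0 < y := lt_of_lt_of_le (by positivity) hy
  have hd2 : (1:ℝ) ≤ ((d:ℝ) ^ (d + 2)) ^ 2 := one_le_pow₀ (one_le_pow₀ hd')
  rw [scaleWeight]
  split_ifs with hi
  · obtain ⟨n, rfl⟩ := Int.eq_ofNat_of_zero_le hi
    rw [zpow_natCast, Int.natAbs_natCast]
    have h1 : (2 / 3 : ℝ) ^ n * (((d:ℝ) ^ (d + 2)) ^ 2 * (3 / 2) ^ n) = ((d:ℝ) ^ (d + 2)) ^ 2 := by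
      rw [mul_left_comm, ← mul_pow]; norm_num
    rw [h1]
    refine le_trans (pow_le_one₀ ?_ (min_le_left _ _)) hd2
    exact le_min zero_le_one (by positivity)
  · obtain ⟨n, rfl⟩ : ∃ n : ℕ, i = -n := ⟨i.natAbs, by omega⟩
    rw [neg_neg, zpow_natCast] at hy
    rw [zpow_neg, zpow_natCast, Int.natAbs_neg, Int.natAbs_natCast]
    have h0 : 0 ≤ min 1 ((y / d) ^ (d + 2))⁻¹ := le_min zero_le_one (by positivity)
    calc (min 1 ((y / d) ^ (d + 2))⁻¹) ^ 2 ≤ (((y / d) ^ (d + 2))⁻¹) ^ 2 := by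
          gcongr; exact min_le_right _ _
      _ ≤ ((((2:ℝ) ^ n / d) ^ (d + 2))⁻¹) ^ 2 := by gcongr
      _ = ((d:ℝ) ^ (d + 2)) ^ 2 * ((2 ^ n) ^ (2 * d + 4))⁻¹ := by
          rw [div_pow, inv_div, div_pow, div_eq_mul_inv]
          congr 2
          rw [← pow_mul]; congr 1; ring
      _ ≤ ((d:ℝ) ^ (d + 2)) ^ 2 * ((2 / 3) ^ n * ((2 ^ (d + 3)) ^ n)⁻¹) := by
          gcongr
          rw [← pow_mul, mul_comm n, pow_mul, ← inv_pow ((2:ℝ) ^ (2 * d + 4)),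
            ← inv_pow ((2:ℝ) ^ (d + 3)), ← mul_pow]
          gcongr
          have h2 : (1:ℝ) ≤ 2 ^ d := one_le_pow₀ (by norm_num)
          rw [show 2 * d + 4 = (d + 3) + (d + 1) by ring, pow_add, mul_inv, mul_comm]
          gcongr
          rw [pow_succ, inv_le_comm₀ (by positivity) (by norm_num)]
          norm_num
          linarith
      _ = _ := by ring

theorem enorm_sum_mul_sq_le {d : ℕ} (hd : 1 ≤ d) : ∃ C : ℝ, 0 < C ∧
    ∀ (p : ℤ) (t B : ℝ) (_ : 0 < t) (_ : 0 ≤ B) (S : Finset ℤ) (R z : ℤ → ℂ),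
      (∀ k ∈ S, ‖R k‖ ≤ B * min 1 (((2:ℝ) ^ (k - p) * t / d) ^ (d + 2))⁻¹) →
      ‖∑ k ∈ S, R k * z k‖ₑ ^ 2 ≤ ENNReal.ofReal (C * B ^ 2) *
        ∑ k ∈ S, ∑' i : ℤ, ENNReal.ofReal (scaleWeight d i) *
          (ENNReal.ofReal (Real.exp (-(Real.pi * ((2:ℝ) ^ (i + k - p)) ^ 2) * t ^ 2)) *
            ‖z k‖ₑ ^ 2) := by
  have hsum := summable_pow_natAbs (a := 2 / 3) (by norm_num) (by norm_num)
  set T₀ := ∑' i : ℤ, (2 / 3 : ℝ) ^ i.natAbs with hT₀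
  have hTpos : 0 < T₀ := hsum.tsum_pos (fun i => by positivity) 0 (by norm_num)
  have hd' : (0:ℝ) < d := by exact_mod_cast hd
  set D := ((d:ℝ) ^ (d + 2)) ^ 2 with hD
  have hDpos : 0 < D := by positivity
  refine ⟨T₀ * (D * Real.exp (4 * Real.pi)), by positivity, fun p t B ht hB S R z hR => ?_⟩
  obtain ⟨j₀, hj₀⟩ := exists_mem_Ico_zpow (y := (2:ℝ)) ht (by norm_num)
  have hlow : ∀ k, (2:ℝ) ^ (-(p - k - j₀)) ≤ (2:ℝ) ^ (k - p) * t := fun k => by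
    rw [show -(p - k - j₀) = (k - p) + j₀ by ring, zpow_add₀ (by norm_num)]
    gcongr; exact hj₀.1
  have hexp : ∀ k, 1 ≤ Real.exp (4 * Real.pi) *
      Real.exp (-(Real.pi * ((2:ℝ) ^ ((p - k - j₀) + k - p)) ^ 2) * t ^ 2) := fun k => by
    rw [← Real.exp_add, Real.one_le_exp_iff]
    have h1 : (2:ℝ) ^ ((p - k - j₀) + k - p) * t ≤ 2 := by
      have : (p - k - j₀) + k - p = 1 - (j₀ + 1) := by ring
      rw [this, zpow_sub₀ (by norm_num), zpow_one, div_mul_eq_mul_div, div_le_iff₀ (by positivity)]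
      have := hj₀.2.le
      nlinarith
    have h2 : ((2:ℝ) ^ ((p - k - j₀) + k - p) * t) ^ 2 ≤ 2 ^ 2 := by gcongr
    rw [mul_pow] at h2
    nlinarith [Real.pi_pos]
  have key : (∑ k ∈ S, ‖R k‖ * ‖z k‖) ^ 2 ≤ T₀ * ∑ k ∈ S,
      (B ^ 2 * D * scaleWeight d (p - k - j₀) * ‖z k‖ ^ 2) := by
    have h1 := Finset.sum_sq_le_sum_mul_sum_of_sq_le_mul S
      (f := fun k => (2 / 3 : ℝ) ^ (p - k - j₀).natAbs)
      (g := fun k => B ^ 2 * D * scaleWeight d (p - k - j₀) * ‖z k‖ ^ 2)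
      (r := fun k => ‖R k‖ * ‖z k‖) (fun k _ => by positivity)
      (fun k _ => by have := scaleWeight_nonneg d (p - k - j₀); positivity) (fun k hk => by
        have h2 := sq_le_weight d hd (p - k - j₀) _ (hlow k)
        calc (‖R k‖ * ‖z k‖) ^ 2 ≤
            ((B * min 1 (((2:ℝ) ^ (k - p) * t / d) ^ (d + 2))⁻¹) * ‖z k‖) ^ 2 := by
              gcongr; exact hR k hk
          _ = B ^ 2 * ‖z k‖ ^ 2 * (min 1 (((2:ℝ) ^ (k - p) * t / d) ^ (d + 2))⁻¹) ^ 2 := by ring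
          _ ≤ B ^ 2 * ‖z k‖ ^ 2 * _ := mul_le_mul_of_nonneg_left h2 (by positivity)
          _ = _ := by ring)
    refine h1.trans ?_
    gcongr
    · exact Finset.sum_nonneg fun k _ => by
        have := scaleWeight_nonneg d (p - k - j₀); positivity
    · have hinj : Set.InjOn (fun k : ℤ => p - k - j₀) S := fun a _ b _ h => by
        simp only at h; omega
      rw [← Finset.sum_image (f := fun i : ℤ => (2 / 3 : ℝ) ^ i.natAbs) hinj]
      exact hsum.sum_le_tsum _ fun i _ => by positivity
  have h3 : ‖∑ k ∈ S, R k * z k‖ ^ 2 ≤ (∑ k ∈ S, ‖R k‖ * ‖z k‖) ^ 2 := by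
    gcongr
    refine (norm_sum_le _ _).trans (le_of_eq ?_)
    simp
  have h4 : ‖∑ k ∈ S, R k * z k‖ ^ 2 ≤ T₀ * (D * Real.exp (4 * Real.pi)) * B ^ 2 *
      ∑ k ∈ S, (scaleWeight d (p - k - j₀) *
        (Real.exp (-(Real.pi * ((2:ℝ) ^ ((p - k - j₀) + k - p)) ^ 2) * t ^ 2) * ‖z k‖ ^ 2)) := by
    refine (h3.trans key).trans ?_
    rw [mul_assoc, mul_assoc]
    gcongr
    rw [Finset.mul_sum, Finset.mul_sum]
    refine Finset.sum_le_sum fun k _ => ?_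
    have h5 : 0 ≤ B ^ 2 * D * scaleWeight d (p - k - j₀) * ‖z k‖ ^ 2 := by
      have := scaleWeight_nonneg d (p - k - j₀); positivity
    calc _ ≤ (B ^ 2 * D * scaleWeight d (p - k - j₀) * ‖z k‖ ^ 2) * _ :=
          le_mul_of_one_le_right h5 (hexp k)
      _ = _ := by ring
  rw [← ofReal_norm, ← ENNReal.ofReal_pow (norm_nonneg _)]
  refine (ENNReal.ofReal_le_ofReal h4).trans ?_
  rw [ENNReal.ofReal_mul (by positivity)]
  gcongr
  rw [ENNReal.ofReal_sum_of_nonneg fun k _ => by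
    have := scaleWeight_nonneg d (p - k - j₀); positivity]
  refine Finset.sum_le_sum fun k _ => ?_
  refine le_trans (le_of_eq ?_) (ENNReal.le_tsum (p - k - j₀))
  rw [ENNReal.ofReal_mul (scaleWeight_nonneg _ _), ENNReal.ofReal_mul (by positivity),
    ← ofReal_norm, ← ENNReal.ofReal_pow (norm_nonneg _)]

end ScaleWeights

theorem continuous_fourier_of_integrable {E : Type*} [NormedAddCommGroup E]
    [InnerProductSpace ℝ E] [FiniteDimensional ℝ E] [MeasurableSpace E] [BorelSpace E]
    {f : E → ℂ} (hf : Integrable f) : Continuous (𝓕 f) :=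
  VectorFourier.fourierIntegral_continuous Real.continuous_fourierChar
    (by exact continuous_inner) hf

section AtomSums

variable {d : ℕ} {φ Om : Rd d → ℝ} {A α : ℝ} {s : ℕ} {F : Finset (ℤ × (Fin d → ℤ))}
  {b : ℤ × (Fin d → ℤ) → Rd d → ℝ}

/-- The sum of the kernels at scale `2^s` times the size of the cube, applied to the atoms. -/
def atomSum (d : ℕ) (φ Om : Rd d → ℝ) (s : ℕ) (F : Finset (ℤ × (Fin d → ℤ)))
    (b : ℤ × (Fin d → ℤ) → Rd d → ℝ) (x : Rd d) : ℝ :=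
  ∑ c ∈ F, kconv (Kker d φ Om (c.1 + s)) (b c) x

theorem integrable_atomSum (hφ : AdmissiblePhi d φ) (hOm : Measurable Om)
    (hA : ∀ x, |Om x| ≤ A) (hb : ∀ c, Integrable (b c)) : Integrable (atomSum d φ Om s F b) :=
  integrable_finsetSum _ fun c _ => integrable_kconv (integrable_Kker hφ hOm hA _) (hb c)

theorem memLp_two_atomSum (hφ : AdmissiblePhi d φ) (hOm : Measurable Om)
    (hA : ∀ x, |Om x| ≤ A) (hb : ∀ c, Integrable (b c)) :
    MemLp (atomSum d φ Om s F b) 2 volume := by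
  obtain ⟨B, -, hB⟩ := AdmissiblePhi.exists_bound hφ
  exact memLp_finsetSum _ fun c _ =>
    memLp_two_kconv (integrable_Kker hφ hOm hA _) (hB Om A hA _) (hb c)

theorem fourier_atomSum (hφ : AdmissiblePhi d φ) (hOm : Measurable Om)
    (hA : ∀ x, |Om x| ≤ A) (hb : ∀ c, Integrable (b c)) (ξ : Rd d) :
    𝓕 (fun x => (atomSum d φ Om s F b x : ℂ)) ξ =
      ∑ c ∈ F, 𝓕 (fun x => (Kker d φ Om (c.1 + s) x : ℂ)) ξ * 𝓕 (fun x => (b c x : ℂ)) ξ := by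
  have h1 : ∀ c, Integrable fun x => (kconv (Kker d φ Om (c.1 + s)) (b c) x : ℂ) := fun c =>
    (integrable_kconv (integrable_Kker hφ hOm hA _) (hb c)).ofReal (𝕜 := ℂ)
  simp_rw [← fourier_kconv (integrable_Kker hφ hOm hA _) (hb _)]
  simp only [Real.fourier_eq, atomSum]
  push_cast
  simp_rw [Finset.smul_sum]
  rw [integral_finsetSum]
  intro c _
  exact (Real.fourierIntegral_convergent_iff ξ).2 (h1 c)

theorem lintegral_enorm_sq_fourier_atomSum (hφ : AdmissiblePhi d φ) (hOm : Measurable Om)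
    (hA : ∀ x, |Om x| ≤ A) (hb : ∀ c, Integrable (b c)) :
    ∫⁻ ξ, ‖𝓕 (fun x => (atomSum d φ Om s F b x : ℂ)) ξ‖ₑ ^ 2 =
      ∫⁻ x, ‖atomSum d φ Om s F b x‖ₑ ^ 2 := by
  have h1 : Integrable fun x => (atomSum d φ Om s F b x : ℂ) :=
    (integrable_atomSum hφ hOm hA hb).ofReal (𝕜 := ℂ)
  have h2 : MemLp (fun x => (atomSum d φ Om s F b x : ℂ)) 2 volume :=
    (memLp_two_atomSum hφ hOm hA hb).ofReal (K := ℂ)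
  rw [lintegral_enorm_sq_fourier h1 h2]
  congr 1; ext x
  congr 1
  rw [← ofReal_norm, ← ofReal_norm, Complex.norm_real]

theorem AtomFamily.lintegral_gaussian_le (hF : AtomFamily d F b α) {p s : ℕ} (hps : p ≤ s)
    (k i : ℤ) :
    ∫⁻ ξ : Rd d, ENNReal.ofReal (Real.exp (-(Real.pi * ((2:ℝ) ^ (i + k - p)) ^ 2) * ‖ξ‖ ^ 2)) *
      ‖𝓕 (fun x => ((∑ c ∈ F with c.1 + (s:ℤ) = k, b c x : ℝ) : ℂ)) ξ‖ₑ ^ 2 ≤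
    ENNReal.ofReal (gaussConst (Rd d) * α * (2:ℝ) ^ ((p:ℤ) - s) *
      ((d * 2 ^ (-i)) * (1 + d * 2 ^ (-i)) ^ (d + 1))) *
      ∑ c ∈ F with c.1 + (s:ℤ) = k, ∫⁻ y, ‖b c y‖ₑ := by
  set Fk := F.filter fun c => c.1 + (s:ℤ) = k with hFk
  have hsub : ∀ c ∈ Fk, c ∈ F := fun c hc => (Finset.mem_filter.1 hc).1
  have hscale : ∀ c ∈ Fk, c.1 = k - s := fun c hc => by
    have := (Finset.mem_filter.1 hc).2; omega
  have hvol : ∀ c : ℤ × (Fin d → ℤ), volume (dcube d 0 c.1 c.2) = ENNReal.ofReal (2 ^ (c.1 * d)) :=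
    fun c => volume_dcube 0 c.1 c.2
  set σ := (2:ℝ) ^ (i + k - p) with hσ
  set D := (d:ℝ) * 2 ^ (k - s) with hD
  set y := (d:ℝ) * 2 ^ (-i) with hy
  have hy0 : 0 ≤ y := by positivity
  have hσ0 : 0 < σ := by positivity
  have hDσ : D / σ = 2 ^ ((p:ℤ) - s) * y := by
    rw [hD, hσ, hy, div_eq_iff hσ0.ne']
    calc (d:ℝ) * 2 ^ (k - s) = d * 2 ^ (((p:ℤ) - s) + -i + (i + k - p)) := by congr 2; ring
      _ = _ := by rw [zpow_add₀ (by norm_num), zpow_add₀ (by norm_num)]; ring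
  have hps' : (2:ℝ) ^ ((p:ℤ) - s) ≤ 1 := zpow_le_one_of_nonpos₀ (by norm_num) (by omega)
  have hInt : Integrable fun x => ∑ c ∈ Fk, b c x :=
    integrable_finsetSum _ fun c _ => hF.integrable c
  have h1 := abs_integral_gaussKer_mul_sum_le (E := Rd d) Fk (fun c => dcube d 0 c.1 c.2) b
    (σ := σ) (D := D) (α := α) hσ0 (by positivity) hF.nonneg
    (fun c _ => measurableSet_dcube _ _ _)
    (hF.disjoint.mono fun c hc => hsub c hc)
    (fun c _ => by rw [hvol]; simp; positivity) (fun c _ => by rw [hvol]; simp)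
    (fun c hc x hx z hz => by
      have := norm_sub_le_of_mem_dcube hx hz
      rwa [hscale c hc] at this)
    (fun c _ => hF.integrable c) (fun c hc => hF.support_subset c (hsub c hc))
    (fun c hc => hF.integral_zero c (hsub c hc))
    (fun c hc => by
      rw [hvol, ENNReal.toReal_ofReal (by positivity)]
      exact hF.bound c (hsub c hc))
  refine (lintegral_gaussian_mul_fourier_sq_le hσ0 hInt h1).trans ?_
  have hG := gaussConst_nonneg (E := Rd d)
  have hα := hF.nonneg
  rw [ENNReal.ofReal_mul (by positivity)]
  refine mul_le_mul' (ENNReal.ofReal_le_ofReal ?_) ?_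
  · rw [finrank_euclideanSpace_fin, hDσ]
    calc gaussConst (Rd d) * (2 ^ ((p:ℤ) - s) * y * (1 + 2 ^ ((p:ℤ) - s) * y) ^ (d + 1)) * α
        ≤ gaussConst (Rd d) * (2 ^ ((p:ℤ) - s) * y * (1 + 1 * y) ^ (d + 1)) * α := by gcongr
      _ = _ := by ring
  · rw [ofReal_integral_eq_lintegral_ofReal hInt.abs (Filter.Eventually.of_forall fun _ => abs_nonneg _),
      ← lintegral_finsetSum' _ fun c _ => (hF.integrable c).1.enorm]
    refine lintegral_mono fun x => ?_
    rw [← Real.enorm_eq_ofReal_abs]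
    exact enorm_sum_le _ _

theorem exists_lintegral_weighted_gaussian_le (d : ℕ) : ∃ C : ℝ, 0 < C ∧
    ∀ (F : Finset (ℤ × (Fin d → ℤ))) (b : ℤ × (Fin d → ℤ) → Rd d → ℝ) (α : ℝ) (p s : ℕ),
      AtomFamily d F b α → p ≤ s →
      ∫⁻ ξ : Rd d, ∑ k ∈ F.image (fun c => c.1 + (s:ℤ)), ∑' i : ℤ,
        ENNReal.ofReal (scaleWeight d i) *
        (ENNReal.ofReal (Real.exp (-(Real.pi * ((2:ℝ) ^ (i + k - p)) ^ 2) * ‖ξ‖ ^ 2)) *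
        ‖𝓕 (fun x => ((∑ c ∈ F with c.1 + (s:ℤ) = k, b c x : ℝ) : ℂ)) ξ‖ₑ ^ 2) ≤
      ENNReal.ofReal (C * (2:ℝ) ^ ((p:ℤ) - s) * α) * ∑ c ∈ F, ∫⁻ y, ‖b c y‖ₑ := by
  have hsum := summable_pow_natAbs (a := 3 / 4) (by norm_num) (by norm_num)
  set T₀ := ∑' i : ℤ, (3 / 4 : ℝ) ^ i.natAbs with hT₀
  have hTpos : 0 < T₀ := hsum.tsum_pos (fun i => by positivity) 0 (by norm_num)
  have hG := gaussConst_nonneg (E := Rd d)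
  refine ⟨(gaussConst (Rd d) + 1) * (d * (1 + d) ^ (d + 1) + 1) * T₀, by positivity,
    fun F b α p s hF hps => ?_⟩
  have hα := hF.nonneg
  have hmeas : ∀ k i : ℤ, Measurable fun ξ : Rd d =>
      (ENNReal.ofReal (Real.exp (-(Real.pi * ((2:ℝ) ^ (i + k - p)) ^ 2) * ‖ξ‖ ^ 2)) *
        ‖𝓕 (fun x => ((∑ c ∈ F with c.1 + (s:ℤ) = k, b c x : ℝ) : ℂ)) ξ‖ₑ ^ 2) := fun k i => by
    have h1 : Integrable fun x => ((∑ c ∈ F with c.1 + (s:ℤ) = k, b c x : ℝ) : ℂ) :=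
      (integrable_finsetSum _ fun c _ => hF.integrable c).ofReal (𝕜 := ℂ)
    have h2 := (continuous_fourier_of_integrable h1).measurable
    exact (by fun_prop : Measurable fun ξ : Rd d => ENNReal.ofReal
      (Real.exp (-(Real.pi * ((2:ℝ) ^ (i + k - p)) ^ 2) * ‖ξ‖ ^ 2))).mul (h2.enorm.pow_const 2)
  rw [lintegral_finsetSum _ fun k _ => Measurable.tsum fun i => (hmeas k i).const_mul _]
  rw [← Finset.sum_fiberwise_of_maps_to (s := F) (t := F.image (fun c => c.1 + (s:ℤ)))
    (g := fun c => c.1 + (s:ℤ)) (fun c hc => Finset.mem_image_of_mem _ hc), Finset.mul_sum]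
  refine Finset.sum_le_sum fun k _ => ?_
  rw [lintegral_tsum fun i => ((hmeas k i).const_mul _).aemeasurable]
  simp_rw [lintegral_const_mul _ (hmeas k _)]
  have hterm : ∀ i : ℤ, ENNReal.ofReal (scaleWeight d i) * ∫⁻ ξ : Rd d,
      (ENNReal.ofReal (Real.exp (-(Real.pi * ((2:ℝ) ^ (i + k - p)) ^ 2) * ‖ξ‖ ^ 2)) *
        ‖𝓕 (fun x => ((∑ c ∈ F with c.1 + (s:ℤ) = k, b c x : ℝ) : ℂ)) ξ‖ₑ ^ 2) ≤
      ENNReal.ofReal ((gaussConst (Rd d) + 1) * (d * (1 + d) ^ (d + 1) + 1) *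
        (2:ℝ) ^ ((p:ℤ) - s) * α * (3 / 4) ^ i.natAbs) *
        ∑ c ∈ F with c.1 + (s:ℤ) = k, ∫⁻ y, ‖b c y‖ₑ := fun i => by
    refine (mul_le_mul_right (hF.lintegral_gaussian_le hps k i) _).trans ?_
    rw [← mul_assoc, ← ENNReal.ofReal_mul (scaleWeight_nonneg _ _)]
    refine mul_le_mul_left (ENNReal.ofReal_le_ofReal ?_) _
    have h3 := scaleWeight_mul_profile_le d i
    calc _ = (gaussConst (Rd d) * α * 2 ^ ((p:ℤ) - s)) * (scaleWeight d i *
          ((d * 2 ^ (-i)) * (1 + d * 2 ^ (-i)) ^ (d + 1))) := by ring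
      _ ≤ (gaussConst (Rd d) * α * 2 ^ ((p:ℤ) - s)) *
          (d * (1 + d) ^ (d + 1) * (3 / 4) ^ i.natAbs) := by gcongr
      _ ≤ ((gaussConst (Rd d) + 1) * α * 2 ^ ((p:ℤ) - s)) *
          ((d * (1 + d) ^ (d + 1) + 1) * (3 / 4) ^ i.natAbs) := by gcongr <;> linarith
      _ = _ := by ring
  refine (ENNReal.tsum_le_tsum hterm).trans ?_
  rw [ENNReal.tsum_mul_right]
  refine mul_le_mul_left (le_of_eq ?_) _
  rw [← ENNReal.ofReal_tsum_of_nonneg (fun i => by positivity) (hsum.mul_left _), tsum_mul_left]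
  congr 1; ring

end AtomSums

section Sectors

variable {d : ℕ} {φ Om : Rd d → ℝ} {A α : ℝ} {s p : ℕ} {i : Fin d} {F : Finset (ℤ × (Fin d → ℤ))}
  {b : ℤ × (Fin d → ℤ) → Rd d → ℝ}

/-- The index of the angular cell containing the direction of `x`, in the sector where the
`i`-th coordinate dominates. -/
def sectorCell (p : ℕ) (i : Fin d) (x : Rd d) : Fin d → ℤ := fun j => ⌊x j / x i * 2 ^ p⌋

/-- The restriction of `Om` to a finite set of angular cells. -/
def cellRestrict (p : ℕ) (i : Fin d) (U : Finset (Fin d → ℤ)) (Om : Rd d → ℝ) (x : Rd d) : ℝ :=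
  if sectorCell p i x ∈ U then Om x else 0

theorem measurable_sectorCell (p : ℕ) (i : Fin d) : Measurable (sectorCell p i) := by
  refine measurable_pi_lambda _ fun j => Int.measurable_floor.comp ?_
  have h : ∀ j : Fin d, Measurable fun x : Rd d => x j := fun j => by fun_prop
  exact ((h j).div (h i)).mul_const _

theorem sectorCell_smul (p : ℕ) (i : Fin d) {r : ℝ} (hr : 0 < r) (x : Rd d) :
    sectorCell p i (r • x) = sectorCell p i x := by
  ext j
  simp only [sectorCell, PiLp.smul_apply, smul_eq_mul]
  rw [mul_div_mul_left _ _ hr.ne']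

theorem measurable_cellRestrict (hOm : Measurable Om) (U : Finset (Fin d → ℤ)) :
    Measurable (cellRestrict p i U Om) :=
  Measurable.ite (measurable_sectorCell p i U.measurableSet) hOm measurable_const

theorem homogeneous_cellRestrict (hh : Homogeneous0 d Om) (U : Finset (Fin d → ℤ)) :
    Homogeneous0 d (cellRestrict p i U Om) := by
  intro x hx r hr
  rw [cellRestrict, cellRestrict, sectorCell_smul p i hr, hh x hx r hr]

theorem abs_cellRestrict_le (hA : ∀ x, |Om x| ≤ A) (U : Finset (Fin d → ℤ)) (x : Rd d) :
    |cellRestrict p i U Om x| ≤ A := by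
  rw [cellRestrict]
  split_ifs
  · exact hA x
  · simpa using (abs_nonneg _).trans (hA x)

theorem cellRestrict_ne_zero {U : Finset (Fin d → ℤ)} {x : Rd d}
    (h : cellRestrict p i U Om x ≠ 0) : sectorCell p i x ∈ U ∧ Om x ≠ 0 := by
  rw [cellRestrict] at h
  split_ifs at h with h1
  · exact ⟨h1, h⟩
  · exact absurd rfl h

theorem Kker_cellRestrict (U : Finset (Fin d → ℤ)) (k : ℤ) (x : Rd d) :
    Kker d φ (cellRestrict p i U Om) k x = ∑ q ∈ U, Kker d φ (cellRestrict p i {q} Om) k x := by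
  have h : cellRestrict p i U Om x = ∑ q ∈ U, cellRestrict p i {q} Om x := by
    simp only [cellRestrict, Finset.mem_singleton]
    rw [Finset.sum_ite_eq]
  simp only [Kker]
  rw [h, Finset.mul_sum, Finset.sum_mul]

/-- `Om` lives in the sector where the `i`-th coordinate dominates. -/
def InSector (i : Fin d) (Om : Rd d → ℝ) : Prop :=
  ∀ x, Om x ≠ 0 → x i ≠ 0 ∧ ∀ j, |x j| ≤ |x i|

theorem InSector.sectorCell_mem (h : InSector i Om) {x : Rd d} (hx : Om x ≠ 0) :
    sectorCell p i x ∈ cellIndices p i := by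
  obtain ⟨h1, h2⟩ := h x hx
  rw [mem_cellIndices]
  have hp : (0:ℝ) < 2 ^ p := by positivity
  refine ⟨?_, fun j _ => ?_⟩
  · simp only [sectorCell, div_self h1, one_mul]
    exact_mod_cast Int.floor_intCast (R := ℝ) (2 ^ p)
  · have h3 : |x j / x i| ≤ 1 := by
      rw [abs_div, div_le_one (abs_pos.2 h1)]; exact h2 j
    have h4 := abs_le.1 h3
    rw [abs_le]
    simp only [sectorCell]
    constructor
    · rw [Int.le_floor]; push_cast; nlinarith
    · have h5 : ((⌊x j / x i * 2 ^ p⌋ : ℤ) : ℝ) ≤ 2 ^ p := (Int.floor_le _).trans (by nlinarith)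
      rw [← Int.cast_le (R := ℝ)]; push_cast; exact h5

theorem InSector.cellRestrict_eq (h : InSector i Om) :
    cellRestrict p i (cellIndices p i) Om = Om := by
  ext x
  rw [cellRestrict]
  by_cases hx : Om x = 0
  · simp [hx]
  · rw [if_pos (h.sectorCell_mem hx)]

theorem abs_sub_le_of_sectorCell {x : Rd d} (hx : x i ≠ 0) (j : Fin d) :
    |x j - x i * (sectorCell p i x j * (2 ^ p)⁻¹)| ≤ (2 ^ p)⁻¹ * |x i| := by
  have hp : (0:ℝ) < 2 ^ p := by positivity
  have h1 := Int.floor_le (x j / x i * 2 ^ p)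
  have h2 := (Int.lt_floor_add_one (x j / x i * 2 ^ p)).le
  have h3 : |x j / x i * 2 ^ p - (⌊x j / x i * 2 ^ p⌋ : ℝ)| ≤ 1 := by
    rw [abs_le]; constructor <;> linarith
  have h4 : x j - x i * (sectorCell p i x j * (2 ^ p)⁻¹) =
      (x j / x i * 2 ^ p - (⌊x j / x i * 2 ^ p⌋ : ℝ)) * ((2 ^ p)⁻¹ * x i) := by
    simp only [sectorCell]
    field_simp
  rw [h4, abs_mul, abs_mul, abs_of_pos (inv_pos.2 hp)]
  exact mul_le_of_le_one_left (by positivity) h3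

/-- Directions in cells that are not nearly orthogonal to `ξ` have a large inner product
with `ξ`. -/
theorem InSector.le_abs_inner (h : InSector i Om) {ξ x : Rd d}
    (hx : cellRestrict p i (cellIndices p i \ badCells p i ξ) Om x ≠ 0) :
    2 ^ (-(p:ℤ)) * ‖ξ‖ / d * ‖x‖ ≤ |inner ℝ x ξ| := by
  obtain ⟨h1, h2⟩ := cellRestrict_ne_zero hx
  obtain ⟨h3, h4⟩ := h x h2
  obtain ⟨h5, h6⟩ := Finset.mem_sdiff.1 h1
  have h7 : 2 * ∑ j, |ξ j| < |∑ j, (sectorCell p i x j : ℝ) * ξ j| := by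
    by_contra! hcon
    exact h6 (Finset.mem_filter.2 ⟨h5, hcon⟩)
  have hp : (0:ℝ) < 2 ^ p := by positivity
  have hd : (0:ℝ) < d := by
    have : 0 < d := i.pos
    exact_mod_cast this
  have hin : (inner ℝ x ξ : ℝ) = ∑ j, x j * ξ j := by
    rw [PiLp.inner_apply]
    refine Finset.sum_congr rfl fun j _ => ?_
    simp [mul_comm]
  have hdiff : |(∑ j, x j * ξ j) - x i * (2 ^ p)⁻¹ * ∑ j, (sectorCell p i x j : ℝ) * ξ j| ≤
      (2 ^ p)⁻¹ * |x i| * ∑ j, |ξ j| := by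
    rw [Finset.mul_sum, ← Finset.sum_sub_distrib, Finset.mul_sum]
    refine (Finset.abs_sum_le_sum_abs _ _).trans (Finset.sum_le_sum fun j _ => ?_)
    have : x j * ξ j - x i * (2 ^ p)⁻¹ * ((sectorCell p i x j : ℝ) * ξ j) =
      (x j - x i * (sectorCell p i x j * (2 ^ p)⁻¹)) * ξ j := by ring
    rw [this, abs_mul]
    gcongr
    exact abs_sub_le_of_sectorCell h3 j
  have hmain : (2 ^ p)⁻¹ * |x i| * (2 * ∑ j, |ξ j|) ≤
      |x i * (2 ^ p)⁻¹ * ∑ j, (sectorCell p i x j : ℝ) * ξ j| := by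
    rw [abs_mul, abs_mul, abs_of_pos (inv_pos.2 hp), mul_comm |x i|]
    gcongr
  have htri := abs_sub_abs_le_abs_sub (x i * (2 ^ p)⁻¹ * ∑ j, (sectorCell p i x j : ℝ) * ξ j)
    (∑ j, x j * ξ j)
  rw [abs_sub_comm] at htri
  have hres : (2 ^ p)⁻¹ * |x i| * ∑ j, |ξ j| ≤ |∑ j, x j * ξ j| := by nlinarith
  rw [hin]
  refine le_trans ?_ hres
  have hxn : ‖x‖ ≤ d * |x i| := by
    refine (norm_le_sum_abs x).trans ((Finset.sum_le_sum fun j _ => h4 j).trans ?_)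
    simp
  have hξn := norm_le_sum_abs ξ
  rw [zpow_neg, zpow_natCast]
  calc (2 ^ p)⁻¹ * ‖ξ‖ / d * ‖x‖ ≤ (2 ^ p)⁻¹ * (∑ j, |ξ j|) / d * (d * |x i|) := by gcongr
    _ = _ := by field_simp

end Sectors

theorem enorm_sum_sq_le {ι E : Type*} [SeminormedAddCommGroup E] (G : Finset ι) (z : ι → E) :
    ‖∑ q ∈ G, z q‖ₑ ^ 2 ≤ G.card * ∑ q ∈ G, ‖z q‖ₑ ^ 2 := by
  have h1 : ‖∑ q ∈ G, z q‖ ^ 2 ≤ G.card * ∑ q ∈ G, ‖z q‖ ^ 2 :=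
    (pow_le_pow_left₀ (norm_nonneg _) (norm_sum_le _ _) 2).trans sq_sum_le_card_mul_sum_sq
  have h2 := ENNReal.ofReal_le_ofReal h1
  rw [ENNReal.ofReal_mul (by positivity), ENNReal.ofReal_natCast,
    ENNReal.ofReal_sum_of_nonneg fun _ _ => by positivity,
    ENNReal.ofReal_pow (norm_nonneg _), ofReal_norm] at h2
  simpa only [ENNReal.ofReal_pow (norm_nonneg _), ofReal_norm] using h2

theorem enorm_add_sq_le {E : Type*} [SeminormedAddCommGroup E] (a b : E) :
    ‖a + b‖ₑ ^ 2 ≤ 2 * ‖a‖ₑ ^ 2 + 2 * ‖b‖ₑ ^ 2 := by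
  have h := enorm_sum_sq_le Finset.univ (fun j : Fin 2 => if j = 0 then a else b)
  simpa [mul_add] using h

section SectorBound

variable {d : ℕ} {φ Om : Rd d → ℝ} {A α : ℝ} {s p : ℕ} {i : Fin d} {F : Finset (ℤ × (Fin d → ℤ))}
  {b : ℤ × (Fin d → ℤ) → Rd d → ℝ}

theorem fourier_finset_sum {E ι : Type*} [NormedAddCommGroup E]
    [InnerProductSpace ℝ E] [FiniteDimensional ℝ E] [MeasurableSpace E] [BorelSpace E]
    (G : Finset ι) {f : ι → E → ℝ} (hf : ∀ q ∈ G, Integrable (f q)) (ξ : E) :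
    𝓕 (fun x => ((∑ q ∈ G, f q x : ℝ) : ℂ)) ξ = ∑ q ∈ G, 𝓕 (fun x => (f q x : ℂ)) ξ := by
  simp only [Real.fourier_eq]
  push_cast
  simp_rw [Finset.smul_sum]
  rw [integral_finsetSum]
  intro q hq
  have h1 : Integrable fun x => (f q x : ℂ) := (hf q hq).ofReal (𝕜 := ℂ)
  exact (Real.fourierIntegral_convergent_iff ξ).2 h1

theorem fourier_Kker_cellRestrict (hφ : AdmissiblePhi d φ) (hOm : Measurable Om)
    (hA : ∀ x, |Om x| ≤ A) (U : Finset (Fin d → ℤ)) (k : ℤ) (ξ : Rd d) :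
    𝓕 (fun x => (Kker d φ (cellRestrict p i U Om) k x : ℂ)) ξ =
      ∑ q ∈ U, 𝓕 (fun x => (Kker d φ (cellRestrict p i {q} Om) k x : ℂ)) ξ := by
  have h1 : (fun x => (Kker d φ (cellRestrict p i U Om) k x : ℂ)) =
      fun x => ((∑ q ∈ U, Kker d φ (cellRestrict p i {q} Om) k x : ℝ) : ℂ) := by
    ext x; rw [Kker_cellRestrict]
  rw [h1]
  exact fourier_finset_sum U (fun q _ => integrable_Kker hφ (measurable_cellRestrict hOm _)
    (abs_cellRestrict_le hA _) k) ξ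

theorem InSector.fourier_atomSum_eq (h : InSector i Om) (hφ : AdmissiblePhi d φ)
    (hOm : Measurable Om) (hA : ∀ x, |Om x| ≤ A) (hb : ∀ c, Integrable (b c)) (ξ : Rd d) :
    𝓕 (fun x => (atomSum d φ Om s F b x : ℂ)) ξ =
      ∑ q ∈ badCells p i ξ, 𝓕 (fun x => (atomSum d φ (cellRestrict p i {q} Om) s F b x : ℂ)) ξ +
      ∑ k ∈ F.image (fun c => c.1 + (s:ℤ)),
        𝓕 (fun x => (Kker d φ
          (cellRestrict p i (cellIndices p i \ badCells p i ξ) Om) k x : ℂ)) ξ *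
        𝓕 (fun x => ((∑ c ∈ F with c.1 + (s:ℤ) = k, b c x : ℝ) : ℂ)) ξ := by
  have h1 : ∀ k, 𝓕 (fun x => (Kker d φ Om k x : ℂ)) ξ =
      ∑ q ∈ badCells p i ξ, 𝓕 (fun x => (Kker d φ (cellRestrict p i {q} Om) k x : ℂ)) ξ +
      𝓕 (fun x => (Kker d φ
          (cellRestrict p i (cellIndices p i \ badCells p i ξ) Om) k x : ℂ)) ξ := fun k => by
    conv_lhs => rw [← h.cellRestrict_eq (p := p)]
    rw [fourier_Kker_cellRestrict hφ hOm hA, fourier_Kker_cellRestrict hφ hOm hA, add_comm,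
      Finset.sum_sdiff (show badCells p i ξ ⊆ cellIndices p i from Finset.filter_subset _ _)]
  rw [fourier_atomSum hφ hOm hA hb]
  simp_rw [fourier_atomSum hφ (measurable_cellRestrict hOm _) (abs_cellRestrict_le hA _) hb]
  rw [Finset.sum_comm]
  simp_rw [h1, add_mul, Finset.sum_add_distrib, Finset.sum_mul]
  congr 1
  rw [← Finset.sum_fiberwise_of_maps_to (s := F) (t := F.image (fun c => c.1 + (s:ℤ)))
    (g := fun c => c.1 + (s:ℤ)) (fun c hc => Finset.mem_image_of_mem _ hc)]
  refine Finset.sum_congr rfl fun k _ => ?_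
  rw [fourier_finset_sum _ fun c _ => hb c, Finset.mul_sum]
  refine Finset.sum_congr rfl fun c hc => ?_
  rw [(Finset.mem_filter.1 hc).2]

theorem exists_lintegral_cell_le (hφ : AdmissiblePhi d φ) (hd : 1 ≤ d) : ∃ C : ℝ, 0 < C ∧
    ∀ (Om : Rd d → ℝ) (A : ℝ) (i : Fin d) (p s : ℕ) (F : Finset (ℤ × (Fin d → ℤ)))
      (b : ℤ × (Fin d → ℤ) → Rd d → ℝ) (α : ℝ), Measurable Om → (∀ x, |Om x| ≤ A) →
      InSector i Om → p ≤ s → AtomFamily d F b α → ∀ q ∈ cellIndices p i,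
      ∫⁻ x, ‖atomSum d φ (cellRestrict p i {q} Om) s F b x‖ₑ ^ 2 ≤
        ENNReal.ofReal (C * A ^ 2 * ((((2:ℝ) ^ p)⁻¹) ^ (d - 1)) ^ 2 * α) *
          ∑ c ∈ F, ∫⁻ y, ‖b c y‖ₑ := by
  obtain ⟨C, hC, h⟩ := AdmissiblePhi.exists_cell_bound hφ hd
  refine ⟨C, hC, fun Om A i p s F b α hOm hA hsec hps hF q hq => ?_⟩
  have hp : (0:ℝ) < 2 ^ p := by positivity
  refine le_trans (lintegral_mono fun x => ?_) (h (cellRestrict p i {q} Om) A i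
    (fun j => q j * (2 ^ p)⁻¹) ((2 ^ p)⁻¹) s F b α (measurable_cellRestrict hOm _)
    (abs_cellRestrict_le hA _) ?_ ?_ ?_ ?_ hF)
  · gcongr
    refine (enorm_sum_le _ _).trans (Finset.sum_le_sum fun c _ => enorm_kconv_le _ _ _)
  · intro j
    rw [abs_mul, abs_of_pos (inv_pos.2 hp), ← div_eq_mul_inv, div_le_one hp]
    have : ((|q j| : ℤ) : ℝ) ≤ ((2 ^ p : ℤ) : ℝ) :=
      Int.cast_le.2 (abs_le_of_mem_cellIndices hq j)
    simpa using this
  · exact inv_le_one_of_one_le₀ (one_le_pow₀ (by norm_num))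
  · rw [zpow_neg, zpow_natCast]
    gcongr
    norm_num
  · intro x hx j _
    obtain ⟨h1, h2⟩ := cellRestrict_ne_zero hx
    rw [Finset.mem_singleton] at h1
    have := abs_sub_le_of_sectorCell (p := p) (hsec x h2).1 j
    rwa [h1] at this

theorem exists_fourier_Kker_min_bound (hφ : AdmissiblePhi d φ) (hd : 1 ≤ d) : ∃ B : ℝ, 0 < B ∧
    ∀ (Om : Rd d → ℝ) (A τ : ℝ) (ξ : Rd d), Measurable Om → Homogeneous0 d Om →
      (∀ x, |Om x| ≤ A) → 0 < τ → (∀ x, x ≠ 0 → Om x ≠ 0 → τ * ‖x‖ ≤ |inner ℝ x ξ|) →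
      ∀ k : ℤ, ‖𝓕 (fun x => (Kker d φ Om k x : ℂ)) ξ‖ ≤
        B * A * min 1 (((2:ℝ) ^ k * τ) ^ (d + 2))⁻¹ := by
  obtain ⟨B₁, hB₁, h₁⟩ := AdmissiblePhi.exists_fourier_bound hφ
  obtain ⟨B₂, hB₂, h₂⟩ := AdmissiblePhi.exists_fourier_decay hφ hd (d + 2)
  refine ⟨max B₁ B₂, lt_max_of_lt_left hB₁, fun Om A τ ξ hOm hh hA hτ hx k => ?_⟩
  have hA0 : 0 ≤ A := (abs_nonneg _).trans (hA 0)
  rw [mul_min_of_nonneg _ _ (by positivity), le_min_iff]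
  constructor
  · refine (h₁ Om A ξ hOm hh hA k).trans ?_
    rw [mul_one]; gcongr; exact le_max_left _ _
  · refine (h₂ Om A τ ξ hOm hh hA hτ hx k).trans ?_
    gcongr; exact le_max_right _ _

theorem exists_sector_bound (hφ : AdmissiblePhi d φ) (hd : 1 ≤ d) : ∃ C : ℝ, 0 < C ∧
    ∀ (Om : Rd d → ℝ) (A : ℝ) (i : Fin d) (p s : ℕ) (F : Finset (ℤ × (Fin d → ℤ)))
      (b : ℤ × (Fin d → ℤ) → Rd d → ℝ) (α : ℝ), Measurable Om → Homogeneous0 d Om →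
      (∀ x, |Om x| ≤ A) → InSector i Om → 3 ≤ p → p ≤ s → AtomFamily d F b α →
      ∫⁻ x, ‖atomSum d φ Om s F b x‖ₑ ^ 2 ≤
        ENNReal.ofReal (C * A ^ 2 * ((2:ℝ) ^ (-(p:ℤ)) + (2:ℝ) ^ ((p:ℤ) - s)) * α) *
          ∑ c ∈ F, ∫⁻ y, ‖b c y‖ₑ := by
  obtain ⟨C₁, hC₁, h₁⟩ := exists_lintegral_cell_le hφ hd
  obtain ⟨B, hB, hR⟩ := exists_fourier_Kker_min_bound hφ hd
  obtain ⟨C₂, hC₂, h₂⟩ := enorm_sum_mul_sq_le hd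
  obtain ⟨C₃, hC₃, h₃⟩ := exists_lintegral_weighted_gaussian_le d
  refine ⟨2 * ((16 * d + 1) * 9 ^ d * C₁) + 2 * (C₂ * B ^ 2 * C₃), by positivity,
    fun Om A i p s F b α hOm hh hA hsec hp hps hF => ?_⟩
  have hA0 : 0 ≤ A := (abs_nonneg _).trans (hA 0)
  have hα := hF.nonneg
  have hd' : (0:ℝ) < d := by exact_mod_cast hd
  have hp0 : (0:ℝ) < 2 ^ p := by positivity
  set M := ∑ c ∈ F, ∫⁻ y, ‖b c y‖ₑ with hM
  set N₁ : ℝ := (16 * d + 1) * (3 * 2 ^ p) ^ d / (2 ^ p * 2 ^ p) with hN₁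
  set S : (Fin d → ℤ) → Rd d → ℝ := fun q => atomSum d φ (cellRestrict p i {q} Om) s F b with hS
  have hSm : ∀ q, Measurable fun ξ => ‖𝓕 (fun x => (S q x : ℂ)) ξ‖ₑ ^ 2 := fun q => by
    have h1 : Integrable fun x => (S q x : ℂ) := (integrable_atomSum hφ
      (measurable_cellRestrict hOm _) (abs_cellRestrict_le hA _) hF.integrable).ofReal (𝕜 := ℂ)
    exact (continuous_fourier_of_integrable h1).measurable.enorm.pow_const 2
  set W : Rd d → ℝ≥0∞ := fun ξ => ∑ k ∈ F.image (fun c => c.1 + (s:ℤ)), ∑' i : ℤ,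
        ENNReal.ofReal (scaleWeight d i) *
        (ENNReal.ofReal (Real.exp (-(Real.pi * ((2:ℝ) ^ (i + k - p)) ^ 2) * ‖ξ‖ ^ 2)) *
        ‖𝓕 (fun x => ((∑ c ∈ F with c.1 + (s:ℤ) = k, b c x : ℝ) : ℂ)) ξ‖ₑ ^ 2) with hW
  have hpt : ∀ ξ : Rd d, ξ ≠ 0 → ‖𝓕 (fun x => (atomSum d φ Om s F b x : ℂ)) ξ‖ₑ ^ 2 ≤
      2 * (ENNReal.ofReal N₁ * ∑ q ∈ cellIndices p i, ‖𝓕 (fun x => (S q x : ℂ)) ξ‖ₑ ^ 2) +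
      2 * (ENNReal.ofReal (C₂ * (B * A) ^ 2) * W ξ) := fun ξ hξ => by
    rw [hsec.fourier_atomSum_eq (p := p) hφ hOm hA hF.integrable]
    refine (enorm_add_sq_le _ _).trans (add_le_add ?_ ?_)
    · refine mul_le_mul_right ((enorm_sum_sq_le _ _).trans (mul_le_mul' ?_ ?_)) _
      · rw [← ENNReal.ofReal_natCast]
        refine ENNReal.ofReal_le_ofReal ?_
        rw [hN₁, le_div_iff₀ (by positivity), mul_comm]
        have := card_badCells_mul_le hp i hξ
        have h4 : ((2 ^ p * 2 ^ p * (badCells p i ξ).card : ℕ) : ℝ) ≤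
          (((8 * 2 * d + 1) * (3 * 2 ^ p) ^ d : ℕ) : ℝ) := by exact_mod_cast this
        push_cast at h4
        linarith
      · exact Finset.sum_le_sum_of_subset (Finset.filter_subset _ _)
    · refine mul_le_mul_right (h₂ p ‖ξ‖ (B * A) (norm_pos_iff.2 hξ) (by positivity) _ _ _
        fun k _ => ?_) _
      have h5 := hR (cellRestrict p i (cellIndices p i \ badCells p i ξ) Om) A
        (2 ^ (-(p:ℤ)) * ‖ξ‖ / d) ξ (measurable_cellRestrict hOm _) (homogeneous_cellRestrict hh _)
        (abs_cellRestrict_le hA _) (by have := norm_pos_iff.2 hξ; positivity)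
        (fun x _ hx => hsec.le_abs_inner hx) k
      have h6 : (2:ℝ) ^ (k - p) * ‖ξ‖ / d = 2 ^ k * (2 ^ (-(p:ℤ)) * ‖ξ‖ / d) := by
        rw [sub_eq_add_neg, zpow_add₀ (by norm_num)]; ring
      rwa [h6]
  have hS2 : ∫⁻ ξ, ∑ q ∈ cellIndices p i, ‖𝓕 (fun x => (S q x : ℂ)) ξ‖ₑ ^ 2 ≤
      ENNReal.ofReal ((3 * 2 ^ p) ^ d / 2 ^ p *
        (C₁ * A ^ 2 * ((((2:ℝ) ^ p)⁻¹) ^ (d - 1)) ^ 2 * α)) * M := by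
    rw [lintegral_finsetSum _ fun q _ => hSm q]
    calc _ ≤ ∑ q ∈ cellIndices p i,
          ENNReal.ofReal (C₁ * A ^ 2 * ((((2:ℝ) ^ p)⁻¹) ^ (d - 1)) ^ 2 * α) * M := by
          refine Finset.sum_le_sum fun q hq => ?_
          rw [hS, lintegral_enorm_sq_fourier_atomSum hφ (measurable_cellRestrict hOm _)
            (abs_cellRestrict_le hA _) hF.integrable]
          exact h₁ Om A i p s F b α hOm hA hsec hps hF q hq
      _ ≤ _ := by
          rw [Finset.sum_const, nsmul_eq_mul, ← mul_assoc,
            ENNReal.ofReal_mul (p := (3 * (2:ℝ) ^ p) ^ d / 2 ^ p) (by positivity)]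
          gcongr
          rw [← ENNReal.ofReal_natCast]
          refine ENNReal.ofReal_le_ofReal ?_
          rw [le_div_iff₀ (by positivity), mul_comm]
          exact_mod_cast card_cellIndices_mul_le p i
  rw [← lintegral_enorm_sq_fourier_atomSum hφ hOm hA hF.integrable]
  have hae : ∀ᵐ ξ : Rd d, ξ ≠ 0 := by
    have : Nontrivial (Rd d) := by
      have : Nonempty (Fin d) := ⟨i⟩
      infer_instance
    exact Measure.ae_ne volume 0
  have hSm' : Measurable fun ξ => ∑ q ∈ cellIndices p i, ‖𝓕 (fun x => (S q x : ℂ)) ξ‖ₑ ^ 2 :=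
    Finset.measurable_fun_sum _ fun q _ => hSm q
  calc _ ≤ ∫⁻ ξ, (2 * (ENNReal.ofReal N₁ * ∑ q ∈ cellIndices p i,
          ‖𝓕 (fun x => (S q x : ℂ)) ξ‖ₑ ^ 2) +
        2 * (ENNReal.ofReal (C₂ * (B * A) ^ 2) * W ξ)) :=
        lintegral_mono_ae (hae.mono fun ξ hξ => hpt ξ hξ)
    _ = 2 * (ENNReal.ofReal N₁ * ∫⁻ ξ, ∑ q ∈ cellIndices p i, ‖𝓕 (fun x => (S q x : ℂ)) ξ‖ₑ ^ 2) +
        2 * (ENNReal.ofReal (C₂ * (B * A) ^ 2) * ∫⁻ ξ, W ξ) := by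
        rw [lintegral_add_left ((hSm'.const_mul _).const_mul _),
          lintegral_const_mul _ (hSm'.const_mul _), lintegral_const_mul _ hSm',
          lintegral_const_mul' _ _ (by simp), lintegral_const_mul' _ _ ENNReal.ofReal_ne_top]
    _ ≤ 2 * (ENNReal.ofReal N₁ * (ENNReal.ofReal ((3 * 2 ^ p) ^ d / 2 ^ p *
        (C₁ * A ^ 2 * ((((2:ℝ) ^ p)⁻¹) ^ (d - 1)) ^ 2 * α)) * M)) +
        2 * (ENNReal.ofReal (C₂ * (B * A) ^ 2) *
          (ENNReal.ofReal (C₃ * (2:ℝ) ^ ((p:ℤ) - s) * α) * M)) := by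
        gcongr
        exact h₃ F b α p s hF hps
    _ = ENNReal.ofReal (2 * (N₁ * ((3 * 2 ^ p) ^ d / 2 ^ p *
        (C₁ * A ^ 2 * ((((2:ℝ) ^ p)⁻¹) ^ (d - 1)) ^ 2 * α))) +
        2 * (C₂ * (B * A) ^ 2 * (C₃ * (2:ℝ) ^ ((p:ℤ) - s) * α))) * M := by
        have hN0 : 0 ≤ N₁ := by rw [hN₁]; positivity
        rw [ENNReal.ofReal_add (by positivity) (by positivity),
          ENNReal.ofReal_mul (p := 2) (by norm_num), ENNReal.ofReal_mul (p := N₁) hN0,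
          ENNReal.ofReal_mul (p := 2) (by norm_num),
          ENNReal.ofReal_mul (p := C₂ * (B * A) ^ 2) (by positivity), ENNReal.ofReal_ofNat]
        ring
    _ ≤ _ := by
        gcongr
        have h7 : N₁ * ((3 * 2 ^ p) ^ d / 2 ^ p *
            (C₁ * A ^ 2 * ((((2:ℝ) ^ p)⁻¹) ^ (d - 1)) ^ 2 * α)) =
            (16 * d + 1) * 9 ^ d * C₁ * A ^ 2 * 2 ^ (-(p:ℤ)) * α := by
          obtain ⟨e, rfl⟩ : ∃ e, d = e + 1 := ⟨d - 1, by omega⟩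
          rw [hN₁, zpow_neg, zpow_natCast, Nat.add_sub_cancel,
            show (9:ℝ) = 3 * 3 by norm_num]
          generalize (2:ℝ) ^ p = z at hp0
          rw [mul_pow, mul_pow, inv_pow]
          field_simp
          ring
        rw [h7]
        have h8 : 0 ≤ (16 * d + 1) * 9 ^ d * C₁ * A ^ 2 * (2:ℝ) ^ ((p:ℤ) - s) * α := by positivity
        have h9 : 0 ≤ C₂ * B ^ 2 * C₃ * A ^ 2 * (2:ℝ) ^ (-(p:ℤ)) * α := by positivity
        nlinarith

end SectorBound

section SectorSplit

variable {d : ℕ} {φ Om : Rd d → ℝ} {A α : ℝ} {s : ℕ} {i : Fin d} {F : Finset (ℤ × (Fin d → ℤ))}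
  {b : ℤ × (Fin d → ℤ) → Rd d → ℝ}

/-- The cone on which `i` is the first coordinate of maximal modulus. -/
def firstMaxCone (i : Fin d) : Set (Rd d) :=
  {x | x i ≠ 0 ∧ (∀ j, |x j| ≤ |x i|) ∧ ∀ j, j < i → |x j| < |x i|}

theorem measurableSet_firstMaxCone (i : Fin d) : MeasurableSet (firstMaxCone i) := by
  have hm : ∀ j : Fin d, Measurable fun x : Rd d => |x j| := fun j => by fun_prop
  have h1 : MeasurableSet {x : Rd d | x i ≠ 0} :=
    (measurableSet_singleton (0:ℝ)).compl.preimage (f := fun x : Rd d => x i) (by fun_prop)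
  have h2 : MeasurableSet (⋂ j, {x : Rd d | |x j| ≤ |x i|}) :=
    MeasurableSet.iInter fun j => measurableSet_le (hm j) (hm i)
  have h3 : MeasurableSet (⋂ j, ⋂ (_ : j < i), {x : Rd d | |x j| < |x i|}) :=
    MeasurableSet.iInter fun j => MeasurableSet.iInter fun _ => measurableSet_lt (hm j) (hm i)
  convert h1.inter (h2.inter h3) using 1
  ext x
  simp [firstMaxCone]

theorem smul_mem_firstMaxCone {r : ℝ} (hr : 0 < r) {x : Rd d} :
    r • x ∈ firstMaxCone i ↔ x ∈ firstMaxCone i := by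
  simp [firstMaxCone, abs_mul, abs_of_pos hr, hr, hr.ne']

theorem existsUnique_mem_firstMaxCone {x : Rd d} (hx : x ≠ 0) : ∃! i, x ∈ firstMaxCone i := by
  classical
  obtain ⟨i₀, hi₀⟩ : ∃ i, x i ≠ 0 := by
    by_contra! h
    exact hx (by ext i; simpa using h i)
  obtain ⟨i₁, -, hi₁⟩ := Finset.exists_max_image Finset.univ (fun j => |x j|) ⟨i₀, Finset.mem_univ _⟩
  set S := Finset.univ.filter fun i => ∀ j, |x j| ≤ |x i| with hS
  have hne : S.Nonempty := ⟨i₁, by simpa [hS] using hi₁⟩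
  have hmem := S.min'_mem hne
  have hmax : ∀ j, |x j| ≤ |x (S.min' hne)| := (Finset.mem_filter.1 hmem).2
  refine ⟨S.min' hne, ⟨?_, hmax, fun j hj => ?_⟩, ?_⟩
  · intro h0
    have := hmax i₀
    rw [h0, abs_zero] at this
    exact hi₀ (abs_nonpos_iff.1 this)
  · refine lt_of_le_of_ne (hmax j) fun heq => ?_
    refine absurd (S.min'_le j ?_) (not_le.2 hj)
    simpa [hS, heq] using hmax
  · rintro i ⟨_, h2, h3⟩
    rcases lt_trichotomy i (S.min' hne) with h | h | h
    · exact absurd (S.min'_le i (by simpa [hS] using h2)) (not_le.2 h)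
    · exact h
    · exact absurd (hmax i) (not_le.2 (h3 _ h))

theorem sum_indicator_firstMaxCone (Om : Rd d → ℝ) {x : Rd d} (hx : x ≠ 0) :
    ∑ i, (firstMaxCone i).indicator Om x = Om x := by
  obtain ⟨i, hi, hu⟩ := existsUnique_mem_firstMaxCone hx
  rw [Finset.sum_eq_single i, indicator_of_mem hi]
  · exact fun j _ hj => indicator_of_notMem (fun h => hj (hu j h)) _
  · simp

theorem Kker_eq_sum_firstMaxCone (hφ : AdmissiblePhi d φ) (k : ℤ) (x : Rd d) :
    Kker d φ Om k x = ∑ i, Kker d φ ((firstMaxCone i).indicator Om) k x := by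
  by_cases hx : x = 0
  · have h0 : ∀ Om', Kker d φ Om' k x = 0 := fun Om' =>
      Kker_eq_zero_of_norm_le hφ (by rw [hx, norm_zero]; positivity)
    simp [h0]
  · simp only [Kker]
    rw [← Finset.sum_mul, ← Finset.mul_sum, sum_indicator_firstMaxCone Om hx]

theorem abs_indicator_le_of_abs_le (hA : ∀ x, |Om x| ≤ A) (S : Set (Rd d)) (x : Rd d) :
    |S.indicator Om x| ≤ A := by
  by_cases hx : x ∈ S
  · rw [indicator_of_mem hx]; exact hA x
  · rw [indicator_of_notMem hx, abs_zero]; exact (abs_nonneg _).trans (hA x)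

theorem atomSum_eq_sum_firstMaxCone (hφ : AdmissiblePhi d φ) (hOm : Measurable Om)
    (hA : ∀ x, |Om x| ≤ A) (hb : ∀ c, Integrable (b c)) (x : Rd d) :
    atomSum d φ Om s F b x =
      ∑ i, atomSum d φ ((firstMaxCone i).indicator Om) s F b x := by
  obtain ⟨B, -, hB⟩ := AdmissiblePhi.exists_bound hφ
  simp only [atomSum]
  rw [Finset.sum_comm]
  refine Finset.sum_congr rfl fun c _ => ?_
  simp only [kconv]
  rw [← integral_finsetSum]
  · congr 1; ext y
    rw [Kker_eq_sum_firstMaxCone hφ, Finset.sum_mul]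
  · intro i _
    exact integrable_mul_of_bound (measurable_Kker hφ (hOm.indicator (measurableSet_firstMaxCone i)) _)
      (hB _ A (abs_indicator_le_of_abs_le hA _) _) (hb c) x

theorem exists_atomSum_bound (hφ : AdmissiblePhi d φ) (hd : 1 ≤ d) : ∃ C : ℝ, 0 < C ∧
    ∀ (Om : Rd d → ℝ) (A : ℝ) (p s : ℕ) (F : Finset (ℤ × (Fin d → ℤ)))
      (b : ℤ × (Fin d → ℤ) → Rd d → ℝ) (α : ℝ), Measurable Om → Homogeneous0 d Om →
      (∀ x, |Om x| ≤ A) → 3 ≤ p → p ≤ s → AtomFamily d F b α →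
      ∫⁻ x, ‖atomSum d φ Om s F b x‖ₑ ^ 2 ≤
        ENNReal.ofReal (C * A ^ 2 * ((2:ℝ) ^ (-(p:ℤ)) + (2:ℝ) ^ ((p:ℤ) - s)) * α) *
          ∑ c ∈ F, ∫⁻ y, ‖b c y‖ₑ := by
  obtain ⟨C, hC, h⟩ := exists_sector_bound hφ hd
  have hd' : (0:ℝ) < d := by exact_mod_cast hd
  refine ⟨d * d * C, by positivity, fun Om A p s F b α hOm hh hA hp hps hF => ?_⟩
  have hα := hF.nonneg
  have hOmi : ∀ i : Fin d, Measurable ((firstMaxCone i).indicator Om) := fun i =>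
    hOm.indicator (measurableSet_firstMaxCone i)
  have hm : ∀ i : Fin d, AEMeasurable fun x =>
      ‖atomSum d φ ((firstMaxCone i).indicator Om) s F b x‖ₑ ^ 2 := fun i =>
    (integrable_atomSum hφ (hOmi i) (abs_indicator_le_of_abs_le hA _)
      hF.integrable).aestronglyMeasurable.enorm.pow_const 2
  have key : ∀ i : Fin d, ∫⁻ x, ‖atomSum d φ ((firstMaxCone i).indicator Om) s F b x‖ₑ ^ 2 ≤
      ENNReal.ofReal (C * A ^ 2 * ((2:ℝ) ^ (-(p:ℤ)) + (2:ℝ) ^ ((p:ℤ) - s)) * α) *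
          ∑ c ∈ F, ∫⁻ y, ‖b c y‖ₑ := fun i => by
    refine h _ A i p s F b α (hOmi i) ?_ (abs_indicator_le_of_abs_le hA _) ?_ hp hps hF
    · intro x hx r hr
      by_cases hxi : x ∈ firstMaxCone i
      · rw [indicator_of_mem hxi, indicator_of_mem ((smul_mem_firstMaxCone hr).2 hxi), hh x hx r hr]
      · rw [indicator_of_notMem hxi, indicator_of_notMem (mt (smul_mem_firstMaxCone hr).1 hxi)]
    · intro x hx
      have := mem_of_indicator_ne_zero hx
      exact ⟨this.1, this.2.1⟩
  calc _ ≤ ∫⁻ x, (d : ℝ≥0∞) * ∑ i, ‖atomSum d φ ((firstMaxCone i).indicator Om) s F b x‖ₑ ^ 2 := by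
        refine lintegral_mono fun x => ?_
        rw [atomSum_eq_sum_firstMaxCone hφ hOm hA hF.integrable]
        simpa using enorm_sum_sq_le Finset.univ
          fun i : Fin d => atomSum d φ ((firstMaxCone i).indicator Om) s F b x
    _ = d * ∑ i, ∫⁻ x, ‖atomSum d φ ((firstMaxCone i).indicator Om) s F b x‖ₑ ^ 2 := by
        rw [lintegral_const_mul' _ _ (by simp), lintegral_finsetSum' _ fun i _ => hm i]
    _ ≤ d * ∑ _i : Fin d, ENNReal.ofReal
          (C * A ^ 2 * ((2:ℝ) ^ (-(p:ℤ)) + (2:ℝ) ^ ((p:ℤ) - s)) * α) *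
            ∑ c ∈ F, ∫⁻ y, ‖b c y‖ₑ := by
        gcongr with i
        exact key i
    _ = _ := by
        rw [Finset.sum_const, Finset.card_univ, Fintype.card_fin, nsmul_eq_mul,
          show d * d * C * A ^ 2 * ((2:ℝ) ^ (-(p:ℤ)) + (2:ℝ) ^ ((p:ℤ) - s)) * α =
          d * (d * (C * A ^ 2 * ((2:ℝ) ^ (-(p:ℤ)) + (2:ℝ) ^ ((p:ℤ) - s)) * α)) by ring,
          ENNReal.ofReal_mul (p := (d:ℝ)) (by positivity),
          ENNReal.ofReal_mul (p := (d:ℝ)) (by positivity), ENNReal.ofReal_natCast]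
        ring

end SectorSplit

section ShiftedGrid

variable {d : ℕ} {w : Fin d → ℝ}

/-- The coordinatewise comparison of endpoints which expresses that the cube with index `K` of the
grid `w` is contained in the one with index `K'`. -/
def CubeLe (w : Fin d → ℝ) (K K' : ℤ × (Fin d → ℤ)) : Prop :=
  ∀ i, (2:ℝ) ^ K'.1 * (w i + K'.2 i) ≤ (2:ℝ) ^ K.1 * (w i + K.2 i) ∧
    (2:ℝ) ^ K.1 * (w i + K.2 i + 1) ≤ (2:ℝ) ^ K'.1 * (w i + K'.2 i + 1)

theorem CubeLe.subset {K K' : ℤ × (Fin d → ℤ)} (h : CubeLe w K K') :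
    dcube d w K.1 K.2 ⊆ dcube d w K'.1 K'.2 := fun _ hx i =>
  ⟨(h i).1.trans (hx i).1, (hx i).2.trans_le (h i).2⟩

theorem CubeLe.trans {K K' K'' : ℤ × (Fin d → ℤ)} (h : CubeLe w K K') (h' : CubeLe w K' K'') :
    CubeLe w K K'' := fun i => ⟨(h' i).1.trans (h i).1, (h i).2.trans (h' i).2⟩

theorem exists_nat_zpow_eq {k k' : ℤ} (h : k < k') : ∃ e : ℕ, k' = k + 1 + e ∧
    (2:ℝ) ^ k' = (2:ℝ) ^ k * (2 * ((2 ^ e : ℤ) : ℝ)) := by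
  obtain ⟨e, he⟩ := Int.eq_ofNat_of_zero_le (show 0 ≤ k' - k - 1 by omega)
  refine ⟨e, by omega, ?_⟩
  rw [show k' = k + 1 + e by omega, zpow_add₀ (by norm_num), zpow_add₀ (by norm_num), zpow_one,
    zpow_natCast]
  push_cast
  ring

/-- Two intersecting intervals of a one dimensional shifted dyadic grid are nested, unless the grid
is shifted by one half and the midpoint of the smaller one is an endpoint of the larger one. -/
theorem interval_dichotomy {v : ℝ} (hv : v = 0 ∨ v = 1 / 2) {k k' : ℤ} {e : ℕ}
    (hz : (2:ℝ) ^ k' = (2:ℝ) ^ k * (2 * ((2 ^ e : ℤ) : ℝ)))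
    {m m' : ℤ} {x : ℝ} (h1 : (2:ℝ) ^ k * (v + m) ≤ x) (h2 : x < (2:ℝ) ^ k * (v + m + 1))
    (h3 : (2:ℝ) ^ k' * (v + m') ≤ x) (h4 : x < (2:ℝ) ^ k' * (v + m' + 1)) :
    ((2:ℝ) ^ k' * (v + m') ≤ (2:ℝ) ^ k * (v + m) ∧
      (2:ℝ) ^ k * (v + m + 1) ≤ (2:ℝ) ^ k' * (v + m' + 1)) ∨
    (v = 1 / 2 ∧ (m + 1 = 2 ^ e * (2 * m' + 1) ∨ m + 1 = 2 ^ e * (2 * m' + 3))) := by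
  have h2k : (0:ℝ) < 2 ^ k := by positivity
  have a1 := h3.trans_lt h2
  have a2 := h1.trans_lt h4
  rw [hz] at a1 a2 ⊢
  rw [mul_assoc] at a1 a2
  rw [mul_lt_mul_iff_right₀ h2k] at a1 a2
  simp only [mul_assoc, mul_le_mul_iff_right₀ h2k]
  rcases hv with rfl | rfl
  · left
    have b1 : 2 * 2 ^ e * m' < m + 1 := by
      have : ((2 * 2 ^ e * m' : ℤ) : ℝ) < ((m + 1 : ℤ) : ℝ) := by push_cast at a1 ⊢; linarith
      exact_mod_cast this
    have b2 : m < 2 * 2 ^ e * (m' + 1) := by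
      have : ((m : ℤ) : ℝ) < ((2 * 2 ^ e * (m' + 1) : ℤ) : ℝ) := by push_cast at a2 ⊢; linarith
      exact_mod_cast this
    have c1 : ((2 * 2 ^ e * m' : ℤ) : ℝ) ≤ ((m : ℤ) : ℝ) := Int.cast_le.2 (by omega)
    have c2 : ((m + 1 : ℤ) : ℝ) ≤ ((2 * 2 ^ e * (m' + 1) : ℤ) : ℝ) := Int.cast_le.2 (by omega)
    push_cast at c1 c2 ⊢
    constructor <;> linarith
  · have b1 : 2 * (2 ^ e * (2 * m' + 1)) < 2 * m + 3 := by
      have : ((2 * (2 ^ e * (2 * m' + 1)) : ℤ) : ℝ) < ((2 * m + 3 : ℤ) : ℝ) := by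
        push_cast at a1 ⊢; linarith
      exact_mod_cast this
    have b2 : 2 * m + 1 < 2 * (2 ^ e * (2 * m' + 3)) := by
      have : ((2 * m + 1 : ℤ) : ℝ) < ((2 * (2 ^ e * (2 * m' + 3)) : ℤ) : ℝ) := by
        push_cast at a2 ⊢; linarith
      exact_mod_cast this
    by_cases e1 : m + 1 = 2 ^ e * (2 * m' + 1)
    · exact Or.inr ⟨rfl, Or.inl e1⟩
    by_cases e2 : m + 1 = 2 ^ e * (2 * m' + 3)
    · exact Or.inr ⟨rfl, Or.inr e2⟩
    left
    have c1 : ((2 ^ e * (2 * m' + 1) : ℤ) : ℝ) ≤ ((m : ℤ) : ℝ) := by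
      exact_mod_cast (show 2 ^ e * (2 * m' + 1) ≤ m by omega)
    have c2 : ((m + 2 : ℤ) : ℝ) ≤ ((2 ^ e * (2 * m' + 3) : ℤ) : ℝ) := by
      exact_mod_cast (show m + 2 ≤ 2 ^ e * (2 * m' + 3) by omega)
    push_cast at c1 c2 ⊢
    constructor <;> linarith

/-- If a cube meets a larger cube which is contained in a still larger one, then it is itself
contained in the largest one. -/
theorem cubeLe_of_mem_of_cubeLe (hw : GridShift d w) {K₁ K₂ K' : ℤ × (Fin d → ℤ)}
    (h12 : K₁.1 < K₂.1) (h23 : K₂.1 < K'.1) {x : Rd d} (hx₁ : x ∈ dcube d w K₁.1 K₁.2)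
    (hx₂ : x ∈ dcube d w K₂.1 K₂.2) (h : CubeLe w K₂ K') : CubeLe w K₁ K' := by
  intro i
  obtain ⟨e, -, hz⟩ := exists_nat_zpow_eq h12
  obtain ⟨e', -, hz'⟩ := exists_nat_zpow_eq h23
  have h2k : (0:ℝ) < 2 ^ K₁.1 := by positivity
  have h2k' : (0:ℝ) < 2 ^ K₂.1 := by positivity
  rcases interval_dichotomy (hw i) hz (hx₁ i).1 (hx₁ i).2 (hx₂ i).1 (hx₂ i).2 with hc | ⟨hv, hc⟩
  · exact ⟨(h i).1.trans hc.1, hc.2.trans (h i).2⟩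
  obtain ⟨g1, g2⟩ := h i
  rw [hz', mul_assoc] at g1 g2
  rw [hv] at g1 g2 ⊢
  rw [mul_le_mul_iff_right₀ h2k'] at g1 g2
  have b1 : 2 * 2 ^ e' * (2 * K'.2 i + 1) ≤ 2 * K₂.2 i + 1 := by
    have : ((2 * 2 ^ e' * (2 * K'.2 i + 1) : ℤ) : ℝ) ≤ ((2 * K₂.2 i + 1 : ℤ) : ℝ) := by
      push_cast at g1 ⊢; linarith
    exact_mod_cast this
  have b2 : 2 * K₂.2 i + 3 ≤ 2 * 2 ^ e' * (2 * K'.2 i + 3) := by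
    have : ((2 * K₂.2 i + 3 : ℤ) : ℝ) ≤ ((2 * 2 ^ e' * (2 * K'.2 i + 3) : ℤ) : ℝ) := by
      push_cast at g2 ⊢; linarith
    exact_mod_cast this
  have b1' : 2 * (2 ^ e' * (2 * K'.2 i + 1)) ≤ 2 * K₂.2 i := by
    rw [mul_assoc] at b1; omega
  have b2' : 2 * K₂.2 i + 4 ≤ 2 * (2 ^ e' * (2 * K'.2 i + 3)) := by
    rw [mul_assoc] at b2; omega
  have hE : (1:ℤ) ≤ 2 ^ e := one_le_pow₀ (by norm_num)
  have hE0 : (0:ℤ) ≤ 2 * 2 ^ e := by positivity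
  have m1 := mul_le_mul_of_nonneg_left b1' hE0
  have m2 := mul_le_mul_of_nonneg_left b2' hE0
  have c1 : 2 * 2 ^ e * (2 * (2 ^ e' * (2 * K'.2 i + 1))) ≤ 2 * K₁.2 i + 1 := by
    rcases hc with hc | hc <;> nlinarith
  have c2 : 2 * K₁.2 i + 3 ≤ 2 * 2 ^ e * (2 * (2 ^ e' * (2 * K'.2 i + 3))) := by
    rcases hc with hc | hc <;> nlinarith
  have d1 : ((2 * 2 ^ e * (2 * (2 ^ e' * (2 * K'.2 i + 1))) : ℤ) : ℝ) ≤
    ((2 * K₁.2 i + 1 : ℤ) : ℝ) := by exact_mod_cast c1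
  have d2 : ((2 * K₁.2 i + 3 : ℤ) : ℝ) ≤
    ((2 * 2 ^ e * (2 * (2 ^ e' * (2 * K'.2 i + 3))) : ℤ) : ℝ) := by exact_mod_cast c2
  rw [hz', hz]
  simp only [mul_assoc, mul_le_mul_iff_right₀ h2k]
  push_cast at d1 d2 ⊢
  constructor <;> linarith

theorem eq_of_two_pow_mul_odd_eq {a b : ℕ} {o o' : ℤ} (ho : Odd o) (ho' : Odd o')
    (h : 2 ^ a * o = 2 ^ b * o') : a = b := by
  wlog hab : a ≤ b generalizing a b o o'
  · exact (this ho' ho h.symm (by omega)).symm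
  obtain ⟨c, rfl⟩ := Nat.exists_eq_add_of_le hab
  rw [pow_add, mul_assoc] at h
  have h' := mul_left_cancel₀ (by positivity) h
  rcases Nat.eq_zero_or_pos c with rfl | hc
  · rfl
  · exfalso
    have : Even o := by
      rw [h']; exact (((even_two (α := ℤ)).pow_of_ne_zero hc.ne').mul_right _)
    exact (Int.not_even_iff_odd.2 ho) this

/-- Among the cubes of larger size meeting a given cube, at most one scale per coordinate fails to
be nested. -/
theorem exists_coord_of_not_cubeLe (hw : GridShift d w) (K : ℤ × (Fin d → ℤ)) :
    ∃ κ : Fin d → ℤ, ∀ K' : ℤ × (Fin d → ℤ), K.1 < K'.1 → ∀ x, x ∈ dcube d w K.1 K.2 →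
      x ∈ dcube d w K'.1 K'.2 → ¬ CubeLe w K K' → ∃ i, K'.1 = κ i := by
  classical
  refine ⟨fun i => if h : ∃ (e : ℕ) (o : ℤ), Odd o ∧ K.2 i + 1 = 2 ^ e * o then
    K.1 + 1 + (h.choose : ℕ) else 0, fun K' hK x hx hx' hn => ?_⟩
  obtain ⟨e, he, hz⟩ := exists_nat_zpow_eq hK
  simp only [CubeLe, not_forall] at hn
  obtain ⟨i, hi⟩ := hn
  refine ⟨i, ?_⟩
  rcases interval_dichotomy (hw i) hz (hx i).1 (hx i).2 (hx' i).1 (hx' i).2 with hc | ⟨-, hc⟩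
  · exact absurd hc hi
  obtain ⟨o, ho, heq⟩ : ∃ o : ℤ, Odd o ∧ K.2 i + 1 = 2 ^ e * o := by
    rcases hc with hc | hc
    · exact ⟨_, ⟨K'.2 i, rfl⟩, hc⟩
    · exact ⟨_, ⟨K'.2 i + 1, by ring⟩, hc⟩
  have hex : ∃ (e : ℕ) (o : ℤ), Odd o ∧ K.2 i + 1 = 2 ^ e * o := ⟨e, o, ho, heq⟩
  obtain ⟨o', ho', heq'⟩ := hex.choose_spec
  simp only [dif_pos hex]
  rw [he, eq_of_two_pow_mul_odd_eq ho ho' (heq.symm.trans heq')]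

/-- Cubes of the same scale with a common point coincide. -/
theorem eq_of_mem_dcube {k : ℤ} {m m' : Fin d → ℤ} {x : Rd d} (hx : x ∈ dcube d w k m)
    (hx' : x ∈ dcube d w k m') : m = m' := by
  have h2k : (0:ℝ) < 2 ^ k := by positivity
  ext i
  have a1 := (hx i).1.trans_lt (hx' i).2
  have a2 := (hx' i).1.trans_lt (hx i).2
  rw [mul_lt_mul_iff_right₀ h2k] at a1 a2
  have b1 : ((m i : ℤ) : ℝ) < ((m' i + 1 : ℤ) : ℝ) := by push_cast; linarith
  have b2 : ((m' i : ℤ) : ℝ) < ((m i + 1 : ℤ) : ℝ) := by push_cast; linarith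
  rw [Int.cast_lt] at b1 b2
  omega

end ShiftedGrid

section Rank

variable {d : ℕ} {w : Fin d → ℝ} {J : Finset (ℤ × (Fin d → ℤ))}

open Classical in
/-- The number of scales of members of `J` which are larger than `K` and contain it. -/
def cubeRank (w : Fin d → ℝ) (J : Finset (ℤ × (Fin d → ℤ))) (K : ℤ × (Fin d → ℤ)) : ℕ :=
  ((J.filter fun K' => K.1 < K'.1 ∧ CubeLe w K K').image Prod.fst).card

open Classical in
theorem cubeRank_lt {K : ℤ × (Fin d → ℤ)} (hK : K ∈ J) {x : Rd d}
    (hx : x ∈ dcube d w K.1 K.2) {N : ℕ}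
    (hN : (J.filter fun K' => x ∈ dcube d w K'.1 K'.2).card ≤ N) : cubeRank w J K < N := by
  refine lt_of_le_of_lt Finset.card_image_le (lt_of_lt_of_le (Finset.card_lt_card ?_) hN)
  rw [Finset.ssubset_iff_of_subset]
  · exact ⟨K, Finset.mem_filter.2 ⟨hK, hx⟩, fun h => lt_irrefl _ (Finset.mem_filter.1 h).2.1⟩
  · intro K' h
    rw [Finset.mem_filter] at h ⊢
    exact ⟨h.1, h.2.2.subset hx⟩

theorem cubeRank_le_of_lt (hw : GridShift d w) {K₁ K₂ : ℤ × (Fin d → ℤ)} (h12 : K₁.1 < K₂.1)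
    {x : Rd d} (hx₁ : x ∈ dcube d w K₁.1 K₁.2) (hx₂ : x ∈ dcube d w K₂.1 K₂.2) :
    cubeRank w J K₂ ≤ cubeRank w J K₁ := by
  classical
  refine Finset.card_le_card (Finset.image_subset_image fun K' h => ?_)
  rw [Finset.mem_filter] at h ⊢
  exact ⟨h.1, h12.trans h.2.1, cubeLe_of_mem_of_cubeLe hw h12 h.2.1 hx₁ hx₂ h.2.2⟩

theorem cubeRank_lt_of_cubeLe {K₁ K₂ : ℤ × (Fin d → ℤ)} (h12 : K₁.1 < K₂.1)
    (h : CubeLe w K₁ K₂) (hK : K₂ ∈ J) : cubeRank w J K₂ < cubeRank w J K₁ := by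
  classical
  refine Finset.card_lt_card ?_
  rw [Finset.ssubset_iff_of_subset]
  · refine ⟨K₂.1, Finset.mem_image_of_mem _ (Finset.mem_filter.2 ⟨hK, h12, h⟩), fun h' => ?_⟩
    obtain ⟨K', h1, h2⟩ := Finset.mem_image.1 h'
    exact absurd h2 (Finset.mem_filter.1 h1).2.1.ne'
  · refine Finset.image_subset_image fun K' h' => ?_
    rw [Finset.mem_filter] at h' ⊢
    exact ⟨h'.1, h12.trans h'.2.1, h.trans h'.2.2⟩

open Classical in
theorem card_cubeRank_eq_le (hw : GridShift d w) (x : Rd d) (j : ℕ) :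
    (J.filter fun K => x ∈ dcube d w K.1 K.2 ∧ cubeRank w J K = j).card ≤ d + 1 := by
  set S := J.filter fun K => x ∈ dcube d w K.1 K.2 ∧ cubeRank w J K = j with hS
  rcases S.eq_empty_or_nonempty with h0 | hne
  · simp [h0]
  obtain ⟨K₀, hK₀, hmin⟩ := Finset.exists_min_image S Prod.fst hne
  have hinj : Set.InjOn Prod.fst (S : Set (ℤ × (Fin d → ℤ))) := fun K hK K' hK' h => by
    obtain ⟨k, m⟩ := K
    obtain ⟨k', m'⟩ := K'
    obtain rfl : k = k' := h
    have : m = m' := eq_of_mem_dcube (Finset.mem_filter.1 hK).2.1 (Finset.mem_filter.1 hK').2.1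
    rw [this]
  obtain ⟨κ, hκ⟩ := exists_coord_of_not_cubeLe hw K₀
  have hsub : S.image Prod.fst ⊆ insert K₀.1 (Finset.univ.image κ) := by
    intro k hk
    obtain ⟨K, hK, rfl⟩ := Finset.mem_image.1 hk
    rcases (hmin K hK).eq_or_lt with h | h
    · rw [h]; exact Finset.mem_insert_self _ _
    · rw [hS, Finset.mem_filter] at hK hK₀
      obtain ⟨i, hi⟩ := hκ K h x hK₀.2.1 hK.2.1 fun hle => by
        have := cubeRank_lt_of_cubeLe h hle hK.1
        omega
      rw [hi]
      exact Finset.mem_insert_of_mem (Finset.mem_image_of_mem _ (Finset.mem_univ _))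
  calc S.card = (S.image Prod.fst).card := (Finset.card_image_of_injOn hinj).symm
    _ ≤ _ := Finset.card_le_card hsub
    _ ≤ (Finset.univ.image κ).card + 1 := Finset.card_insert_le _ _
    _ ≤ d + 1 := by
        gcongr
        exact Finset.card_image_le.trans (by simp)

end Rank

section DyadicBlocks

variable {ι E : Type*} [SeminormedAddCommGroup E]

theorem sum_filter_lt_eq_sum_blocks (J : Finset ι) (r : ι → ℕ) (z : ι → E) {H j : ℕ}
    (hj : j < 2 ^ H) : ∑ K ∈ J with r K < j, z K = ∑ h ∈ Finset.range H,
      if j / 2 ^ h % 2 = 1 then ∑ K ∈ J with r K / 2 ^ h = j / 2 ^ h - 1, z K else 0 := by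
  have hstep : ∀ h, (if j / 2 ^ h % 2 = 1 then ∑ K ∈ J with r K / 2 ^ h = j / 2 ^ h - 1, z K else 0) =
      ∑ K ∈ J with r K / 2 ^ h < j / 2 ^ h, z K -
        ∑ K ∈ J with r K / 2 ^ (h + 1) < j / 2 ^ (h + 1), z K := fun h => by
    simp only [pow_succ, ← Nat.div_div_eq_div_mul]
    rw [eq_sub_iff_add_eq]
    simp only [Finset.sum_filter]
    split_ifs with ho
    · rw [← Finset.sum_add_distrib]
      refine Finset.sum_congr rfl fun K _ => ?_
      generalize r K / 2 ^ h = u, j / 2 ^ h = v at *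
      by_cases h1 : u = v - 1
      · rw [if_pos h1, if_neg (by omega), if_pos (by omega), add_zero]
      · rw [if_neg h1, zero_add]
        exact if_congr (show u / 2 < v / 2 ↔ u < v by omega) rfl rfl
    · rw [zero_add]
      refine Finset.sum_congr rfl fun K _ => ?_
      generalize r K / 2 ^ h = u, j / 2 ^ h = v at *
      exact if_congr (show u / 2 < v / 2 ↔ u < v by omega) rfl rfl
  rw [Finset.sum_congr rfl fun h _ => hstep h, Finset.sum_range_sub'
    (fun h => ∑ K ∈ J with r K / 2 ^ h < j / 2 ^ h, z K)]
  simp [Nat.div_eq_of_lt hj]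

theorem enorm_sum_filter_lt_sq_le (J : Finset ι) (r : ι → ℕ) (z : ι → E) {H j : ℕ}
    (hj : j < 2 ^ H) : ‖∑ K ∈ J with r K < j, z K‖ₑ ^ 2 ≤
      H * ∑ h ∈ Finset.range H, ∑ q ∈ Finset.range (2 ^ H),
        ‖∑ K ∈ J with r K / 2 ^ h = q, z K‖ₑ ^ 2 := by
  rw [sum_filter_lt_eq_sum_blocks J r z hj]
  refine (enorm_sum_sq_le _ _).trans ?_
  rw [Finset.card_range]
  gcongr with h _
  split_ifs
  · refine Finset.single_le_sum (f := fun q => ‖∑ K ∈ J with r K / 2 ^ h = q, z K‖ₑ ^ 2)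
      (fun _ _ => zero_le) (Finset.mem_range.2 ?_)
    exact lt_of_le_of_lt (Nat.sub_le _ _) (lt_of_le_of_lt (Nat.div_le_self _ _) hj)
  · rw [show ‖(0 : E)‖ₑ ^ 2 = 0 by simp [enorm]]; exact zero_le

end DyadicBlocks

section Maximal

variable {d : ℕ} {w : Fin d → ℝ} {J : Finset (ℤ × (Fin d → ℤ))}
  {h : ℤ × (Fin d → ℤ) → Rd d → ℝ}

theorem enorm_truncated_sum_sq_le (hw : GridShift d w)
    (hsupp : ∀ K ∈ J, ∀ x, x ∉ dcube d w K.1 K.2 → h K x = 0) {H : ℕ}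
    (hrank : ∀ K ∈ J, cubeRank w J K < 2 ^ H) (l : ℤ) (x : Rd d) :
    ‖∑ K ∈ J with l ≤ K.1, h K x‖ₑ ^ 2 ≤
      2 * (H * ∑ t ∈ Finset.range H, ∑ q ∈ Finset.range (2 ^ H),
        ‖∑ K ∈ J with cubeRank w J K / 2 ^ t = q, h K x‖ₑ ^ 2) +
      2 * ((d + 1 : ℕ) * ∑ K ∈ J, ‖h K x‖ₑ ^ 2) := by
  classical
  set S := J.filter fun K => l ≤ K.1 ∧ x ∈ dcube d w K.1 K.2 with hS
  have h0 : ∑ K ∈ J with l ≤ K.1, h K x = ∑ K ∈ S, h K x := by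
    rw [hS, ← Finset.filter_filter]
    refine (Finset.sum_subset (Finset.filter_subset _ _) fun K hK hK' => ?_).symm
    refine hsupp K (Finset.mem_filter.1 hK).1 x fun hx => hK' (Finset.mem_filter.2 ⟨hK, hx⟩)
  rw [h0]
  rcases S.eq_empty_or_nonempty with he | hne
  · simp [he]
  obtain ⟨K₀, hK₀, hmax⟩ := Finset.exists_max_image S (cubeRank w J) hne
  set j := cubeRank w J K₀ with hj
  have hK₀' := Finset.mem_filter.1 hK₀
  have hsplit : ∑ K ∈ S, h K x = ∑ K ∈ J with cubeRank w J K < j, h K x +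
      ∑ K ∈ S with cubeRank w J K = j, h K x := by
    rw [← Finset.sum_filter_add_sum_filter_not S (fun K => cubeRank w J K < j)]
    congr 1
    · refine Finset.sum_subset (fun K hK => ?_) fun K hK hK' => ?_
      · rw [Finset.mem_filter] at hK ⊢
        exact ⟨(Finset.mem_filter.1 hK.1).1, hK.2⟩
      · rw [Finset.mem_filter] at hK
        refine hsupp K hK.1 x fun hx => hK' ?_
        refine Finset.mem_filter.2 ⟨Finset.mem_filter.2 ⟨hK.1, ?_, hx⟩, hK.2⟩
        by_contra! hlt
        have := cubeRank_le_of_lt (J := J) hw (hlt.trans_le hK₀'.2.1) hx hK₀'.2.2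
        omega
    · refine Finset.sum_congr (Finset.filter_congr fun K hK => ?_) fun _ _ => rfl
      have := hmax K hK
      omega
  rw [hsplit]
  refine (enorm_add_sq_le _ _).trans (add_le_add ?_ ?_)
  · exact mul_le_mul_right (enorm_sum_filter_lt_sq_le J _ _ (hrank K₀ hK₀'.1)) _
  · refine mul_le_mul_right ((enorm_sum_sq_le _ _).trans (mul_le_mul' ?_ ?_)) _
    · refine Nat.cast_le.2 (le_trans (Finset.card_le_card fun K hK => ?_)
        (card_cubeRank_eq_le (J := J) hw x j))
      rw [hS, Finset.mem_filter, Finset.mem_filter] at hK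
      exact Finset.mem_filter.2 ⟨hK.1.1, hK.1.2.2, hK.2⟩
    · exact Finset.sum_le_sum_of_subset
        ((Finset.filter_subset _ _).trans (Finset.filter_subset _ _))

/-- A Rademacher-Menshov type bound for the maximal truncations of a finite family. -/
theorem lintegral_iSup_truncated_sum_sq_le (hw : GridShift d w)
    (hsupp : ∀ K ∈ J, ∀ x, x ∉ dcube d w K.1 K.2 → h K x = 0) {H : ℕ}
    (hrank : ∀ K ∈ J, cubeRank w J K < 2 ^ H) (hm : ∀ K, AEMeasurable (h K))
    {D : ℝ≥0∞} {M : ℤ × (Fin d → ℤ) → ℝ≥0∞}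
    (hD : ∀ S ⊆ J, ∫⁻ x, ‖∑ K ∈ S, h K x‖ₑ ^ 2 ≤ D * ∑ K ∈ S, M K) :
    ∫⁻ x, (⨆ l : ℤ, ‖∑ K ∈ J with l ≤ K.1, h K x‖ₑ ^ 2) ≤
      (2 * H * H + 2 * (d + 1 : ℕ)) * (D * ∑ K ∈ J, M K) := by
  have hmS : ∀ S : Finset (ℤ × (Fin d → ℤ)), AEMeasurable fun x => ‖∑ K ∈ S, h K x‖ₑ ^ 2 :=
    fun S => (Finset.aemeasurable_fun_sum S fun K _ => hm K).enorm.pow_const 2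
  have hmK : ∀ K, AEMeasurable fun x => ‖h K x‖ₑ ^ 2 := fun K => (hm K).enorm.pow_const 2
  have h1 : ∀ t, ∫⁻ x, ∑ q ∈ Finset.range (2 ^ H),
      ‖∑ K ∈ J with cubeRank w J K / 2 ^ t = q, h K x‖ₑ ^ 2 ≤ D * ∑ K ∈ J, M K := fun t => by
    rw [lintegral_finsetSum' _ fun q _ => hmS _]
    calc _ ≤ ∑ q ∈ Finset.range (2 ^ H), D * ∑ K ∈ J with cubeRank w J K / 2 ^ t = q, M K :=
          Finset.sum_le_sum fun q _ => hD _ (Finset.filter_subset _ _)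
      _ = D * ∑ K ∈ J, M K := by
          rw [← Finset.mul_sum, Finset.sum_fiberwise_of_maps_to]
          exact fun K hK => Finset.mem_range.2 (lt_of_le_of_lt (Nat.div_le_self _ _) (hrank K hK))
  have h2 : ∫⁻ x, ∑ K ∈ J, ‖h K x‖ₑ ^ 2 ≤ D * ∑ K ∈ J, M K := by
    rw [lintegral_finsetSum' _ fun K _ => hmK K, Finset.mul_sum]
    refine Finset.sum_le_sum fun K hK => ?_
    simpa using hD {K} (Finset.singleton_subset_iff.2 hK)
  calc _ ≤ ∫⁻ x, (2 * (H * ∑ t ∈ Finset.range H, ∑ q ∈ Finset.range (2 ^ H),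
        ‖∑ K ∈ J with cubeRank w J K / 2 ^ t = q, h K x‖ₑ ^ 2) +
      2 * ((d + 1 : ℕ) * ∑ K ∈ J, ‖h K x‖ₑ ^ 2)) :=
        lintegral_mono fun x => iSup_le fun l => enorm_truncated_sum_sq_le hw hsupp hrank l x
    _ = 2 * (H * ∑ t ∈ Finset.range H, ∫⁻ x, ∑ q ∈ Finset.range (2 ^ H),
        ‖∑ K ∈ J with cubeRank w J K / 2 ^ t = q, h K x‖ₑ ^ 2) +
      2 * ((d + 1 : ℕ) * ∫⁻ x, ∑ K ∈ J, ‖h K x‖ₑ ^ 2) := by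
        rw [lintegral_add_right' _
          (((Finset.aemeasurable_fun_sum _ fun K _ => hmK K).const_mul _).const_mul _),
          lintegral_const_mul' _ _ (by simp), lintegral_const_mul' _ _ (by simp),
          lintegral_const_mul' _ _ (by simp), lintegral_const_mul' _ _ (by simp),
          lintegral_finsetSum' _ fun t _ => Finset.aemeasurable_fun_sum _ fun q _ => hmS _]
    _ ≤ 2 * (H * ∑ _t ∈ Finset.range H, D * ∑ K ∈ J, M K) +
        2 * ((d + 1 : ℕ) * (D * ∑ K ∈ J, M K)) := by
        gcongr with t _
        exact h1 t
    _ = _ := by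
        rw [Finset.sum_const, Finset.card_range, nsmul_eq_mul]
        ring

end Maximal

section Children

variable {d : ℕ} {w : Fin d → ℝ} {s : ℕ}

/-- The lower corner of `½K`, in units of `2^{-s}` times the size of `K`. -/
def quarterIdx (w : Fin d → ℝ) (s : ℕ) (m : Fin d → ℤ) (i : Fin d) : ℤ :=
  ⌊(2:ℝ) ^ s * (w i + m i + 1 / 4)⌋

theorem cast_quarterIdx (hw : GridShift d w) (hs : 2 ≤ s) (m : Fin d → ℤ) (i : Fin d) :
    (quarterIdx w s m i : ℝ) = (2:ℝ) ^ s * (w i + m i + 1 / 4) := by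
  obtain ⟨t, rfl⟩ := Nat.exists_eq_add_of_le hs
  have h : ∃ z : ℤ, (z : ℝ) = (2:ℝ) ^ (2 + t) * (w i + m i + 1 / 4) := by
    rcases hw i with h0 | h0
    · exact ⟨2 ^ t * (4 * m i + 1), by rw [h0, pow_add]; push_cast; ring⟩
    · exact ⟨2 ^ t * (4 * m i + 3), by rw [h0, pow_add]; push_cast; ring⟩
  obtain ⟨z, hz⟩ := h
  rw [quarterIdx, ← hz, Int.floor_intCast]

/-- The indices of the standard dyadic cubes of size `2^{-s} l(K)` contained in `½K`. -/
def childIdx (w : Fin d → ℝ) (s : ℕ) (m : Fin d → ℤ) : Finset (Fin d → ℤ) :=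
  Fintype.piFinset fun i => Finset.Ico (quarterIdx w s m i) (quarterIdx w s m i + 2 ^ (s - 1))

theorem mem_dhalf_iff (hw : GridShift d w) (hs : 2 ≤ s) {k : ℤ} {m : Fin d → ℤ} {x : Rd d} :
    x ∈ dhalf d w k m ↔ ∀ i, (2:ℝ) ^ (k - s) * (quarterIdx w s m i : ℤ) ≤ x i ∧
      x i < (2:ℝ) ^ (k - s) * (quarterIdx w s m i + 2 ^ (s - 1) : ℤ) := by
  have hk : (2:ℝ) ^ k = 2 ^ (k - s) * 2 ^ s := by
    rw [← zpow_natCast, ← zpow_add₀ (by norm_num)]; congr 1; ring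
  have hs' : (2:ℝ) ^ s = 2 ^ (s - 1) * 2 := by
    rw [← pow_succ]; congr 1; omega
  refine forall_congr' fun i => ?_
  push_cast
  rw [cast_quarterIdx hw hs, hk]
  have e1 : (2:ℝ) ^ (k - s) * 2 ^ s * (w i + m i + 1 / 4) =
    2 ^ (k - s) * (2 ^ s * (w i + m i + 1 / 4)) := by ring
  have e2 : (2:ℝ) ^ (k - s) * 2 ^ s * (w i + m i + 3 / 4) =
    2 ^ (k - s) * (2 ^ s * (w i + m i + 1 / 4) + 2 ^ (s - 1)) := by rw [hs']; ring
  rw [e1, e2]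

theorem mem_childIdx_of_mem (hw : GridShift d w) (hs : 2 ≤ s) {k : ℤ} {m v : Fin d → ℤ}
    {x : Rd d} (hx : x ∈ dhalf d w k m) (hv : x ∈ dcube d 0 (k - s) v) : v ∈ childIdx w s m := by
  rw [mem_dhalf_iff hw hs] at hx
  have h2 : (0:ℝ) < 2 ^ (k - s) := by positivity
  refine Fintype.mem_piFinset.2 fun i => Finset.mem_Ico.2 ?_
  have a1 := (hx i).1.trans_lt (hv i).2
  have a2 := (hv i).1.trans_lt (hx i).2
  rw [mul_lt_mul_iff_right₀ h2] at a1 a2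
  have b1 : ((quarterIdx w s m i : ℤ) : ℝ) < ((v i + 1 : ℤ) : ℝ) := by
    push_cast; simpa using a1
  have b2 : ((v i : ℤ) : ℝ) < ((quarterIdx w s m i + 2 ^ (s - 1) : ℤ) : ℝ) := by
    simpa using a2
  exact ⟨Int.lt_add_one_iff.1 (Int.cast_lt.1 b1), Int.cast_lt.1 b2⟩

theorem dcube_subset_dhalf (hw : GridShift d w) (hs : 2 ≤ s) {k : ℤ} {m v : Fin d → ℤ}
    (hv : v ∈ childIdx w s m) : dcube d 0 (k - s) v ⊆ dhalf d w k m := by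
  intro x hx
  rw [mem_dhalf_iff hw hs]
  intro i
  obtain ⟨h1, h2⟩ := Finset.mem_Ico.1 (Fintype.mem_piFinset.1 hv i)
  have h3 : ((quarterIdx w s m i : ℤ) : ℝ) ≤ 0 + v i := by
    rw [zero_add]; exact Int.cast_le.2 h1
  have h4 : (0:ℝ) + v i + 1 ≤ ((quarterIdx w s m i + 2 ^ (s - 1) : ℤ) : ℝ) := by
    have := Int.cast_le (R := ℝ).2 (Int.add_one_le_iff.2 h2)
    rw [zero_add]
    simpa using this
  exact ⟨le_trans (by gcongr; exact h3) (hx i).1, (hx i).2.trans_le (by gcongr; exact h4)⟩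

theorem dhalf_subset_dcube (k : ℤ) (m : Fin d → ℤ) : dhalf d w k m ⊆ dcube d w k m := by
  intro x hx i
  have h2 : (0:ℝ) < 2 ^ k := by positivity
  exact ⟨le_trans (mul_le_mul_of_nonneg_left (by linarith) h2.le) (hx i).1,
    (hx i).2.trans_le (mul_le_mul_of_nonneg_left (by linarith) h2.le)⟩

theorem dcube_nonempty (k : ℤ) (m : Fin d → ℤ) : (dcube d w k m).Nonempty := by
  refine ⟨WithLp.toLp 2 fun i => (2:ℝ) ^ k * (w i + m i), fun i => ⟨le_rfl, ?_⟩⟩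
  have h2 : (0:ℝ) < 2 ^ k := by positivity
  exact mul_lt_mul_of_pos_left (by linarith) h2

open Classical in
/-- The indices of the cubes of `Qset` of size `2^{-s} l(K)` which are contained in `½K`. -/
def atomIdx (w : Fin d → ℝ) (s : ℕ) (Qset : Set (ℤ × (Fin d → ℤ))) (K : ℤ × (Fin d → ℤ)) :
    Finset (ℤ × (Fin d → ℤ)) :=
  ((childIdx w s K.2).image fun v => (K.1 - (s:ℤ), v)).filter (· ∈ Qset)

variable {Qset : Set (ℤ × (Fin d → ℤ))} {K K' c : ℤ × (Fin d → ℤ)}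

theorem mem_atomIdx : c ∈ atomIdx w s Qset K ↔ c ∈ Qset ∧ c.1 = K.1 - s ∧
    c.2 ∈ childIdx w s K.2 := by
  obtain ⟨k, v⟩ := c
  simp only [atomIdx, Finset.mem_filter, Finset.mem_image, Prod.mk.injEq]
  constructor
  · rintro ⟨⟨v', h1, h2, rfl⟩, h3⟩
    exact ⟨h3, h2.symm, h1⟩
  · rintro ⟨h1, h2, h3⟩
    exact ⟨⟨v, h3, h2.symm, rfl⟩, h1⟩

theorem dcube_subset_of_mem_atomIdx (hw : GridShift d w) (hs : 2 ≤ s)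
    (hc : c ∈ atomIdx w s Qset K) : dcube d 0 c.1 c.2 ⊆ dhalf d w K.1 K.2 := by
  obtain ⟨-, h1, h2⟩ := mem_atomIdx.1 hc
  rw [h1]
  exact dcube_subset_dhalf hw hs h2

theorem eq_of_mem_atomIdx (hw : GridShift d w) (hs : 2 ≤ s)
    (hc : c ∈ atomIdx w s Qset K) (hc' : c ∈ atomIdx w s Qset K') : K = K' := by
  have h1 := (mem_atomIdx.1 hc).2.1
  have h2 := (mem_atomIdx.1 hc').2.1
  obtain ⟨x, hx⟩ := dcube_nonempty (w := (0 : Fin d → ℝ)) c.1 c.2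
  have h3 := dhalf_subset_dcube _ _ (dcube_subset_of_mem_atomIdx hw hs hc hx)
  have h4 := dhalf_subset_dcube _ _ (dcube_subset_of_mem_atomIdx hw hs hc' hx)
  have h5 : K.1 = K'.1 := by omega
  rw [h5] at h3
  exact Prod.ext h5 (eq_of_mem_dcube h3 h4)

theorem indicator_dhalf_bsum (hw : GridShift d w) (hs : 2 ≤ s)
    {b : ℤ × (Fin d → ℤ) → Rd d → ℝ}
    (hb : ∀ q ∈ Qset, Function.support (b q) ⊆ dcube d 0 q.1 q.2) (x : Rd d) :
    (dhalf d w K.1 K.2).indicator (bsum d Qset b (K.1 - (s:ℤ))) x =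
      ∑ c ∈ atomIdx w s Qset K, b c x := by
  classical
  by_cases hx : x ∈ dhalf d w K.1 K.2
  · rw [indicator_of_mem hx, bsum, tsum_eq_sum (s := childIdx w s K.2)]
    · rw [atomIdx, Finset.sum_filter, Finset.sum_image fun v _ v' _ h => (Prod.mk.inj h).2]
      exact Finset.sum_congr rfl fun v _ => by rw [indicator_apply]
    · intro v hv
      by_contra h0
      have h1 := mem_of_indicator_ne_zero h0
      rw [indicator_of_mem h1] at h0
      exact hv (mem_childIdx_of_mem hw hs hx (hb _ h1 h0))
  · rw [indicator_of_notMem hx]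
    refine (Finset.sum_eq_zero fun c hc => ?_).symm
    by_contra h0
    exact hx (dcube_subset_of_mem_atomIdx hw hs hc (hb c (mem_atomIdx.1 hc).1 h0))

theorem atomIdx_nonempty (hw : GridShift d w) (hs : 2 ≤ s)
    {b : ℤ × (Fin d → ℤ) → Rd d → ℝ}
    (hb : ∀ q ∈ Qset, Function.support (b q) ⊆ dcube d 0 q.1 q.2)
    (hK : ¬ ((dhalf d w K.1 K.2).indicator (bsum d Qset b (K.1 - (s : ℤ)))
        =ᵐ[(volume : Measure (Rd d))] (fun _ => (0:ℝ)))) : (atomIdx w s Qset K).Nonempty := by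
  by_contra h
  rw [Finset.not_nonempty_iff_eq_empty] at h
  refine hK (Filter.Eventually.of_forall fun x => ?_)
  simp only [indicator_dhalf_bsum hw hs hb, h, Finset.sum_empty]

theorem TKop_eq_zero_of_notMem {φ Om : Rd d → ℝ} (hφ : AdmissiblePhi d φ) {k : ℤ}
    {m : Fin d → ℤ} (g : Rd d → ℝ) {x : Rd d} (hx : x ∉ dcube d w k m) :
    TKop d φ Om w k m g x = 0 := by
  rw [TKop, integral_eq_zero_of_ae]
  refine Filter.Eventually.of_forall fun y => ?_
  by_contra h0
  have h0' := mul_ne_zero_iff.1 h0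
  have hy := mem_of_indicator_ne_zero h0'.2
  have hn : ‖x - y‖ < 2 ^ (k - 2) := by
    by_contra! hle
    exact h0'.1 (Kker_eq_zero_of_le_norm hφ hle)
  refine hx fun i => ?_
  have h1 := ((abs_apply_le_norm (x - y) i).trans_lt hn)
  rw [zpow_sub₀ (by norm_num), PiLp.sub_apply, abs_lt] at h1
  have h2 := hy i
  norm_num at h1
  constructor <;> linarith [h1.1, h1.2, h2.1, h2.2]

theorem sum_atomIdx_le_tsum (hw : GridShift d w) (hs : 2 ≤ s) (g : ℤ × (Fin d → ℤ) → ℝ≥0∞)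
    {T : Set (ℤ × (Fin d → ℤ))} (S : Finset (ℤ × (Fin d → ℤ)))
    (hT : ∀ K ∈ S, ∀ c ∈ atomIdx w s Qset K, c ∈ T) :
    ∑ K ∈ S, ∑ c ∈ atomIdx w s Qset K, g c ≤ ∑' c, T.indicator g c := by
  classical
  rw [← Finset.sum_biUnion fun K _ K' _ hne => Finset.disjoint_left.2 fun c hc hc' =>
    hne (eq_of_mem_atomIdx hw hs hc hc')]
  refine le_trans (le_of_eq (Finset.sum_congr rfl fun c hc => ?_)) (ENNReal.sum_le_tsum _)
  obtain ⟨K, hK, hcK⟩ := Finset.mem_biUnion.1 hc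
  rw [indicator_of_mem (hT K hK c hcK)]

end Children

theorem tsum_indicator_measure_le {ι α : Type*} [Countable ι] [MeasurableSpace α]
    {μ : Measure α} {T : Set ι} {A : ι → Set α} {F : Set α} (hA : ∀ i, MeasurableSet (A i))
    (hT : T.Pairwise fun i j => Disjoint (A i) (A j)) (hF : ∀ i ∈ T, A i ⊆ F) :
    ∑' i, T.indicator (fun i => μ (A i)) i ≤ μ F := by
  classical
  have h : ∀ i, T.indicator (fun i => μ (A i)) i = μ (if i ∈ T then A i else ∅) := by
    intro i
    by_cases hi : i ∈ T <;> simp [hi]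
  simp only [h]
  rw [← measure_iUnion]
  · refine measure_mono (iUnion_subset fun i => ?_)
    by_cases hi : i ∈ T
    · simpa [hi] using hF i hi
    · simp [hi]
  · intro i j hij
    by_cases hi : i ∈ T
    · by_cases hj : j ∈ T
      · simpa [Function.onFun, hi, hj] using hT hi hj hij
      · simp [Function.onFun, hj]
    · simp [Function.onFun, hi]
  · intro i
    by_cases hi : i ∈ T
    · simpa [hi] using hA i
    · simp [hi]

section Counting

variable {d : ℕ} {w : Fin d → ℝ} {s : ℕ} {Qset : Set (ℤ × (Fin d → ℤ))}
  {b : ℤ × (Fin d → ℤ) → Rd d → ℝ} {COm Cc c₁ c₂ lam : ℝ} {f : Rd d → ℝ}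

theorem mem_Fset_succ {C₀ : ℝ} {n : ℕ} {x : Rd d} : x ∈ Fset d w Qset b s C₀ (n + 1) ↔
    ENNReal.ofReal (C₀ * (2:ℝ) ^ (d * s)) < ∑' km : ℤ × (Fin d → ℤ),
      {km' : ℤ × (Fin d → ℤ) | dcube d w km'.1 km'.2 ⊆ Fset d w Qset b s C₀ n ∧
        ¬ ((dhalf d w km'.1 km'.2).indicator (bsum d Qset b (km'.1 - (s : ℤ)))
          =ᵐ[(volume : Measure (Rd d))] (fun _ => (0:ℝ)))}.indicator
        (fun km' => (dcube d w km'.1 km'.2).indicator (fun _ => (1:ℝ≥0∞)) x) km :=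
  Iff.rfl

/-- The total volume of the cubes of `Qset` contained in the `m`-th exceptional set. -/
def exceptionalVolume (w : Fin d → ℝ) (Qset : Set (ℤ × (Fin d → ℤ)))
    (b : ℤ × (Fin d → ℤ) → Rd d → ℝ) (s : ℕ) (C₀ : ℝ) (m : ℕ) : ℝ≥0∞ :=
  ∑' q : ℤ × (Fin d → ℤ), {q' : ℤ × (Fin d → ℤ) | q' ∈ Qset ∧
      dcube d 0 q'.1 q'.2 ⊆ Fset d w Qset b s C₀ m}.indicator
    (fun q' => volume (dcube d 0 q'.1 q'.2)) q

theorem ofReal_mul_volume_le (h : CZData d COm Cc c₁ c₂ f lam Qset b) (hf : Integrable f)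
    {q : ℤ × (Fin d → ℤ)} (hq : q ∈ Qset) :
    ENNReal.ofReal (c₁ * lam / COm) * volume (dcube d 0 q.1 q.2) ≤
      ∫⁻ x in dcube d 0 q.1 q.2, ‖f x‖ₑ := by
  have h0 := h.avg_lower q hq
  have h2 : (0:ℝ) < 2 ^ (q.1 * d) := by positivity
  rw [volume_dcube, ENNReal.toReal_ofReal h2.le, le_div_iff₀ h2] at h0
  rw [volume_dcube, ← ENNReal.ofReal_mul' h2.le]
  refine (ENNReal.ofReal_le_ofReal h0).trans (le_of_eq ?_)
  exact ofReal_integral_norm_eq_lintegral_enorm hf.integrableOn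

theorem integral_abs_le (h : CZData d COm Cc c₁ c₂ f lam Qset b) (hCc : 0 ≤ Cc)
    {q : ℤ × (Fin d → ℤ)} (hq : q ∈ Qset) :
    ∫ x, |b q x| ≤ Cc * (c₂ * lam / COm) * (2:ℝ) ^ (q.1 * d) := by
  have h0 := h.avg_upper q hq
  have h2 : (0:ℝ) < 2 ^ (q.1 * d) := by positivity
  rw [volume_dcube, ENNReal.toReal_ofReal h2.le, div_le_iff₀ h2] at h0
  rw [mul_assoc]
  exact (h.l1_bound q hq).trans (mul_le_mul_of_nonneg_left h0 hCc)

theorem lintegral_enorm_le (h : CZData d COm Cc c₁ c₂ f lam Qset b) (hCc : 0 ≤ Cc)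
    {q : ℤ × (Fin d → ℤ)} (hq : q ∈ Qset) :
    ∫⁻ x, ‖b q x‖ₑ ≤
      ENNReal.ofReal (Cc * (c₂ * lam / COm)) * volume (dcube d 0 q.1 q.2) := by
  have h2 : (0:ℝ) < 2 ^ (q.1 * d) := by positivity
  rw [volume_dcube, ← ENNReal.ofReal_mul' h2.le,
    ← ofReal_integral_norm_eq_lintegral_enorm (h.integrable q hq)]
  exact ENNReal.ofReal_le_ofReal (integral_abs_le h hCc hq)

theorem ofReal_mul_exceptionalVolume_zero_le (h : CZData d COm Cc c₁ c₂ f lam Qset b)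
    (hf : Integrable f) (C₀ : ℝ) :
    ENNReal.ofReal (c₁ * lam / COm) * exceptionalVolume w Qset b s C₀ 0 ≤ ∫⁻ x, ‖f x‖ₑ := by
  classical
  rw [exceptionalVolume, ← ENNReal.tsum_mul_left]
  have h1 : ∀ q : ℤ × (Fin d → ℤ), ENNReal.ofReal (c₁ * lam / COm) *
      {q' : ℤ × (Fin d → ℤ) | q' ∈ Qset ∧
        dcube d 0 q'.1 q'.2 ⊆ Fset d w Qset b s C₀ 0}.indicator
        (fun q' => volume (dcube d 0 q'.1 q'.2)) q ≤
      Qset.indicator (fun q' => (volume.withDensity fun x => ‖f x‖ₑ)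
        (dcube d 0 q'.1 q'.2)) q := by
    intro q
    by_cases hq : q ∈ Qset
    · rw [indicator_of_mem hq, indicator_of_mem (by exact ⟨hq, subset_univ _⟩),
        withDensity_apply _ (measurableSet_dcube 0 q.1 q.2)]
      exact ofReal_mul_volume_le h hf hq
    · rw [indicator_of_notMem (fun h' => hq h'.1), mul_zero]
      exact zero_le
  refine (ENNReal.tsum_le_tsum h1).trans ?_
  refine (tsum_indicator_measure_le (F := univ) (fun q : ℤ × (Fin d → ℤ) => measurableSet_dcube 0 q.1 q.2)
    h.pairwise_disjoint fun _ _ => subset_univ _).trans ?_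
  rw [withDensity_apply _ MeasurableSet.univ, Measure.restrict_univ]

theorem volume_dcube_eq_of_mem_atomIdx {K c : ℤ × (Fin d → ℤ)} (hc : c ∈ atomIdx w s Qset K) :
    volume (dcube d w K.1 K.2) = ENNReal.ofReal ((2:ℝ) ^ (d * s)) *
      volume (dcube d 0 c.1 c.2) := by
  rw [volume_dcube, volume_dcube, ← ENNReal.ofReal_mul (by positivity), (mem_atomIdx.1 hc).2.1,
    ← zpow_natCast, ← zpow_add₀ (by norm_num)]
  congr 2
  push_cast
  ring

theorem four_mul_exceptionalVolume_succ_le (hw : GridShift d w) (hs : 2 ≤ s)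
    (h : CZData d COm Cc c₁ c₂ f lam Qset b) (m : ℕ) :
    4 * exceptionalVolume w Qset b s 4 (m + 1) ≤ exceptionalVolume w Qset b s 4 m := by
  classical
  have h1 : exceptionalVolume w Qset b s 4 (m + 1) ≤ volume (Fset d w Qset b s 4 (m + 1)) :=
    tsum_indicator_measure_le (fun q => measurableSet_dcube 0 q.1 q.2)
      (h.pairwise_disjoint.mono fun q hq => hq.1) fun q hq => hq.2
  set E : Set (ℤ × (Fin d → ℤ)) := {km' : ℤ × (Fin d → ℤ) |
      dcube d w km'.1 km'.2 ⊆ Fset d w Qset b s 4 m ∧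
      ¬ ((dhalf d w km'.1 km'.2).indicator (bsum d Qset b (km'.1 - (s : ℤ)))
        =ᵐ[(volume : Measure (Rd d))] (fun _ => (0:ℝ)))} with hE
  have hmeas : ∀ K : ℤ × (Fin d → ℤ), Measurable fun x : Rd d =>
      E.indicator (fun km' => (dcube d w km'.1 km'.2).indicator
        (fun _ => (1:ℝ≥0∞)) x) K := by
    intro K
    simp only [indicator_apply _ (_ : ℤ × (Fin d → ℤ) → ℝ≥0∞)]
    split_ifs
    · exact measurable_const.indicator (measurableSet_dcube w K.1 K.2)
    · exact measurable_const
  have h2 : ENNReal.ofReal (4 * (2:ℝ) ^ (d * s)) * volume (Fset d w Qset b s 4 (m + 1)) ≤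
      ∑' K, E.indicator (fun K => volume (dcube d w K.1 K.2)) K := by
    have e : ∑' K, E.indicator (fun K => volume (dcube d w K.1 K.2)) K =
        ∫⁻ x, ∑' K, E.indicator (fun km' => (dcube d w km'.1 km'.2).indicator
          (fun _ => (1:ℝ≥0∞)) x) K := by
      rw [lintegral_tsum fun K => (hmeas K).aemeasurable]
      refine tsum_congr fun K => ?_
      by_cases hK : K ∈ E
      · simp only [indicator_of_mem hK]
        rw [lintegral_indicator_const (measurableSet_dcube w K.1 K.2), one_mul]
      · simp only [indicator_of_notMem hK, lintegral_zero]
    rw [e]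
    refine le_trans (mul_le_mul_right (measure_mono fun x hx => ?_) _)
      (mul_meas_ge_le_lintegral (Measurable.tsum hmeas) _)
    exact le_of_lt (mem_Fset_succ.1 hx)
  have h3 : ∑' K, E.indicator (fun K => volume (dcube d w K.1 K.2)) K ≤
      ENNReal.ofReal ((2:ℝ) ^ (d * s)) * exceptionalVolume w Qset b s 4 m := by
    rw [ENNReal.tsum_eq_iSup_sum]
    refine iSup_le fun S => ?_
    simp only [indicator_apply]
    rw [← Finset.sum_filter]
    have h4 : ∀ K ∈ S.filter (· ∈ E), volume (dcube d w K.1 K.2) ≤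
        ENNReal.ofReal ((2:ℝ) ^ (d * s)) *
          ∑ c ∈ atomIdx w s Qset K, volume (dcube d 0 c.1 c.2) := by
      intro K hK
      obtain ⟨c, hc⟩ := atomIdx_nonempty hw hs h.support_subset (Finset.mem_filter.1 hK).2.2
      rw [volume_dcube_eq_of_mem_atomIdx hc]
      exact mul_le_mul_right (Finset.single_le_sum
        (f := fun c => volume (dcube d 0 c.1 c.2)) (fun _ _ => zero_le) hc) _
    refine (Finset.sum_le_sum h4).trans ?_
    rw [← Finset.mul_sum]
    refine mul_le_mul_right (sum_atomIdx_le_tsum hw hs _ _ fun K hK c hc => ?_) _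
    exact ⟨(mem_atomIdx.1 hc).1, (dcube_subset_of_mem_atomIdx hw hs hc).trans
      ((dhalf_subset_dcube _ _).trans (Finset.mem_filter.1 hK).2.1)⟩
  have h5 := (mul_le_mul_right h1 (ENNReal.ofReal (4 * (2:ℝ) ^ (d * s)))).trans (h2.trans h3)
  rw [mul_comm (4:ℝ), ENNReal.ofReal_mul (by positivity), mul_assoc] at h5
  rw [ENNReal.mul_le_mul_iff_right (by simp) (by simp)] at h5
  simpa using h5

theorem four_pow_mul_exceptionalVolume_le (hw : GridShift d w) (hs : 2 ≤ s)
    (h : CZData d COm Cc c₁ c₂ f lam Qset b) (m : ℕ) :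
    4 ^ m * exceptionalVolume w Qset b s 4 m ≤ exceptionalVolume w Qset b s 4 0 := by
  induction m with
  | zero => simp
  | succ m ih =>
    refine le_trans ?_ ih
    rw [pow_succ, mul_assoc]
    exact mul_le_mul_right (four_mul_exceptionalVolume_succ_le hw hs h m) _

theorem sum_lintegral_atoms_le (hw : GridShift d w) (hs : 2 ≤ s)
    (h : CZData d COm Cc c₁ c₂ f lam Qset b) (hf : Integrable f) (hCc : 0 ≤ Cc) (hc₁ : 0 < c₁)
    (hc₂ : 0 ≤ c₂) {m : ℕ} {S : Finset (ℤ × (Fin d → ℤ))}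
    (hS : ∀ K ∈ S, dcube d w K.1 K.2 ⊆ Fset d w Qset b s 4 m) :
    4 ^ m * ∑ K ∈ S, ∑ c ∈ atomIdx w s Qset K, ∫⁻ x, ‖b c x‖ₑ ≤
      ENNReal.ofReal (Cc * c₂ / c₁) * ∫⁻ x, ‖f x‖ₑ := by
  have h1 : ∑ K ∈ S, ∑ c ∈ atomIdx w s Qset K, ∫⁻ x, ‖b c x‖ₑ ≤
      ENNReal.ofReal (Cc * (c₂ * lam / COm)) * exceptionalVolume w Qset b s 4 m := by
    refine (Finset.sum_le_sum fun K _ => Finset.sum_le_sum fun c hc =>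
      lintegral_enorm_le h hCc (mem_atomIdx.1 hc).1).trans ?_
    simp only [← Finset.mul_sum]
    refine mul_le_mul_right (sum_atomIdx_le_tsum hw hs _ _ fun K hK c hc => ?_) _
    exact ⟨(mem_atomIdx.1 hc).1, (dcube_subset_of_mem_atomIdx hw hs hc).trans
      ((dhalf_subset_dcube _ _).trans (hS K hK))⟩
  have e : Cc * (c₂ * lam / COm) = Cc * c₂ / c₁ * (c₁ * lam / COm) := by
    field_simp
  calc _ ≤ 4 ^ m * (ENNReal.ofReal (Cc * (c₂ * lam / COm)) *
        exceptionalVolume w Qset b s 4 m) := mul_le_mul_right h1 _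
    _ = ENNReal.ofReal (Cc * c₂ / c₁) * (ENNReal.ofReal (c₁ * lam / COm) *
        (4 ^ m * exceptionalVolume w Qset b s 4 m)) := by
        rw [e, ENNReal.ofReal_mul (by positivity)]; ring
    _ ≤ _ := mul_le_mul_right ((mul_le_mul_right
        (four_pow_mul_exceptionalVolume_le hw hs h m) _).trans
        (ofReal_mul_exceptionalVolume_zero_le h hf 4)) _

theorem cubeRank_lt_of_mem_Isharp {n : ℕ} (hn : 1 ≤ n) {J : Finset (ℤ × (Fin d → ℤ))}
    (hJ : ∀ K ∈ J, K ∈ Isharp d w Qset b s 4 n) {K : ℤ × (Fin d → ℤ)} (hK : K ∈ J) :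
    cubeRank w J K < 2 ^ (d * s + 2) := by
  classical
  obtain ⟨m, rfl⟩ := Nat.exists_eq_add_of_le' hn
  obtain ⟨x, hxK, hxF⟩ := not_subset.1 (hJ K hK).2.2
  refine cubeRank_lt hK hxK ?_
  have h1 := not_lt.1 (mt mem_Fset_succ.2 hxF)
  have h2 : ((J.filter fun K' => x ∈ dcube d w K'.1 K'.2).card : ℝ≥0∞) ≤
      ENNReal.ofReal (4 * (2:ℝ) ^ (d * s)) := by
    refine le_trans ?_ h1
    refine le_trans (le_of_eq ?_)
      (ENNReal.sum_le_tsum (J.filter fun K' => x ∈ dcube d w K'.1 K'.2))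
    rw [Finset.card_eq_sum_ones, Nat.cast_sum]
    refine Finset.sum_congr rfl fun K' hK' => ?_
    obtain ⟨h3, h4⟩ := Finset.mem_filter.1 hK'
    have h5 := hJ K' h3
    rw [indicator_of_mem (by exact ⟨h5.2.1, h5.1⟩), indicator_of_mem h4, Nat.cast_one]
  have e : ENNReal.ofReal (4 * (2:ℝ) ^ (d * s)) = ((2 ^ (d * s + 2) : ℕ) : ℝ≥0∞) := by
    rw [← ENNReal.ofReal_natCast]
    congr 1
    push_cast
    ring
  rw [e] at h2
  exact_mod_cast h2

/-- The sidelengths of the cubes in `Isharp` are bounded above. -/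
theorem exists_scale_bound (hd : 1 ≤ d) (hw : GridShift d w) (hs : 2 ≤ s)
    (h : CZData d COm Cc c₁ c₂ f lam Qset b) (hf : Integrable f) (hpos : 0 < c₁ * lam / COm)
    (C₀ : ℝ) (n : ℕ) : ∃ N : ℤ, ∀ K ∈ Isharp d w Qset b s C₀ n, K.1 ≤ N := by
  have h2 : (1:ℝ) < 2 := by norm_num
  obtain ⟨r, hr⟩ := pow_unbounded_of_one_lt ((∫ x, |f x|) / (c₁ * lam / COm)) h2
  refine ⟨r + s, fun K hK => ?_⟩
  obtain ⟨c, hc⟩ := atomIdx_nonempty hw hs h.support_subset hK.1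
  by_contra! hlt
  obtain ⟨hq, hc1, -⟩ := mem_atomIdx.1 hc
  have hrc : (r:ℤ) ≤ c.1 := by omega
  have h0 := h.avg_lower c hq
  have h3 : (0:ℝ) < 2 ^ (c.1 * d) := by positivity
  rw [volume_dcube, ENNReal.toReal_ofReal h3.le, le_div_iff₀ h3] at h0
  have h4 := h0.trans (setIntegral_le_integral hf.abs
    (Filter.Eventually.of_forall fun x => abs_nonneg (f x)))
  have h5 : (2:ℝ) ^ r ≤ 2 ^ (c.1 * d) := by
    rw [← zpow_natCast]
    refine zpow_le_zpow_right₀ h2.le (hrc.trans ?_)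
    have : (1:ℤ) ≤ d := by exact_mod_cast hd
    nlinarith
  rw [div_lt_iff₀ hpos] at hr
  nlinarith

end Counting

section MeasurableModification

variable {d : ℕ} {Ω : Rd d → ℝ}

/-- A function which is homogeneous of degree zero and whose restriction to the sphere agrees
almost everywhere with `G` is almost everywhere equal to the homogeneous extension of `G`. -/
theorem ae_eq_comp_normalize (hd : 1 ≤ d) (hΩ : Homogeneous0 d Ω) {G : Rd d → ℝ}
    (hG : ∀ᵐ θ : sphere (0 : Rd d) 1 ∂sphereMeasure d, Ω θ = G θ) :
    ∀ᵐ x : Rd d, Ω x = G (‖x‖⁻¹ • x) := by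
  have : Nonempty (Fin d) := ⟨⟨0, hd⟩⟩
  have h1 := (Measure.quasiMeasurePreserving_fst (μ := sphereMeasure d)
    (ν := Measure.volumeIoiPow (Module.finrank ℝ (Rd d) - 1))).ae hG
  have hmp := (volume : Measure (Rd d)).measurePreserving_homeomorphUnitSphereProd
  have h2 := hmp.quasiMeasurePreserving.ae h1
  have h3 : ∀ x : ({0}ᶜ : Set (Rd d)),
      (((homeomorphUnitSphereProd (Rd d)) x).1 : Rd d) = ‖(x : Rd d)‖⁻¹ • (x : Rd d) :=
    fun x => by simp
  simp only [h3] at h2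
  have h4 := (ae_restrict_iff_subtype (p := fun x : Rd d => Ω (‖x‖⁻¹ • x) = G (‖x‖⁻¹ • x))
    (measurableSet_singleton (0 : Rd d)).compl).2 h2
  rw [ae_restrict_iff' (measurableSet_singleton (0 : Rd d)).compl] at h4
  have h5 : ∀ᵐ x : Rd d, x ∈ ({0}ᶜ : Set (Rd d)) :=
    compl_mem_ae_iff.2 (measure_singleton 0)
  filter_upwards [h4, h5] with x hx hx0
  rw [← hx hx0, hΩ x hx0 _ (inv_pos.2 (norm_pos_iff.2 hx0))]

theorem exists_measurable_truncation (hd : 1 ≤ d) (hΩ : Homogeneous0 d Ω)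
    (hm : AEStronglyMeasurable (fun θ : sphere (0 : Rd d) 1 => Ω θ) (sphereMeasure d))
    {A : ℝ} (hA : 0 ≤ A) : ∃ Om : Rd d → ℝ, Measurable Om ∧ Homogeneous0 d Om ∧
      (∀ x, |Om x| ≤ A) ∧ (fun x => if |Ω x| < A then Ω x else 0) =ᵐ[volume] Om := by
  obtain ⟨G, hGm, hG⟩ := (MeasurableEmbedding.subtype_coe
    (isClosed_sphere (x := (0 : Rd d)) (ε := 1)).measurableSet).exists_measurable_extend
    hm.aemeasurable.measurable_mk (fun _ => ⟨(0:ℝ)⟩)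
  have hae : ∀ᵐ θ : sphere (0 : Rd d) 1 ∂sphereMeasure d, Ω θ = G θ := by
    filter_upwards [hm.aemeasurable.ae_eq_mk] with θ hθ
    rw [hθ, ← hG, Function.comp_apply]
  have hGn : Measurable fun x : Rd d => G (‖x‖⁻¹ • x) :=
    hGm.comp (measurable_norm.inv.smul measurable_id)
  refine ⟨fun x => if |G (‖x‖⁻¹ • x)| < A then G (‖x‖⁻¹ • x) else 0,
    Measurable.ite (measurableSet_lt (continuous_abs.measurable.comp hGn) measurable_const)
      hGn measurable_const, fun x _ r hr => ?_, fun x => ?_, ?_⟩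
  · have : ‖r • x‖⁻¹ • r • x = ‖x‖⁻¹ • x := by
      rw [norm_smul, Real.norm_of_nonneg hr.le, smul_smul]
      congr 1
      field_simp
    simp only [this]
  · dsimp only
    split_ifs with h
    · exact h.le
    · simpa using hA
  · filter_upwards [ae_eq_comp_normalize hd hΩ hae] with x hx
    rw [hx]

theorem half_omegaL1_le_constCOmega (hΩ : OmegaHyp d Ω) :
    omegaL1 d Ω / 2 ≤ constCOmega d Ω := by
  have h1 : omegaL1 d Ω / 2 ≤ omegaLlogL d Ω := by
    rw [omegaL1, omegaLlogL, sphInt, sphInt, ← integral_div]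
    refine integral_mono (hΩ.2.1.abs.div_const 2) hΩ.2.2.2 fun θ => ?_
    have h2 : Real.log 2 ≤ Real.log (2 + |Ω θ|) :=
      Real.log_le_log (by norm_num) (by linarith [abs_nonneg (Ω θ)])
    have h3 := Real.log_two_gt_d9
    have h4 : 1 / 2 ≤ Real.log (2 + |Ω θ|) := by norm_num at h3; linarith
    have h5 := mul_le_mul_of_nonneg_left h4 (abs_nonneg (Ω θ))
    dsimp only
    linarith
  have h6 : 0 ≤ sphInt d (fun x => |Ω x| * (1 + max (Real.log (|Ω x| / omegaL1 d Ω)) 0)) :=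
    integral_nonneg fun θ => mul_nonneg (abs_nonneg _)
      (add_nonneg zero_le_one (le_max_right _ _))
  rw [constCOmega]
  linarith

theorem omegaL1_nonneg : 0 ≤ omegaL1 d Ω := integral_nonneg fun _ => abs_nonneg _

variable {w : Fin d → ℝ} {s : ℕ} {Qset : Set (ℤ × (Fin d → ℤ))}
  {b b' : ℤ × (Fin d → ℤ) → Rd d → ℝ} {COm Cc c₁ c₂ lam : ℝ} {f : Rd d → ℝ}

/-- The bad functions can be chosen Borel measurable. -/
theorem exists_measurable_atoms (h : CZData d COm Cc c₁ c₂ f lam Qset b) :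
    ∃ b' : ℤ × (Fin d → ℤ) → Rd d → ℝ, (∀ c, Measurable (b' c)) ∧
      (∀ c, Integrable (b' c)) ∧ (∀ c ∈ Qset, Function.support (b' c) ⊆ dcube d 0 c.1 c.2) ∧
      ∀ c ∈ Qset, b' c =ᵐ[volume] b c := by
  have key : ∀ c : ℤ × (Fin d → ℤ), ∃ g : Rd d → ℝ, Measurable g ∧ Integrable g ∧
      (c ∈ Qset → Function.support g ⊆ dcube d 0 c.1 c.2 ∧ g =ᵐ[volume] b c) := by
    intro c
    by_cases hc : c ∈ Qset
    · have hi := h.integrable c hc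
      set g := (dcube d 0 c.1 c.2).indicator (hi.1.aemeasurable.mk (b c)) with hg
      have hgm : Measurable g :=
        hi.1.aemeasurable.measurable_mk.indicator (measurableSet_dcube 0 c.1 c.2)
      have hae : g =ᵐ[volume] b c := by
        filter_upwards [hi.1.aemeasurable.ae_eq_mk] with x hx
        by_cases hxc : x ∈ dcube d 0 c.1 c.2
        · rw [hg, indicator_of_mem hxc, ← hx]
        · rw [hg, indicator_of_notMem hxc]
          by_contra h0
          exact hxc (h.support_subset c hc (Ne.symm h0))
      exact ⟨g, hgm, hi.congr hae.symm, fun _ => ⟨support_indicator_subset, hae⟩⟩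
    · exact ⟨fun _ => 0, measurable_const, integrable_zero _ _ _, fun hc' => absurd hc' hc⟩
  choose b' h1 h2 h3 using key
  exact ⟨b', h1, h2, fun c hc => (h3 c hc).1, fun c hc => (h3 c hc).2⟩

theorem AtomFamily.of_CZData (h : CZData d COm Cc c₁ c₂ f lam Qset b) (hCc : 0 ≤ Cc)
    (hα : 0 ≤ Cc * (c₂ * lam / COm)) (hm : ∀ c, Measurable (b' c)) (hi : ∀ c, Integrable (b' c))
    (hsupp : ∀ c ∈ Qset, Function.support (b' c) ⊆ dcube d 0 c.1 c.2)
    (hae : ∀ c ∈ Qset, b' c =ᵐ[volume] b c) {F : Finset (ℤ × (Fin d → ℤ))}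
    (hF : ∀ c ∈ F, c ∈ Qset) : AtomFamily d F b' (Cc * (c₂ * lam / COm)) where
  nonneg := hα
  disjoint := h.pairwise_disjoint.mono fun c hc => hF c hc
  support_subset c hc := hsupp c (hF c hc)
  measurable := hm
  integrable := hi
  integral_zero c hc := (integral_congr_ae (hae c (hF c hc))).trans (h.integral_zero c (hF c hc))
  bound c hc := by
    refine le_trans (le_of_eq (integral_congr_ae ?_)) (integral_abs_le h hCc (hF c hc))
    filter_upwards [hae c (hF c hc)] with x hx
    rw [hx]

theorem TKop_eq_sum_kconv {φ Om Om' : Rd d → ℝ} (hφ : AdmissiblePhi d φ) (hw : GridShift d w)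
    (hs : 2 ≤ s) (h : CZData d COm Cc c₁ c₂ f lam Qset b) (hi : ∀ c, Integrable (b' c))
    (hae : ∀ c ∈ Qset, b' c =ᵐ[volume] b c) (hOm : Om =ᵐ[volume] Om') (hOm' : Measurable Om')
    {A : ℝ} (hA : ∀ x, |Om' x| ≤ A) (K : ℤ × (Fin d → ℤ)) (x : Rd d) :
    TKop d φ Om w K.1 K.2 (bsum d Qset b (K.1 - (s:ℤ))) x =
      ∑ c ∈ atomIdx w s Qset K, kconv (Kker d φ Om' (c.1 + s)) (b' c) x := by
  obtain ⟨B, -, hB⟩ := AdmissiblePhi.exists_bound hφ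
  have e1 : ∑ c ∈ atomIdx w s Qset K, kconv (Kker d φ Om' (c.1 + s)) (b' c) x =
      ∫ y, ∑ c ∈ atomIdx w s Qset K, Kker d φ Om' K.1 (x - y) * b' c y := by
    rw [integral_finsetSum _ fun c _ => integrable_mul_of_bound (measurable_Kker hφ hOm' K.1)
      (hB Om' A hA K.1) (hi c) x]
    refine Finset.sum_congr rfl fun c hc => ?_
    rw [kconv, (mem_atomIdx.1 hc).2.1, sub_add_cancel]
  rw [e1, TKop]
  refine integral_congr_ae ?_
  have h1 : ∀ᵐ y : Rd d, Om (x - y) = Om' (x - y) :=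
    (Measure.measurePreserving_sub_left volume x).quasiMeasurePreserving.ae hOm
  have h2 : ∀ᵐ y : Rd d, ∀ c ∈ atomIdx w s Qset K, b' c y = b c y :=
    (Finset.eventually_all _).2 fun c hc => hae c (mem_atomIdx.1 hc).1
  filter_upwards [h1, h2] with y hy1 hy2
  rw [indicator_dhalf_bsum hw hs h.support_subset, ← Finset.mul_sum, Finset.sum_congr rfl hy2,
    Kker, Kker, hy1]

end MeasurableModification

/-- A bound for the maximal truncations of all finite sub-sums passes to the full series. -/
theorem lintegral_iSup_truncated_tsum_sq_le {α ι : Type*} [MeasurableSpace α] {μ : Measure α}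
    [Countable ι] {I : Set ι} {r : ι → ℤ} {h : ι → α → ℝ} (hm : ∀ K, AEMeasurable (h K) μ)
    (hfin : ∀ x l, {K | K ∈ I ∧ l ≤ r K ∧ h K x ≠ 0}.Finite) {R : ℝ≥0∞}
    (hR : ∀ J : Finset ι, (∀ K ∈ J, K ∈ I) →
      ∫⁻ x, (⨆ l : ℤ, ‖∑ K ∈ J with l ≤ r K, h K x‖ₑ ^ 2) ∂μ ≤ R) :
    ∫⁻ x, (⨆ l : ℤ, ‖∑' K, (I ∩ {K | l ≤ r K}).indicator (fun K => h K x) K‖ₑ ^ 2) ∂μ ≤ R := by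
  classical
  have := Encodable.ofCountable ι
  set J : ℕ → Finset ι := fun N => ((Finset.range N).preimage Encodable.encode
    Encodable.encode_injective.injOn).filter (· ∈ I) with hJ
  have hJI : ∀ N, ∀ K ∈ J N, K ∈ I := fun N K hK => (Finset.mem_filter.1 hK).2
  have hlim : ∀ x, (⨆ l : ℤ, ‖∑' K, (I ∩ {K | l ≤ r K}).indicator (fun K => h K x) K‖ₑ ^ 2) ≤
      Filter.liminf (fun N => ⨆ l : ℤ, ‖∑ K ∈ J N with l ≤ r K, h K x‖ₑ ^ 2) Filter.atTop := by
    intro x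
    refine iSup_le fun l => Filter.le_liminf_of_le (by isBoundedDefault) ?_
    obtain ⟨N, hN⟩ := ((hfin x l).image Encodable.encode).bddAbove
    filter_upwards [Filter.eventually_gt_atTop N] with M hM
    refine le_trans (le_of_eq ?_) (le_iSup _ l)
    congr 2
    rw [tsum_eq_sum (s := (J M).filter fun K => l ≤ r K)]
    · refine Finset.sum_congr rfl fun K hK => ?_
      obtain ⟨h1, h2⟩ := Finset.mem_filter.1 hK
      exact indicator_of_mem (s := I ∩ {K | l ≤ r K}) ⟨hJI M K h1, h2⟩ _
    · intro K hK
      by_contra h0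
      have h1 := mem_of_indicator_ne_zero h0
      rw [indicator_of_mem h1] at h0
      have h3 : K ∈ {K | K ∈ I ∧ l ≤ r K ∧ h K x ≠ 0} := ⟨h1.1, h1.2, h0⟩
      have h2 := hN (mem_image_of_mem _ h3)
      refine hK (Finset.mem_filter.2 ⟨Finset.mem_filter.2 ⟨?_, h1.1⟩, h1.2⟩)
      exact Finset.mem_preimage.2 (Finset.mem_range.2 (h2.trans_lt hM))
  refine (lintegral_mono hlim).trans ((lintegral_liminf_le' fun N => ?_).trans ?_)
  · exact AEMeasurable.iSup fun l =>
      (Finset.aemeasurable_fun_sum _ fun K _ => hm K).enorm.pow_const 2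
  · refine (Filter.liminf_le_liminf (Filter.Eventually.of_forall fun N => hR (J N) (hJI N))).trans ?_
    rw [Filter.liminf_const]

section Assembly

variable {d : ℕ} {φ Om Om' : Rd d → ℝ} {w : Fin d → ℝ} {s : ℕ} {Qset : Set (ℤ × (Fin d → ℤ))}
  {b b' : ℤ × (Fin d → ℤ) → Rd d → ℝ} {COm Cc c₁ c₂ lam A : ℝ} {f : Rd d → ℝ}

theorem aemeasurable_TKop (hφ : AdmissiblePhi d φ) (hw : GridShift d w)
    (hs : 2 ≤ s) (h : CZData d COm Cc c₁ c₂ f lam Qset b) (hOm : Om =ᵐ[volume] Om')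
    (hOm' : Measurable Om') (hA : ∀ x, |Om' x| ≤ A) (K : ℤ × (Fin d → ℤ)) :
    AEMeasurable fun x => TKop d φ Om w K.1 K.2 (bsum d Qset b (K.1 - (s:ℤ))) x := by
  obtain ⟨b', -, hi, -, hae⟩ := exists_measurable_atoms h
  simp only [TKop_eq_sum_kconv hφ hw hs h hi hae hOm hOm' hA]
  exact Finset.aemeasurable_fun_sum _ fun c _ =>
    (integrable_kconv (integrable_Kker hφ hOm' hA _) (hi c)).aemeasurable

theorem lintegral_iSup_truncated_TKop_sq_le (hφ : AdmissiblePhi d φ) (hw : GridShift d w)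
    (hs : 2 ≤ s) (h : CZData d COm Cc c₁ c₂ f lam Qset b) (hf : Integrable f)
    (hCc : 0 ≤ Cc) (hc₁ : 0 < c₁) (hc₂ : 0 ≤ c₂) (hα : 0 ≤ Cc * (c₂ * lam / COm))
    (hOm : Om =ᵐ[volume] Om') (hOm' : Measurable Om') (hA : ∀ x, |Om' x| ≤ A) {D : ℝ≥0∞}
    (hD : ∀ F b', AtomFamily d F b' (Cc * (c₂ * lam / COm)) →
      ∫⁻ x, ‖atomSum d φ Om' s F b' x‖ₑ ^ 2 ≤ D * ∑ c ∈ F, ∫⁻ y, ‖b' c y‖ₑ)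
    {m : ℕ} {J : Finset (ℤ × (Fin d → ℤ))}
    (hJ : ∀ K ∈ J, K ∈ Isharp d w Qset b s 4 (m + 1)) :
    4 ^ m * ∫⁻ x, (⨆ l : ℤ, ‖∑ K ∈ J with l ≤ K.1,
        TKop d φ Om w K.1 K.2 (bsum d Qset b (K.1 - (s:ℤ))) x‖ₑ ^ 2) ≤
      (2 * (d * s + 2 : ℕ) * (d * s + 2 : ℕ) + 2 * (d + 1 : ℕ)) * (D *
        (ENNReal.ofReal (Cc * c₂ / c₁) * ∫⁻ x, ‖f x‖ₑ)) := by
  classical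
  obtain ⟨b', hm, hi, hsupp, hae⟩ := exists_measurable_atoms h
  have hT := TKop_eq_sum_kconv hφ hw hs h hi hae hOm hOm' hA
  have hM : ∀ c ∈ Qset, ∫⁻ x, ‖b' c x‖ₑ = ∫⁻ x, ‖b c x‖ₑ := fun c hc =>
    lintegral_congr_ae (by filter_upwards [hae c hc] with x hx; rw [hx])
  have key := lintegral_iSup_truncated_sum_sq_le (J := J) (D := D)
    (h := fun K x => TKop d φ Om w K.1 K.2 (bsum d Qset b (K.1 - (s:ℤ))) x)
    (M := fun K => ∑ c ∈ atomIdx w s Qset K, ∫⁻ x, ‖b c x‖ₑ) hw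
    (fun K _ x hx => TKop_eq_zero_of_notMem hφ _ hx)
    (fun K hK => cubeRank_lt_of_mem_Isharp (Nat.le_add_left 1 m) hJ hK) (fun K => ?_)
    (fun S hS => ?_)
  · refine (mul_le_mul_right key _).trans ?_
    have h1 := sum_lintegral_atoms_le (m := m) hw hs h hf hCc hc₁ hc₂ (S := J)
      fun K hK => (hJ K hK).2.1
    rw [mul_left_comm, mul_left_comm (4 ^ m) D]
    exact mul_le_mul_right (mul_le_mul_right h1 _) _
  · exact aemeasurable_TKop hφ hw hs h hOm hOm' hA K
  · have hdisj : (S : Set (ℤ × (Fin d → ℤ))).PairwiseDisjoint (atomIdx w s Qset) :=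
      fun K _ K' _ hne => Finset.disjoint_left.2 fun c hc hc' =>
        hne (eq_of_mem_atomIdx hw hs hc hc')
    have h2 := hD (S.biUnion (atomIdx w s Qset)) b'
      (AtomFamily.of_CZData h hCc hα hm hi hsupp hae fun c hc => by
        obtain ⟨K, -, hK⟩ := Finset.mem_biUnion.1 hc
        exact (mem_atomIdx.1 hK).1)
    rw [Finset.sum_biUnion hdisj] at h2
    refine le_trans (le_of_eq (lintegral_congr fun x => ?_)) (h2.trans (le_of_eq ?_))
    · simp only [hT, atomSum]
      rw [Finset.sum_biUnion hdisj]
    · congr 1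
      exact Finset.sum_congr rfl fun K _ => Finset.sum_congr rfl fun c hc =>
        hM c (mem_atomIdx.1 hc).1

theorem finite_setOf_TKop_ne_zero (hφ : AdmissiblePhi d φ) {I : Set (ℤ × (Fin d → ℤ))} {N : ℤ}
    (hN : ∀ K ∈ I, K.1 ≤ N) (g : ℤ × (Fin d → ℤ) → Rd d → ℝ) (x : Rd d) (l : ℤ) :
    {K | K ∈ I ∧ l ≤ K.1 ∧ TKop d φ Om w K.1 K.2 (g K) x ≠ 0}.Finite := by
  have hx : ∀ K ∈ {K | K ∈ I ∧ l ≤ K.1 ∧ TKop d φ Om w K.1 K.2 (g K) x ≠ 0},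
      x ∈ dcube d w K.1 K.2 := fun K hK => by
    by_contra h0
    exact hK.2.2 (TKop_eq_zero_of_notMem hφ _ h0)
  refine Set.Finite.of_finite_image (f := Prod.fst) ((finite_Icc l N).subset ?_) ?_
  · rintro _ ⟨K, hK, rfl⟩
    exact ⟨hK.2.1, hN K hK.1⟩
  · intro K hK K' hK' he
    have h1 := hx K hK
    rw [he] at h1
    exact Prod.ext he (eq_of_mem_dcube h1 (hx K' hK'))

theorem truncation_constant_le {C L : ℝ} (hC : 0 ≤ C) (hCc : 0 ≤ Cc) (hc₂ : 0 ≤ c₂)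
    (hlam : 0 ≤ lam) (hL : 0 ≤ L) (hCOm : 0 < COm) (hLC : L / 2 ≤ COm) (s : ℕ) :
    C * ((2:ℝ) ^ ((1 / 8 : ℝ) * s) * L) ^ 2 *
        ((2:ℝ) ^ (-((s / 2 : ℕ) : ℤ)) + (2:ℝ) ^ (((s / 2 : ℕ) : ℤ) - s)) *
        (Cc * (c₂ * lam / COm)) ≤
      12 * C * Cc * c₂ * ((2:ℝ) ^ (-(1 / 4 : ℝ) * s) * lam * COm) := by
  have h2 : (0:ℝ) < 2 := by norm_num
  have hp1 : ((s / 2 : ℕ) : ℝ) ≤ s / 2 := Nat.cast_div_le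
  have hp2 : (s : ℝ) / 2 - 1 ≤ ((s / 2 : ℕ) : ℝ) := by
    have : s ≤ 2 * (s / 2) + 1 := by omega
    have : (s : ℝ) ≤ 2 * ((s / 2 : ℕ) : ℝ) + 1 := by exact_mod_cast this
    linarith
  have e1 : (2:ℝ) ^ (-((s / 2 : ℕ) : ℤ)) ≤ 2 * (2:ℝ) ^ (-(1 / 2 : ℝ) * s) := by
    have e : 2 * (2:ℝ) ^ (-(1 / 2 : ℝ) * s) = (2:ℝ) ^ (1 + -(1 / 2 : ℝ) * s) := by
      rw [Real.rpow_add h2, Real.rpow_one]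
    rw [← Real.rpow_intCast, e]
    refine Real.rpow_le_rpow_of_exponent_le (by norm_num) ?_
    rw [Int.cast_neg, Int.cast_natCast]
    linarith
  have e2 : (2:ℝ) ^ (((s / 2 : ℕ) : ℤ) - s) ≤ (2:ℝ) ^ (-(1 / 2 : ℝ) * s) := by
    rw [← Real.rpow_intCast]
    refine Real.rpow_le_rpow_of_exponent_le (by norm_num) ?_
    rw [Int.cast_sub, Int.cast_natCast, Int.cast_natCast]
    linarith
  have e3 : ((2:ℝ) ^ ((1 / 8 : ℝ) * s)) ^ 2 * (2:ℝ) ^ (-(1 / 2 : ℝ) * s) =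
      (2:ℝ) ^ (-(1 / 4 : ℝ) * s) := by
    rw [← Real.rpow_natCast, ← Real.rpow_mul h2.le, ← Real.rpow_add h2]
    congr 1
    push_cast
    ring
  have e4 : L ^ 2 ≤ 4 * COm ^ 2 := by nlinarith
  set t := (2:ℝ) ^ ((1 / 8 : ℝ) * s) with ht
  set u := (2:ℝ) ^ (-(1 / 2 : ℝ) * s) with hu
  have hu0 : 0 < u := by positivity
  calc _ ≤ C * (t * L) ^ 2 * (2 * u + u) * (Cc * (c₂ * lam / COm)) := by
        gcongr
    _ = 3 * C * Cc * c₂ * ((t ^ 2 * u) * lam * (L ^ 2 / COm)) := by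
        field_simp
        ring
    _ ≤ 3 * C * Cc * c₂ * ((t ^ 2 * u) * lam * (4 * COm)) := by
        have : L ^ 2 / COm ≤ 4 * COm := by
          rw [div_le_iff₀ hCOm]; linarith
        gcongr
    _ = _ := by rw [e3]; ring

end Assembly

theorem rpow_half_le_ofReal {T : ℝ≥0∞} {Y : ℝ} (hY : 0 ≤ Y) (h : T ≤ ENNReal.ofReal (Y ^ 2)) :
    T ^ (1 / 2 : ℝ) ≤ ENNReal.ofReal Y := by
  refine (ENNReal.rpow_le_rpow h (by norm_num)).trans (le_of_eq ?_)
  rw [ENNReal.ofReal_rpow_of_nonneg (sq_nonneg Y) (by norm_num), ← Real.sqrt_eq_rpow,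
    Real.sqrt_sq hY]

theorem le_ofReal_div_of_mul_le {T : ℝ≥0∞} {Z : ℝ} {m : ℕ} (h : 4 ^ m * T ≤ ENNReal.ofReal Z) :
    T ≤ ENNReal.ofReal (Z / 4 ^ m) := by
  rw [ENNReal.ofReal_div_of_pos (by positivity), ENNReal.ofReal_pow (by norm_num),
    ENNReal.le_div_iff_mul_le (by simp) (by simp), mul_comm]
  simpa using h

theorem height_constant_le (d : ℕ) {s : ℕ} (hs : 2 ≤ s) :
    2 * ((d * s + 2 : ℕ) : ℝ) * (d * s + 2 : ℕ) + 2 * (d + 1 : ℕ) ≤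
      4 * ((d:ℝ) + 1) ^ 2 * (s:ℝ) ^ 2 := by
  have hs' : (2:ℝ) ≤ s := by exact_mod_cast hs
  have hd : (0:ℝ) ≤ d := Nat.cast_nonneg d
  have h1 : ((d * s + 2 : ℕ) : ℝ) ≤ (d + 1) * s := by push_cast; linarith
  have h2 : ((d * s + 2 : ℕ) : ℝ) * (d * s + 2 : ℕ) ≤ ((d + 1) * s) * ((d + 1) * s) := by
    gcongr
  have h3 : ((d:ℝ) + 1) ≤ ((d + 1) * s) * ((d + 1) * s) := by
    have h4 : (1:ℝ) ≤ (d + 1) * s := by nlinarith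
    nlinarith
  push_cast at h2 ⊢
  nlinarith

end RoughSingular

/-- The key decay estimate for the maximal sums over the partition classes `𝓘_s^{#,n}`. -/
theorem Isharp_maximal_l2_bound :
    ∀ d : ℕ, 2 ≤ d →
    ∀ Cc c₁ c₂ : ℝ, 0 < Cc → 0 < c₁ → 0 < c₂ →
    ∀ φ : Rd d → ℝ, AdmissiblePhi d φ →
    ∃ η : ℝ, 0 < η ∧ ∃ δ : ℝ, 0 < δ ∧ ∃ C₀ : ℝ, 0 < C₀ ∧ ∃ C' : ℝ, 0 < C' ∧
      ∀ Ω : Rd d → ℝ, OmegaHyp d Ω →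
      ∀ f : Rd d → ℝ, Integrable f →
      ∀ lam : ℝ, 0 < lam →
      ∀ (Qset : Set (ℤ × (Fin d → ℤ))) (b : ℤ × (Fin d → ℤ) → Rd d → ℝ),
        CZData d (constCOmega d Ω) Cc c₁ c₂ f lam Qset b →
      ∀ s : ℕ, 200 ≤ s →
      ∀ w : Fin d → ℝ, GridShift d w →
      ∀ n : ℕ, 1 ≤ n →
        (∫⁻ x : Rd d,
            (⨆ l : ℤ, ENNReal.ofReal
              |∑' km : ℤ × (Fin d → ℤ),
                  Set.indicator
                    (Isharp d w Qset b s C₀ n ∩ {km' : ℤ × (Fin d → ℤ) | l ≤ km'.1})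
                    (fun km' => TKop d φ (Omega2 d Ω η s) w km'.1 km'.2
                      (bsum d Qset b (km'.1 - (s : ℤ))) x) km|) ^ (2:ℝ)) ^ (1/2 : ℝ) ≤
          ENNReal.ofReal (C' * (2:ℝ) ^ (-(n:ℤ)) * Real.sqrt ((s:ℝ)^2 * (2:ℝ) ^ (-δ * s) *
            lam * constCOmega d Ω * ∫ x : Rd d, |f x|)) := by
  intro d hd Cc c₁ c₂ hCc hc₁ hc₂ φ hφ
  have hd1 : 1 ≤ d := by omega
  obtain ⟨C, hC, hbound⟩ := RoughSingular.exists_atomSum_bound hφ hd1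
  set R : ℝ := 192 * ((d:ℝ) + 1) ^ 2 * C * Cc ^ 2 * c₂ ^ 2 / c₁ with hR
  have hR0 : 0 < R := by positivity
  refine ⟨1 / 8, by norm_num, 1 / 4, by norm_num, 4, by norm_num, Real.sqrt R,
    Real.sqrt_pos.2 hR0, ?_⟩
  intro Ω hΩ f hf lam hlam Qset b hCZ s hs w hw n hn
  refine RoughSingular.rpow_half_le_ofReal (by positivity) ?_
  have hL0 : 0 ≤ omegaL1 d Ω := RoughSingular.omegaL1_nonneg
  rcases hL0.eq_or_lt with hL | hL
  · have h0 : Omega2 d Ω (1 / 8) s = fun _ => 0 := by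
      funext x
      rw [Omega2, ← hL, mul_zero, if_neg (abs_nonneg _).not_gt]
    have h1 : ∀ (k : ℤ) (m : Fin d → ℤ) (g : Rd d → ℝ) (x : Rd d),
        TKop d φ (Omega2 d Ω (1 / 8) s) w k m g x = 0 := fun k m g x => by
      simp only [TKop, Kker, h0, mul_zero, zero_mul, integral_zero]
    simp only [h1, indicator_zero, tsum_zero, abs_zero, ENNReal.ofReal_zero]
    simp
  obtain ⟨m, rfl⟩ := Nat.exists_eq_add_of_le' hn
  have hLC := RoughSingular.half_omegaL1_le_constCOmega hΩ
  have hCOm : 0 < constCOmega d Ω := by linarith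
  set F : ℝ := ∫ x : Rd d, |f x| with hF
  have hF0 : 0 ≤ F := integral_nonneg fun x => abs_nonneg (f x)
  have hFe : ∫⁻ x, ‖f x‖ₑ = ENNReal.ofReal F :=
    (ofReal_integral_norm_eq_lintegral_enorm hf).symm
  set A : ℝ := (2:ℝ) ^ ((1 / 8 : ℝ) * s) * omegaL1 d Ω with hA
  have hA0 : 0 ≤ A := by positivity
  obtain ⟨Om', hOm'm, hOm'h, hOm'A, hOm'ae⟩ :=
    RoughSingular.exists_measurable_truncation hd1 hΩ.1 hΩ.2.1.1 hA0
  set X : ℝ := (2:ℝ) ^ (-(1 / 4 : ℝ) * s) * lam * constCOmega d Ω with hX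
  have hX0 : 0 < X := by positivity
  set D : ℝ := 12 * C * Cc * c₂ * X with hD
  have hα : 0 ≤ Cc * (c₂ * lam / constCOmega d Ω) := by positivity
  have hDb : ∀ F b', RoughSingular.AtomFamily d F b' (Cc * (c₂ * lam / constCOmega d Ω)) →
      ∫⁻ x, ‖RoughSingular.atomSum d φ Om' s F b' x‖ₑ ^ 2 ≤
        ENNReal.ofReal D * ∑ c ∈ F, ∫⁻ y, ‖b' c y‖ₑ := fun F b' hFb =>
    (hbound Om' A (s / 2) s F b' _ hOm'm hOm'h hOm'A (by omega) (by omega) hFb).trans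
      (mul_le_mul_left (ENNReal.ofReal_le_ofReal (RoughSingular.truncation_constant_le hC.le
        hCc.le hc₂.le hlam.le hL0 hCOm hLC s)) _)
  obtain ⟨N, hN⟩ := RoughSingular.exists_scale_bound (w := w) (s := s) hd1 hw (by omega) hCZ hf
    (by positivity) 4 (m + 1)
  have hfinal : ∀ J : Finset (ℤ × (Fin d → ℤ)), (∀ K ∈ J, K ∈ Isharp d w Qset b s 4 (m + 1)) →
      ∫⁻ x, (⨆ l : ℤ, ‖∑ K ∈ J with l ≤ K.1, TKop d φ (Omega2 d Ω (1 / 8) s) w K.1 K.2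
        (bsum d Qset b (K.1 - (s:ℤ))) x‖ₑ ^ 2) ≤
      ENNReal.ofReal (4 * ((d:ℝ) + 1) ^ 2 * (s:ℝ) ^ 2 * (D * (Cc * c₂ / c₁ * F)) / 4 ^ m) := by
    intro J hJ
    refine RoughSingular.le_ofReal_div_of_mul_le
      ((RoughSingular.lintegral_iSup_truncated_TKop_sq_le hφ hw (by omega) hCZ hf hCc.le hc₁
        hc₂.le hα hOm'ae hOm'm hOm'A hDb hJ).trans ?_)
    rw [hFe, ← ENNReal.ofReal_mul (by positivity), ← ENNReal.ofReal_mul (by positivity),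
      ENNReal.ofReal_mul (p := 4 * ((d:ℝ) + 1) ^ 2 * (s:ℝ) ^ 2) (by positivity)]
    refine mul_le_mul_left (le_trans (le_of_eq ?_) (ENNReal.ofReal_le_ofReal
      (RoughSingular.height_constant_le d (by omega : 2 ≤ s)))) _
    rw [ENNReal.ofReal_add (by positivity) (by positivity), ENNReal.ofReal_mul (by positivity),
      ENNReal.ofReal_mul (by positivity), ENNReal.ofReal_mul (by positivity)]
    simp only [ENNReal.ofReal_natCast, ENNReal.ofReal_ofNat]
  have hmain := RoughSingular.lintegral_iSup_truncated_tsum_sq_le (μ := volume)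
    (I := Isharp d w Qset b s 4 (m + 1)) (r := Prod.fst) (fun K => ?_)
    (RoughSingular.finite_setOf_TKop_ne_zero (Om := Omega2 d Ω (1 / 8) s) (w := w) hφ hN
      fun K => bsum d Qset b (K.1 - (s:ℤ))) hfinal
  · refine le_trans (le_of_eq (lintegral_congr fun x => ?_)) (hmain.trans
      (ENNReal.ofReal_le_ofReal (le_of_eq ?_)))
    · rw [ENNReal.rpow_ofNat, ENNReal.iSup_pow]
      simp only [Real.enorm_eq_ofReal_abs]
    · rw [mul_pow, mul_pow, Real.sq_sqrt hR0.le, Real.sq_sqrt (by positivity), hR, hD]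
      rw [show (s:ℝ) ^ 2 * (2:ℝ) ^ (-(1 / 4 : ℝ) * s) * lam * constCOmega d Ω * F =
        (s:ℝ) ^ 2 * X * F by rw [hX]; ring]
      have e : ((2:ℝ) ^ (-((m + 1 : ℕ) : ℤ))) ^ 2 = 1 / (4 * 4 ^ m) := by
        rw [zpow_neg, zpow_natCast, inv_pow, ← pow_mul, mul_comm (m + 1), pow_mul, pow_succ]
        norm_num [mul_comm]
      rw [e]
      field_simp
      ring
  · exact RoughSingular.aemeasurable_TKop hφ hw (by omega) hCZ hOm'ae hOm'm hOm'A K
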